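/- Almost all perfect graphs are 2-clique-colourable; more precisely, there exist c > 0 and n₀ such that for all n ≥ n₀, the probability that a graph P_n sampled uniformly at random from 𝒫_n admits a 2-clique-colouring is at least 1 − 2^{−c·(log₂ n)²}. -/

import Mathlib

open scoped Classical
open Filter

noncomputable section

/-- A finite simple graph is perfect if every induced subgraph has chromatic number
equal to clique number. -/
def IsPerfect {V : Type*} (G : SimpleGraph V) : Prop :=
  ∀ s : Set V, (G.induce s).chromaticNumber = ((G.induce s).cliqueNum : ℕ∞)

/-- `(G, C)` is a unipolar arrangement: `C` is a clique (the central clique) and every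
connected component of the subgraph induced on the complement of `C` is a clique. -/
def IsUnipolarArrangement {V : Type*} (G : SimpleGraph V) (C : Set V) : Prop :=
  G.IsClique C ∧
    ∀ u v : (Cᶜ : Set V), (G.induce Cᶜ).Reachable u v → u ≠ v → (G.induce Cᶜ).Adj u v

def IsUnipolar {V : Type*} (G : SimpleGraph V) : Prop :=
  ∃ C : Set V, IsUnipolarArrangement G C

def IsCoUnipolar {V : Type*} (G : SimpleGraph V) : Prop := IsUnipolar Gᶜ

def IsGenSplit {V : Type*} (G : SimpleGraph V) : Prop := IsUnipolar G ∨ IsCoUnipolar G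

/-- the `m`-th Bell number: the number of partitions of an `m`-element set. -/
def bell (m : ℕ) : ℕ := Nat.card (Finpartition (Finset.univ : Finset (Fin m)))

/-- `ℓ_{n,k} = C(n,k) · 2^{k(n-k)} · B_{n-k}` -/
def ell (n k : ℕ) : ℕ := Nat.choose n k * 2 ^ (k * (n - k)) * bell (n - k)

/-- `𝓛_n = Σ_{k=0}^n ℓ_{n,k}` -/
def scrL (n : ℕ) : ℕ := ∑ k ∈ Finset.range (n + 1), ell n k

/-- the number of perfect graphs on `{1,…,n}` -/
def perfectCount (n : ℕ) : ℕ := Nat.card {G : SimpleGraph (Fin n) // IsPerfect G}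

/-- independence number -/
def indepNum {V : Type*} (G : SimpleGraph V) : ℕ := Gᶜ.cliqueNum

/-- A 2-clique-colouring of `G`: a colouring of the vertices with two colours such that no
inclusion-maximal clique with at least two vertices is monochromatic. -/
def TwoCliqueColourable {V : Type*} (G : SimpleGraph V) : Prop :=
  ∃ f : V → Fin 2, ∀ s : Set V, G.IsClique s →
    (∀ t : Set V, G.IsClique t → s ⊆ t → t = s) → s.Nontrivial →
    ∃ u ∈ s, ∃ v ∈ s, f u ≠ f v

/-- The number of elements of a finite type satisfying a predicate, as a real number. -/
def cnt {α : Type*} (P : α → Prop) : ℝ := (Set.ncard {x | P x} : ℝ)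

section cnt
variable {α β ι : Type*}

theorem cnt_nonneg (P : α → Prop) : 0 ≤ cnt P := Nat.cast_nonneg _

theorem cnt_mono [Finite α] {P Q : α → Prop} (h : ∀ x, P x → Q x) : cnt P ≤ cnt Q := by
  unfold cnt
  exact_mod_cast Set.ncard_le_ncard (fun x hx => h x hx) (Set.toFinite _)

theorem cnt_or [Finite α] (P Q : α → Prop) : cnt (fun x => P x ∨ Q x) ≤ cnt P + cnt Q := by
  unfold cnt
  exact_mod_cast Set.ncard_union_le {x | P x} {x | Q x}

theorem cnt_eq_card_filter [Fintype α] (P : α → Prop) [DecidablePred P] :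
    cnt P = ((Finset.univ.filter P).card : ℝ) := by
  unfold cnt
  rw [← Set.ncard_coe_finset]
  congr 2
  ext x; simp

theorem cnt_fiber [Finite α] [Finite β] {P : α → Prop} {Q : β → Prop} (f : α → β) {M : ℝ}
    (hf : ∀ x, P x → Q (f x)) (hM : ∀ b, Q b → cnt (fun x => P x ∧ f x = b) ≤ M) :
    cnt P ≤ cnt Q * M := by
  have := Fintype.ofFinite α
  have := Fintype.ofFinite β
  rw [cnt_eq_card_filter, cnt_eq_card_filter]
  rw [Finset.card_eq_sum_card_fiberwise (f := f) (t := Finset.univ.filter Q)]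
  · push_cast
    rw [← nsmul_eq_mul]
    apply Finset.sum_le_card_nsmul
    intro b hb
    have := hM b (by simpa using hb)
    rw [cnt_eq_card_filter] at this
    rwa [Finset.filter_filter]
  · intro x hx
    have hx' : P x := by simpa using hx
    simpa using hf x hx'

theorem cnt_inj [Finite α] [Finite β] {P : α → Prop} {Q : β → Prop} (f : α → β)
    (hf : ∀ x, P x → Q (f x)) (hi : ∀ x y, P x → P y → f x = f y → x = y) :
    cnt P ≤ cnt Q := by
  unfold cnt
  exact_mod_cast Set.ncard_le_ncard_of_injOn f (fun x hx => hf x hx)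
    (fun x hx y hy h => hi x y hx hy h) (Set.toFinite _)

theorem cnt_exists [Finite α] [Finite ι] {R : ι → Prop} {P : ι → α → Prop} {M : ℝ}
    (hM : ∀ i, R i → cnt (P i) ≤ M) :
    cnt (fun x => ∃ i, R i ∧ P i x) ≤ cnt R * M := by
  have h1 : cnt (fun x => ∃ i, R i ∧ P i x) ≤ cnt (fun p : ι × α => R p.1 ∧ P p.1 p.2) := by
    have := Fintype.ofFinite α
    have := Fintype.ofFinite ι
    rw [cnt_eq_card_filter, cnt_eq_card_filter]
    norm_cast
    refine le_trans (Finset.card_le_card ?_) (Finset.card_image_le (f := Prod.snd))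
    intro x hx
    simp only [Finset.mem_filter, Finset.mem_univ, true_and] at hx
    obtain ⟨i, hi⟩ := hx
    rw [Finset.mem_image]
    exact ⟨(i, x), by simpa using hi, rfl⟩
  refine h1.trans (cnt_fiber Prod.fst (fun x hx => hx.1) ?_)
  intro i hi
  refine le_trans (cnt_inj (Q := P i) Prod.snd ?_ ?_) (hM i hi)
  · rintro ⟨a, b⟩ ⟨⟨_, h2⟩, h3⟩
    subst h3; exact h2
  · rintro ⟨a, b⟩ ⟨c, d⟩ ⟨⟨_, _⟩, h3⟩ ⟨_, h4⟩ h5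
    simp only at h3 h4 h5
    rw [h3, h4, h5]

theorem cnt_true [Fintype α] : cnt (fun _ : α => True) = Fintype.card α := by
  rw [cnt_eq_card_filter]; simp

theorem cnt_le_card [Fintype α] (P : α → Prop) : cnt P ≤ Fintype.card α := by
  rw [← cnt_true]; exact cnt_mono (fun _ _ => trivial)

theorem cnt_congr {P Q : α → Prop} (h : ∀ x, P x ↔ Q x) : cnt P = cnt Q := by
  have : P = Q := funext fun x => propext (h x)
  rw [this]

theorem cnt_pi {V : Type*} [Fintype V] {α : Type*} [Fintype α] (opt : V → α → Prop) :
    cnt (fun T : V → α => ∀ v, opt v (T v)) = ∏ v, cnt (opt v) := by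
  rw [cnt_eq_card_filter]
  have : (Finset.univ.filter fun T : V → α => ∀ v, opt v (T v)) =
      Fintype.piFinset (fun v => Finset.univ.filter (opt v)) := by
    ext T; simp [Fintype.mem_piFinset]
  rw [this, Fintype.card_piFinset]
  push_cast
  refine Finset.prod_congr rfl fun v _ => ?_
  rw [cnt_eq_card_filter]

theorem cnt_finset_subset [Fintype α] (S : Finset α) :
    cnt (fun X : Finset α => X ⊆ S) = 2 ^ S.card := by
  rw [cnt_eq_card_filter]
  have : (Finset.univ.filter fun X : Finset α => X ⊆ S) = S.powerset := by
    ext X; simp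
  rw [this, Finset.card_powerset]; push_cast; rfl

theorem cnt_equiv [Finite α] [Finite β] {P : α → Prop} {Q : β → Prop} (e : α ≃ β)
    (h : ∀ x, P x ↔ Q (e x)) : cnt P = cnt Q := by
  apply le_antisymm
  · exact cnt_inj e (fun x hx => (h x).1 hx) (fun x y _ _ hxy => e.injective hxy)
  · exact cnt_inj e.symm (fun x hx => (h _).2 (by simpa using hx))
      (fun x y _ _ hxy => e.symm.injective hxy)

theorem cnt_prod [Finite α] [Finite β] (P : α → Prop) (Q : β → Prop) :
    cnt (fun x : α × β => P x.1 ∧ Q x.2) = cnt P * cnt Q := by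
  have := Fintype.ofFinite α
  have := Fintype.ofFinite β
  rw [cnt_eq_card_filter, cnt_eq_card_filter, cnt_eq_card_filter]
  rw [← Nat.cast_mul, ← Finset.card_product]
  congr 2
  ext x; simp

theorem cnt_pos_of [Finite α] {P : α → Prop} (x : α) (h : P x) : 1 ≤ cnt P := by
  unfold cnt
  have : 0 < Set.ncard {x | P x} := (Set.ncard_pos (Set.toFinite _)).2 ⟨x, h⟩
  exact_mod_cast this

/-- Each value satisfying `Q` has at least `M` preimages -/
theorem cnt_fiber_ge [Finite α] [Finite β] {P : α → Prop} {Q : β → Prop} (f : α → β) {M : ℝ}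
    (hM : ∀ b, Q b → M ≤ cnt (fun x => P x ∧ f x = b)) :
    cnt Q * M ≤ cnt P := by
  have := Fintype.ofFinite α
  have := Fintype.ofFinite β
  have h1 : cnt (fun x => P x ∧ Q (f x)) ≤ cnt P := cnt_mono (fun x hx => hx.1)
  refine le_trans ?_ h1
  rw [cnt_eq_card_filter, cnt_eq_card_filter]
  rw [Finset.card_eq_sum_card_fiberwise (f := f) (t := Finset.univ.filter Q)]
  · push_cast
    rw [← nsmul_eq_mul]
    apply Finset.card_nsmul_le_sum
    intro b hb
    have hb' : Q b := by simpa using hb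
    have := hM b hb'
    rw [cnt_eq_card_filter] at this
    rw [Finset.filter_filter]
    refine this.trans (le_of_eq ?_)
    congr 2
    ext x
    simp only [Finset.mem_filter, Finset.mem_univ, true_and]
    constructor
    · rintro ⟨h1, h2⟩; exact ⟨⟨h1, h2 ▸ hb'⟩, h2⟩
    · rintro ⟨⟨h1, _⟩, h2⟩; exact ⟨h1, h2⟩
  · intro x hx
    simp at hx ⊢
    exact hx.2
end cnt

/-- The number of subsets of size at most `d` of an `n`-element set. -/
def ballCard (n d : ℕ) : ℝ := ∑ i ∈ Finset.range (d + 1), (n.choose i : ℝ)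

theorem cnt_card_le {V : Type*} [Fintype V] (d : ℕ) :
    cnt (fun X : Finset V => X.card ≤ d) = ballCard (Fintype.card V) d := by
  rw [cnt_eq_card_filter, ballCard]
  rw [Finset.card_eq_sum_card_fiberwise (f := Finset.card) (t := Finset.range (d+1))]
  · push_cast
    refine Finset.sum_congr rfl fun i hi => ?_
    rw [← Finset.card_univ, ← Finset.card_powersetCard, Finset.filter_filter]
    congr 2
    ext X
    simp only [Finset.mem_filter, Finset.mem_univ, true_and, Finset.mem_powersetCard, Finset.subset_univ]
    constructor
    · rintro ⟨_, h⟩; exact h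
    · rintro h; exact ⟨by rw [h]; simpa [Nat.lt_succ_iff] using hi, h⟩
  · intro X hX
    simp at hX ⊢
    omega

theorem ballCard_pos (n d : ℕ) : 1 ≤ ballCard n d := by
  unfold ballCard
  rw [Finset.sum_range_succ']
  simp
  exact Finset.sum_nonneg fun i _ => by positivity

theorem ballCard_le_exp (n d : ℕ) {x : ℝ} (hx : 0 < x) (hx1 : x ≤ 1) :
    ballCard n d ≤ (1 + x) ^ n * x⁻¹ ^ d := by
  have h1 : ballCard n d * x ^ d ≤ (1 + x) ^ n := by
    unfold ballCard
    rw [Finset.sum_mul, add_comm 1 x, add_pow]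
    calc ∑ i ∈ Finset.range (d+1), (n.choose i : ℝ) * x ^ d
        ≤ ∑ i ∈ Finset.range (d+1), (n.choose i : ℝ) * x ^ i := by
          refine Finset.sum_le_sum fun i hi => ?_
          apply mul_le_mul_of_nonneg_left _ (by positivity)
          exact pow_le_pow_of_le_one hx.le hx1 (by simp at hi; omega)
      _ ≤ ∑ i ∈ Finset.range (max d n + 1), (n.choose i : ℝ) * x ^ i := by
          apply Finset.sum_le_sum_of_subset_of_nonneg
          · intro i hi; simp at hi ⊢; omega
          · intros; positivity
      _ = ∑ i ∈ Finset.range (n + 1), (n.choose i : ℝ) * x ^ i := by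
          symm
          apply Finset.sum_subset
          · intro i hi; simp at hi ⊢; omega
          · intro i _ hi
            simp at hi
            rw [Nat.choose_eq_zero_of_lt (by omega)]; simp
      _ = _ := by
          refine Finset.sum_congr rfl fun i _ => ?_
          simp; ring
  rw [inv_pow, ← div_eq_mul_inv, le_div_iff₀ (by positivity)]
  exact h1

/-- Balls of small linear radius have subexponential size -/
theorem ballCard_small {κ : ℝ} (hκ : 0 < κ) : ∃ lam : ℝ, 0 < lam ∧ lam ≤ 1 ∧
    ∀ n d : ℕ, (d : ℝ) ≤ lam * n → ballCard n d ≤ (2 : ℝ) ^ (κ * n) := by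
  obtain ⟨x, hx0, hx1, hx⟩ : ∃ x : ℝ, 0 < x ∧ x ≤ 1 ∧ 1 + x ≤ 2 ^ (κ/2) := by
    have : 1 < (2:ℝ) ^ (κ/2) := Real.one_lt_rpow (by norm_num) (by linarith)
    refine ⟨min 1 (2 ^ (κ/2) - 1), ?_, min_le_left _ _, ?_⟩
    · simp; linarith
    · have := min_le_right 1 ((2:ℝ) ^ (κ/2) - 1); linarith
  set L := Real.logb 2 x⁻¹ with hL
  have hLx : (2:ℝ) ^ L = x⁻¹ := Real.rpow_logb (by norm_num) (by norm_num) (by positivity)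
  have hL0 : 0 ≤ L := Real.logb_nonneg (by norm_num) (one_le_inv₀ hx0 |>.2 hx1)
  refine ⟨min 1 (κ / 2 / (L + 1)), by positivity, min_le_left _ _, ?_⟩
  intro n d hd
  refine (ballCard_le_exp n d hx0 hx1).trans ?_
  rw [← hLx, ← Real.rpow_natCast, ← Real.rpow_natCast ((2:ℝ)^L), ← Real.rpow_mul (by norm_num)]
  calc (1 + x) ^ (n:ℝ) * 2 ^ (L * d) ≤ (2 ^ (κ/2)) ^ (n:ℝ) * 2 ^ (L * d) := by gcongr
    _ = 2 ^ (κ / 2 * n + L * d) := by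
      rw [← Real.rpow_mul (by norm_num), ← Real.rpow_add (by norm_num)]
    _ ≤ _ := by
      apply Real.rpow_le_rpow_of_exponent_le (by norm_num)
      have h1 : (d:ℝ) ≤ κ / 2 / (L + 1) * n := hd.trans (by gcongr; exact min_le_right _ _)
      have h2 : L * d ≤ κ / 2 * n := by
        calc L * d ≤ (L+1) * (κ / 2 / (L + 1) * n) := by gcongr; linarith
          _ = κ / 2 * n := by field_simp
      linarith

section basic
variable {V W : Type*}

/-- A homogeneous set: a clique or an independent set. -/
def Hom (G : SimpleGraph V) (Q : Finset V) : Prop := G.IsClique ↑Q ∨ Gᶜ.IsClique ↑Q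

/-- No induced path on three vertices inside `X`. -/
def PFree (G : SimpleGraph V) (X : Set V) : Prop :=
  ∀ ⦃u v w : V⦄, u ∈ X → v ∈ X → w ∈ X → G.Adj u v → G.Adj v w → u ≠ w → G.Adj u w

def Clean (G : SimpleGraph V) (X : Set V) : Prop := PFree G X ∨ PFree Gᶜ X

/-- No induced five-cycle. -/
def NoC5 (G : SimpleGraph V) : Prop :=
  ∀ a b c d e : V, G.Adj a b → G.Adj b c → G.Adj c d → G.Adj d e → G.Adj e a →
    ¬ G.Adj a c → ¬ G.Adj a d → ¬ G.Adj b d → ¬ G.Adj b e → ¬ G.Adj c e → False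

/-- The hereditary class containing all perfect graphs with which we work. -/
structure InF (G : SimpleGraph V) : Prop where
  hom : ∀ X : Finset V, ∃ Q ⊆ X, Hom G Q ∧ X.card ≤ Q.card ^ 2
  noC5 : NoC5 G

theorem Hom.compl {G : SimpleGraph V} {Q : Finset V} (h : Hom G Q) : Hom Gᶜ Q := by
  unfold Hom; rw [compl_compl]; exact h.symm

theorem Hom.mono {G : SimpleGraph V} {Q R : Finset V} (h : Hom G Q) (hR : R ⊆ Q) : Hom G R := by
  rcases h with h | h
  · exact Or.inl (h.subset (by exact_mod_cast hR))
  · exact Or.inr (h.subset (by exact_mod_cast hR))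

theorem Clean.compl {G : SimpleGraph V} {X : Set V} (h : Clean G X) : Clean Gᶜ X := by
  unfold Clean; rw [compl_compl]; exact h.symm

theorem NoC5.compl {G : SimpleGraph V} (h : NoC5 G) : NoC5 Gᶜ := by
  intro a b c d e h1 h2 h3 h4 h5 n1 n2 n3 n4 n5
  simp only [SimpleGraph.compl_adj] at *
  have a1 : G.Adj a c := by
    by_contra hh; exact n1 ⟨fun h => by subst h; exact n2 ⟨h3.1, h3.2⟩, hh⟩
  have a2 : G.Adj a d := by
    by_contra hh; exact n2 ⟨fun h => by subst h; exact n3 ⟨h1.1.symm, fun h => h1.2 h.symm⟩, hh⟩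
  have a3 : G.Adj b d := by
    by_contra hh; exact n3 ⟨fun h => by subst h; exact n4 ⟨h4.1, h4.2⟩, hh⟩
  have a4 : G.Adj b e := by
    by_contra hh; exact n4 ⟨fun h => by subst h; exact n5 ⟨h2.1.symm, fun h => h2.2 h.symm⟩, hh⟩
  have a5 : G.Adj c e := by
    by_contra hh; exact n5 ⟨fun h => by subst h; exact n1 ⟨h5.1.symm, fun h => h5.2 h.symm⟩, hh⟩
  exact h a c e b d a1 a5 a4.symm a3 a2.symm (fun h => h5.2 h.symm) h1.2 (fun h => h2.2 h.symm)
    h3.2 (fun h => h4.2 h.symm)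

theorem InF.compl {G : SimpleGraph V} (h : InF G) : InF Gᶜ :=
  ⟨fun X => let ⟨Q, h1, h2, h3⟩ := h.hom X; ⟨Q, h1, h2.compl, h3⟩, h.noC5.compl⟩

theorem InF.comap {G : SimpleGraph V} (h : InF G) (f : W → V) (hf : f.Injective) :
    InF (G.comap f) := by
  constructor
  · intro X
    obtain ⟨Q, h1, h2, h3⟩ := h.hom (X.image f)
    refine ⟨X.filter (fun x => f x ∈ Q), Finset.filter_subset _ _, ?_, ?_⟩
    · rcases h2 with h2 | h2
      · left
        intro x hx y hy hxy
        simp at hx hy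
        exact h2 hx.2 hy.2 (fun h => hxy (hf h))
      · right
        intro x hx y hy hxy
        simp at hx hy
        have := h2 hx.2 hy.2 (fun h => hxy (hf h))
        simp at this ⊢
        exact ⟨hxy, this.2⟩
    · rw [Finset.card_image_of_injective _ hf] at h3
      refine h3.trans (Nat.pow_le_pow_left ?_ 2)
      rw [← Finset.card_image_of_injective _ hf]
      apply Finset.card_le_card
      intro y hy
      obtain ⟨x, hx, rfl⟩ := Finset.mem_image.1 (h1 hy)
      exact Finset.mem_image_of_mem _ (by simp [hx, hy])
  · intro a b c d e
    simp only [SimpleGraph.comap_adj]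
    exact h.noC5 _ _ _ _ _

theorem InF.of_iso {G : SimpleGraph V} {H : SimpleGraph W} (e : G ≃g H) (h : InF G) : InF H := by
  have := h.comap e.symm e.symm.injective
  rwa [show G.comap e.symm = H from by
    ext x y; simp [SimpleGraph.comap_adj, e.symm.map_adj_iff]] at this

theorem IsPerfect.colorable [Finite V] {G : SimpleGraph V} (h : IsPerfect G) (s : Set V) :
    (G.induce s).Colorable (G.induce s).cliqueNum := by
  rw [← SimpleGraph.chromaticNumber_le_iff_colorable, h s]

theorem IsPerfect.hom [Fintype V] {G : SimpleGraph V} (h : IsPerfect G) (X : Finset V) :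
    ∃ Q ⊆ X, Hom G Q ∧ X.card ≤ Q.card ^ 2 := by
  obtain ⟨c⟩ := h.colorable (X : Set V)
  set H := G.induce (X : Set V) with hH
  obtain ⟨K, hK⟩ := H.exists_isNClique_cliqueNum
  set ω := H.cliqueNum
  by_cases hcl : ∃ i : Fin ω, ω < (Finset.univ.filter fun x => c x = i).card
  · obtain ⟨i0, hi0⟩ := hcl
    obtain ⟨i, -, hi⟩ := Finset.exists_max_image (Finset.univ : Finset (Fin ω))
      (fun i => (Finset.univ.filter fun x => c x = i).card) ⟨i0, by simp⟩
    refine ⟨(Finset.univ.filter fun x => c x = i).map (Function.Embedding.subtype _), ?_, ?_, ?_⟩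
    · intro x hx
      simp at hx
      exact hx.1
    · right
      intro x hx y hy hxy
      simp at hx hy
      obtain ⟨hx, hx'⟩ := hx
      obtain ⟨hy, hy'⟩ := hy
      simp only [SimpleGraph.compl_adj]
      refine ⟨hxy, fun hadj => ?_⟩
      have : H.Adj ⟨x, hx⟩ ⟨y, hy⟩ := hadj
      exact c.valid this (hx'.trans hy'.symm)
    · rw [Finset.card_map]
      have h1 : (Finset.univ : Finset (X : Set V)).card ≤ ω * (Finset.univ.filter fun x => c x = i).card := by
        have := Finset.card_le_mul_card_image_of_maps_to (f := c) (s := Finset.univ) (t := Finset.univ)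
          (fun x _ => Finset.mem_univ _) (Finset.univ.filter fun x => c x = i).card
          (fun b hb => hi b hb)
        rwa [Finset.card_univ (α := Fin ω), Fintype.card_fin, mul_comm] at this
      have h2 := hi i0 (Finset.mem_univ _)
      simp only [Finset.card_univ] at h1
      rw [show Fintype.card (X : Set V) = X.card by simp] at h1
      nlinarith
  · push Not at hcl
    refine ⟨K.map (Function.Embedding.subtype _), ?_, ?_, ?_⟩
    · intro x hx
      simp at hx
      exact hx.1
    · left
      intro x hx y hy hxy
      simp at hx hy
      obtain ⟨hx, hx'⟩ := hx
      obtain ⟨hy, hy'⟩ := hy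
      have := hK.isClique hx' hy' (by simpa using hxy)
      exact this
    · rw [Finset.card_map, hK.card_eq]
      have := Finset.card_le_mul_card_image_of_maps_to (f := c) (s := Finset.univ) (t := Finset.univ)
          (fun x _ => Finset.mem_univ _) ω
          (fun b hb => hcl b)
      rw [Finset.card_univ (α := Fin ω), Fintype.card_fin, Finset.card_univ,
        show Fintype.card (X : Set V) = X.card by simp] at this
      nlinarith

theorem IsPerfect.noC5 [Fintype V] {G : SimpleGraph V} (h : IsPerfect G) : NoC5 G := by
  intro a b c d e h1 h2 h3 h4 h5 n1 n2 n3 n4 n5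
  have hs := h1.symm
  have hs2 := h2.symm
  have hs3 := h3.symm
  have hs4 := h4.symm
  have hs5 := h5.symm
  have m1 : ¬ G.Adj c a := fun h => n1 h.symm
  have m2 : ¬ G.Adj d a := fun h => n2 h.symm
  have m3 : ¬ G.Adj d b := fun h => n3 h.symm
  have m4 : ¬ G.Adj e b := fun h => n4 h.symm
  have m5 : ¬ G.Adj e c := fun h => n5 h.symm
  set s : Set V := {a, b, c, d, e} with hsdef
  have hc := h.colorable s
  have hω : (G.induce s).cliqueNum ≤ 2 := by
    obtain ⟨K, hK⟩ := (G.induce s).exists_isNClique_cliqueNum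
    by_contra hlt
    push Not at hlt
    rw [← hK.card_eq] at hlt
    rw [Finset.two_lt_card] at hlt
    obtain ⟨⟨x, hx⟩, hxK, ⟨y, hy⟩, hyK, ⟨z, hz⟩, hzK, hxy, hxz, hyz⟩ := hlt
    have e1 : G.Adj x y := hK.isClique hxK hyK hxy
    have e2 : G.Adj x z := hK.isClique hxK hzK hxz
    have e3 : G.Adj y z := hK.isClique hyK hzK hyz
    clear hxK hyK hzK hxy hxz hyz hK hc
    simp only [hsdef, Set.mem_insert_iff, Set.mem_singleton_iff] at hx hy hz
    rcases hx with rfl | rfl | rfl | rfl | rfl <;> rcases hy with rfl | rfl | rfl | rfl | rfl <;>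
      first
      | exact absurd e1 (SimpleGraph.irrefl _)
      | exact absurd e1 (by assumption)
      | (rcases hz with rfl | rfl | rfl | rfl | rfl <;>
          first
          | exact absurd e2 (SimpleGraph.irrefl _)
          | exact absurd e2 (by assumption)
          | exact absurd e3 (SimpleGraph.irrefl _)
          | exact absurd e3 (by assumption))
  obtain ⟨f⟩ := hc.mono hω
  have ma : a ∈ s := by simp [hsdef]
  have mb : b ∈ s := by simp [hsdef]
  have mc : c ∈ s := by simp [hsdef]
  have md : d ∈ s := by simp [hsdef]
  have me : e ∈ s := by simp [hsdef]
  have f1 := f.valid (show (G.induce s).Adj ⟨a, ma⟩ ⟨b, mb⟩ from h1)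
  have f2 := f.valid (show (G.induce s).Adj ⟨b, mb⟩ ⟨c, mc⟩ from h2)
  have f3 := f.valid (show (G.induce s).Adj ⟨c, mc⟩ ⟨d, md⟩ from h3)
  have f4 := f.valid (show (G.induce s).Adj ⟨d, md⟩ ⟨e, me⟩ from h4)
  have f5 := f.valid (show (G.induce s).Adj ⟨e, me⟩ ⟨a, ma⟩ from h5)
  omega

theorem IsPerfect.inF [Fintype V] {G : SimpleGraph V} (h : IsPerfect G) : InF G :=
  ⟨h.hom, h.noC5⟩

theorem isUnipolarArrangement_iff {G : SimpleGraph V} {C : Set V} :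
    IsUnipolarArrangement G C ↔ G.IsClique C ∧ PFree G Cᶜ := by
  unfold IsUnipolarArrangement
  refine and_congr_right fun _ => ⟨fun h u v w hu hv hw huv hvw huw => ?_, fun h u v huv => ?_⟩
  · have h1 : (G.induce Cᶜ).Adj ⟨u, hu⟩ ⟨v, hv⟩ := huv
    have h2 : (G.induce Cᶜ).Adj ⟨v, hv⟩ ⟨w, hw⟩ := hvw
    exact h ⟨u, hu⟩ ⟨w, hw⟩ (h1.reachable.trans h2.reachable) (by simpa using huw)
  · obtain ⟨p⟩ := huv
    induction p with
    | nil => intro h; exact absurd rfl h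
    | @cons a b c hab p ih =>
      intro hac
      by_cases hbc : b = c
      · subst hbc; exact hab
      · have := ih hbc
        exact h a.2 b.2 c.2 hab this (fun h => hac (Subtype.ext h))

/-- The class of `v` inside `D` in a graph which is `P₃`-free on `D`. -/
def blk [Fintype V] (G : SimpleGraph V) (D : Set V) (v : V) : Finset V :=
  Finset.univ.filter fun w => w ∈ D ∧ (w = v ∨ G.Adj v w)

theorem blk_isClique [Fintype V] {G : SimpleGraph V} {D : Set V} (h : PFree G D) {v : V}
    (hv : v ∈ D) : G.IsClique ↑(blk G D v) := by
  intro x hx y hy hxy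
  simp only [blk, Finset.coe_filter, Finset.mem_univ, true_and, Set.mem_ofPred_eq] at hx hy
  rcases hx.2 with rfl | hx'
  · rcases hy.2 with rfl | hy'
    · exact absurd rfl hxy
    · exact hy'
  · rcases hy.2 with rfl | hy'
    · exact hx'.symm
    · exact h hx.1 hv hy.1 hx'.symm hy' hxy

theorem blk_eq [Fintype V] {G : SimpleGraph V} {D : Set V} (h : PFree G D) {u v : V}
    (hu : u ∈ D) (hv : v ∈ D) (huv : G.Adj u v) : blk G D u = blk G D v := by
  ext w
  simp only [blk, Finset.mem_filter, Finset.mem_univ, true_and]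
  refine and_congr_right fun hw => ⟨?_, ?_⟩
  · rintro (rfl | h1)
    · exact Or.inr huv.symm
    · by_cases hwv : w = v
      · exact Or.inl hwv
      · exact Or.inr (h hv hu hw huv.symm h1 (Ne.symm hwv))
  · rintro (rfl | h1)
    · exact Or.inr huv
    · by_cases hwu : w = u
      · exact Or.inl hwu
      · exact Or.inr (h hu hv hw huv h1 (Ne.symm hwu))

theorem IsUnipolar.colorable_cliqueNum [Fintype V] {G : SimpleGraph V} (h : IsUnipolar G) :
    G.Colorable G.cliqueNum := by
  obtain ⟨C, hC⟩ := h
  rw [isUnipolarArrangement_iff] at hC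
  obtain ⟨hcl, hP⟩ := hC
  set ω := G.cliqueNum with hω
  have hCω : C.toFinset.card ≤ ω :=
    SimpleGraph.IsClique.card_le_cliqueNum (tc := by simpa using hcl)
  obtain ⟨e⟩ : Nonempty (C.toFinset ↪ Fin ω) := by
    rw [Function.Embedding.nonempty_iff_card_le]; simpa using hCω
  let allowed : V → Finset (Fin ω) := fun v =>
    Finset.univ.filter fun i => ∀ c : C.toFinset, e c = i → ¬ G.Adj v c
  have hall : ∀ K : Finset V, G.IsClique ↑K → (∀ x ∈ K, x ∉ C) →
      ∃ f : K → Fin ω, Function.Injective f ∧ ∀ x : K, f x ∈ allowed x := by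
    intro K hK hKC
    rw [← Finset.all_card_le_biUnion_card_iff_exists_injective (fun x : K => allowed x)]
    intro S
    set S' : Finset V := S.map (Function.Embedding.subtype _) with hS'
    set D : Finset C.toFinset := Finset.univ.filter fun c => ∀ x ∈ S', G.Adj x c with hD
    rcases S.eq_empty_or_nonempty with hSe | ⟨x0, hx0⟩
    · simp [hSe]
    have hun : (D.map e)ᶜ ⊆ S.biUnion (fun x : K => allowed x) := by
      intro i hi
      rw [Finset.mem_compl] at hi
      by_contra hcon
      apply hi
      simp only [Finset.mem_biUnion, not_exists, not_and] at hcon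
      · have h0 := hcon x0 hx0
        simp only [allowed, Finset.mem_filter, Finset.mem_univ, true_and] at h0 hcon
        push Not at h0
        obtain ⟨c, rfl, _⟩ := h0
        refine Finset.mem_map_of_mem _ ?_
        simp only [hD, Finset.mem_filter, Finset.mem_univ, true_and, hS', Finset.mem_map]
        rintro _ ⟨x, hx, rfl⟩
        have h1 := hcon x hx
        push Not at h1
        obtain ⟨c', hc', h2⟩ := h1
        rw [← e.injective hc']
        exact h2
    have hcl2 : G.IsClique ↑(S' ∪ D.map (Function.Embedding.subtype _)) := by
      intro x hx y hy hxy
      simp only [Finset.coe_union, Set.mem_union, Finset.mem_coe] at hx hy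
      have memS : ∀ z ∈ S', z ∈ K := by
        intro z hz
        simp [hS'] at hz
        exact hz.1
      have memD : ∀ z ∈ D.map (Function.Embedding.subtype _), z ∈ C ∧ ∀ x ∈ S', G.Adj x z := by
        intro z hz
        simp [hD] at hz
        obtain ⟨h1, h2⟩ := hz
        exact ⟨h2, fun x hx => h1 x hx⟩
      rcases hx with hx | hx <;> rcases hy with hy | hy
      · exact hK (memS x hx) (memS y hy) hxy
      · exact (memD y hy).2 x hx
      · exact ((memD x hx).2 y hy).symm
      · exact hcl (memD x hx).1 (memD y hy).1 hxy
    have hcard := hcl2.card_le_cliqueNum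
    rw [Finset.card_union_of_disjoint, Finset.card_map] at hcard
    · have h3 := Finset.card_le_card hun
      rw [Finset.card_compl, Finset.card_map, Fintype.card_fin] at h3
      rw [Finset.card_map] at hcard
      omega
    · rw [Finset.disjoint_left]
      intro x hx hx'
      simp [hS'] at hx hx'
      exact hKC x hx.1 hx'.1
  choose F hF using hall
  have hb : ∀ v, v ∉ C → G.IsClique ↑(blk G Cᶜ v) ∧ ∀ x ∈ blk G Cᶜ v, x ∉ C := by
    intro v hv
    refine ⟨blk_isClique hP hv, fun x hx => ?_⟩
    simp only [blk, Finset.mem_filter] at hx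
    exact hx.2.1
  refine ⟨SimpleGraph.Coloring.mk (fun v => if hv : v ∈ C then e ⟨v, by simpa using hv⟩ else
    F (blk G Cᶜ v) (hb v hv).1 (hb v hv).2 ⟨v, by simp [blk, hv]⟩) ?_⟩
  have key : ∀ u v, u ∈ C → v ∉ C → ∀ (hu : u ∈ C.toFinset) (hv : v ∈ blk G Cᶜ v), G.Adj u v →
      ∀ p q, e ⟨u, hu⟩ ≠ F (blk G Cᶜ v) p q ⟨v, hv⟩ := by
    intro u v hu hv hu' hv' huv _ _ heq
    have := (hF _ (hb v hv).1 (hb v hv).2).2 ⟨v, hv'⟩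
    simp only [allowed, Finset.mem_filter, Finset.mem_univ, true_and] at this
    exact this _ heq huv.symm
  intro u v huv
  by_cases hu : u ∈ C <;> by_cases hv : v ∈ C
  · simp only [hu, hv, dif_pos]
    intro heq
    exact huv.ne (by simpa using e.injective heq)
  · simp only [hu, hv, dif_pos, dif_neg, not_false_eq_true]
    exact key u v hu hv _ _ huv _ _
  · simp only [hu, hv, dif_pos, dif_neg, not_false_eq_true]
    exact (key v u hv hu _ _ huv.symm _ _).symm
  · simp only [hu, hv, dif_neg, not_false_eq_true]
    have hbe := blk_eq hP hu hv huv
    intro heq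
    have h1 := (hF _ (hb v hv).1 (hb v hv).2).1
    have h2 : ∀ (K : Finset V) (hK : K = blk G Cᶜ v) (hu : u ∈ K) (hv : v ∈ blk G Cᶜ v) (p q p' q'),
        F K p q ⟨u, hu⟩ = F (blk G Cᶜ v) p' q' ⟨v, hv⟩ → u = v := by
      rintro K rfl hu hv _ _ _ _ h
      simpa using h1 h
    exact huv.ne (h2 _ hbe _ _ _ _ _ _ heq)

theorem IsUnipolar.comap {G : SimpleGraph V} (h : IsUnipolar G) (f : W → V) (hf : f.Injective) :
    IsUnipolar (G.comap f) := by
  obtain ⟨C, hC⟩ := h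
  rw [isUnipolarArrangement_iff] at hC
  refine ⟨f ⁻¹' C, isUnipolarArrangement_iff.2 ⟨?_, ?_⟩⟩
  · intro x hx y hy hxy
    exact hC.1 hx hy (fun h => hxy (hf h))
  · intro u v w hu hv hw h1 h2 h3
    exact hC.2 hu hv hw h1 h2 (fun h => h3 (hf h))

theorem IsUnipolar.isPerfect [Fintype V] {G : SimpleGraph V} (h : IsUnipolar G) : IsPerfect G := by
  intro s
  have h1 : IsUnipolar (G.induce s) := h.comap _ Subtype.val_injective
  apply le_antisymm
  · rw [SimpleGraph.chromaticNumber_le_iff_colorable]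
    exact h1.colorable_cliqueNum
  · exact SimpleGraph.cliqueNum_le_chromaticNumber
end basic

/-- The number of members of the hereditary class on `n` vertices -/
def nF (n : ℕ) : ℝ := cnt (fun G : SimpleGraph (Fin n) => InF G)

/-- The number of unipolar graphs on `n` vertices -/
def nU (n : ℕ) : ℝ := cnt (fun G : SimpleGraph (Fin n) => IsUnipolar G)

section
variable {V W : Type}

theorem isUnipolar_of_iso {G : SimpleGraph V} {H : SimpleGraph W} (e : G ≃g H)
    (h : IsUnipolar G) : IsUnipolar H := by
  have := h.comap e.symm e.symm.injective
  rwa [show G.comap e.symm = H from by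
    ext x y; simp [SimpleGraph.comap_adj, e.symm.map_adj_iff]] at this

theorem cnt_graph_equiv [Finite V] [Finite W] (e : V ≃ W) (P : SimpleGraph V → Prop)
    (Q : SimpleGraph W → Prop) (h : ∀ G H, Nonempty (G ≃g H) → (P G ↔ Q H)) : cnt P = cnt Q := by
  refine cnt_equiv e.simpleGraph (fun G => h _ _ ⟨?_⟩)
  exact ⟨e, by intro a b; simp [Equiv.simpleGraph]⟩

theorem cnt_inF [Fintype V] : cnt (fun G : SimpleGraph V => InF G) = nF (Fintype.card V) :=
  cnt_graph_equiv (Fintype.equivFin V) _ _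
    (fun _ _ ⟨e⟩ => ⟨fun h => h.of_iso e, fun h => h.of_iso e.symm⟩)

theorem cnt_isUnipolar [Fintype V] :
    cnt (fun G : SimpleGraph V => IsUnipolar G) = nU (Fintype.card V) :=
  cnt_graph_equiv (Fintype.equivFin V) _ _
    (fun _ _ ⟨e⟩ => ⟨fun h => isUnipolar_of_iso e h, fun h => isUnipolar_of_iso e.symm h⟩)

theorem nU_pos (n : ℕ) : 1 ≤ nU n := by
  apply cnt_pos_of ⊤
  exact ⟨Set.univ, isUnipolarArrangement_iff.2 ⟨fun x _ y _ h => h, by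
    intro u v w hu; simp at hu⟩⟩

/-- Add one vertex with neighbourhood `X`. -/
def addVertex (H : SimpleGraph V) (X : Set V) : SimpleGraph (Option V) where
  Adj x y := match x, y with
    | none, none => False
    | none, some y => y ∈ X
    | some x, none => x ∈ X
    | some x, some y => H.Adj x y
  symm := ⟨by rintro (_ | x) (_ | y) h <;> first | exact h | exact h.symm⟩
  loopless := ⟨by rintro (_ | x) h <;> first | exact h | exact H.irrefl h⟩

theorem addVertex_isUnipolar_of_superset {H : SimpleGraph V} {C X : Set V}
    (hC : IsUnipolarArrangement H C) (hX : C ⊆ X) : IsUnipolar (addVertex H X) := by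
  rw [isUnipolarArrangement_iff] at hC
  refine ⟨{x | ∀ y, x = some y → y ∈ C}, isUnipolarArrangement_iff.2 ⟨?_, ?_⟩⟩
  · rintro (_ | x) hx (_ | y) hy hxy
    · exact absurd rfl hxy
    · exact hX (hy y rfl)
    · exact hX (hx x rfl)
    · exact hC.1 (hx x rfl) (hy y rfl) (by simpa using hxy)
  · rintro (_ | x) (_ | y) (_ | z) hx hy hz h1 h2 h3 <;> simp at hx hy hz
    exact hC.2 hx hy hz h1 h2 (by simpa using h3)

theorem addVertex_isUnipolar_of_subset {H : SimpleGraph V} {C X : Set V}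
    (hC : IsUnipolarArrangement H C) (hX : X ⊆ C) : IsUnipolar (addVertex H X) := by
  rw [isUnipolarArrangement_iff] at hC
  refine ⟨{x | ∃ y, x = some y ∧ y ∈ C}, isUnipolarArrangement_iff.2 ⟨?_, ?_⟩⟩
  · rintro x ⟨x, rfl, hx⟩ y ⟨y, rfl, hy⟩ hxy
    exact hC.1 hx hy (by simpa using hxy)
  · rintro (_ | x) (_ | y) (_ | z) hx hy hz h1 h2 h3 <;> simp at hx hy hz
    · exact absurd rfl h3
    · exact h1.elim
    · exact absurd rfl h3
    · exact absurd (hX h1) hy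
    · exact absurd (hX h1) hx
    · exact absurd (hX h1) hx
    · exact absurd (hX h2) hy
    · exact hC.2 hx hy hz h1 h2 (by simpa using h3)

theorem addVertex_injective {H : SimpleGraph V} {X Y : Set V}
    (h : addVertex H X = addVertex H Y) : X = Y := by
  ext x
  have : (addVertex H X).Adj none (some x) ↔ (addVertex H Y).Adj none (some x) := by rw [h]
  exact this

theorem comap_addVertex (H : SimpleGraph V) (X : Set V) : (addVertex H X).comap some = H := by
  ext x y; exact Iff.rfl

theorem cnt_superset [Fintype V] (S : Finset V) :
    cnt (fun X : Finset V => S ⊆ X) = 2 ^ (Fintype.card V - S.card) := by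
  rw [← Finset.card_compl, ← cnt_finset_subset]
  refine cnt_equiv ⟨compl, compl, compl_compl, compl_compl⟩ (fun X => ?_)
  simp

theorem nU_succ (n : ℕ) : (2:ℝ) ^ ((n:ℝ)/2) * nU n ≤ nU (n+1) := by
  have h1 : nU (n+1) = cnt (fun G : SimpleGraph (Option (Fin n)) => IsUnipolar G) := by
    rw [cnt_isUnipolar]; simp
  rw [h1, nU, mul_comm]
  apply cnt_fiber_ge (fun G : SimpleGraph (Option (Fin n)) => G.comap some)
  rintro H ⟨C, hC⟩
  have key : ∀ R : Finset (Fin n) → Prop, (∀ X, R X → IsUnipolar (addVertex H (X : Set (Fin n)))) →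
      cnt R ≤ cnt (fun x : SimpleGraph (Option (Fin n)) => IsUnipolar x ∧ x.comap some = H) := by
    intro R hR
    apply cnt_inj (fun X : Finset (Fin n) => addVertex H (X : Set (Fin n)))
    · intro X hX; exact ⟨hR X hX, comap_addVertex _ _⟩
    · intro X Y _ _ h; simpa using addVertex_injective h
  have hcard : C.toFinset.card ≤ n := by simpa using Finset.card_le_univ C.toFinset
  rcases le_total ((n:ℝ)/2) (C.toFinset.card) with h | h
  · refine le_trans ?_ (key (fun X => X ⊆ C.toFinset) fun X hX =>
      addVertex_isUnipolar_of_subset hC (by simpa using hX))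
    rw [cnt_finset_subset, ← Real.rpow_natCast]
    exact Real.rpow_le_rpow_of_exponent_le (by norm_num) h
  · refine le_trans ?_ (key (fun X => C.toFinset ⊆ X) fun X hX =>
      addVertex_isUnipolar_of_superset hC (by simpa using hX))
    rw [cnt_superset, ← Real.rpow_natCast]
    exact Real.rpow_le_rpow_of_exponent_le (by norm_num) (by
      rw [Fintype.card_fin, Nat.cast_sub hcard]; linarith)

theorem nU_add (m k : ℕ) : (2:ℝ) ^ ((k:ℝ) * m / 2) * nU m ≤ nU (m+k) := by
  induction k with
  | zero => simp
  | succ k ih =>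
    refine le_trans ?_ (nU_succ (m+k))
    calc (2:ℝ) ^ (((k+1:ℕ):ℝ) * m / 2) * nU m = 2 ^ ((m:ℝ)/2) * (2 ^ ((k:ℝ) * m / 2) * nU m) := by
          rw [← mul_assoc, ← Real.rpow_add (by norm_num)]; congr 2; push_cast; ring
      _ ≤ 2 ^ (((m+k:ℕ):ℝ)/2) * nU (m+k) := by
          have := nU_pos m
          gcongr
          · norm_num
          · omega

/-- A unipolar graph built from the crossing edges `X` and labels `g` -/
def labelGraph (a M b : ℕ) (X : Fin a → Finset (Fin M ⊕ Fin b)) (g : Fin b → Fin M) :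
    SimpleGraph (Fin a ⊕ (Fin M ⊕ Fin b)) where
  Adj x y := x ≠ y ∧ match x, y with
    | .inl _, .inl _ => True
    | .inl i, .inr y => y ∈ X i
    | .inr y, .inl i => y ∈ X i
    | .inr x, .inr y => Sum.elim id g x = Sum.elim id g y
  symm := ⟨by rintro (i | x) (j | y) ⟨h1, h2⟩ <;> refine ⟨h1.symm, ?_⟩ <;>
    first | trivial | exact h2 | exact h2.symm⟩
  loopless := ⟨by rintro x ⟨h, _⟩; exact h rfl⟩

theorem labelGraph_isUnipolar (a M b : ℕ) (X : Fin a → Finset (Fin M ⊕ Fin b)) (g : Fin b → Fin M) :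
    IsUnipolar (labelGraph a M b X g) := by
  refine ⟨{x | ∃ i, x = .inl i}, isUnipolarArrangement_iff.2 ⟨?_, ?_⟩⟩
  · rintro _ ⟨i, rfl⟩ _ ⟨j, rfl⟩ h
    exact ⟨h, trivial⟩
  · rintro (i | x) (j | y) (k | z) hx hy hz h1 h2 h3 <;> simp at hx hy hz
    exact ⟨h3, h1.2.trans h2.2⟩

theorem nU_ge (a M b : ℕ) : (2:ℝ) ^ (a * (M + b)) * M ^ b ≤ nU (a + (M + b)) := by
  have h1 : nU (a + (M+b)) = cnt (fun G : SimpleGraph (Fin a ⊕ (Fin M ⊕ Fin b)) => IsUnipolar G) := by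
    rw [cnt_isUnipolar]; simp
  rw [h1]
  have h2 : cnt (fun _ : (Fin a → Finset (Fin M ⊕ Fin b)) × (Fin b → Fin M) => True) =
      2 ^ (a * (M + b)) * M ^ b := by
    rw [cnt_true]
    simp only [Fintype.card_prod, Fintype.card_fun, Fintype.card_finset, Fintype.card_sum,
      Fintype.card_fin]
    push_cast
    rw [← pow_mul, mul_comm (M + b) a]
  rw [← h2]
  apply cnt_inj (fun p => labelGraph a M b p.1 p.2)
  · intro p _; exact labelGraph_isUnipolar _ _ _ _ _
  · rintro ⟨X, g⟩ ⟨Y, h⟩ _ _ heq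
    simp only at heq
    have hadj : ∀ x y, (labelGraph a M b X g).Adj x y ↔ (labelGraph a M b Y h).Adj x y := by
      intro x y; rw [heq]
    congr 1
    · ext i y
      have := hadj (.inl i) (.inr y)
      simpa [labelGraph] using this
    · funext j
      have := hadj (.inr (.inr j)) (.inr (.inl (g j)))
      simp [labelGraph] at this
      exact this.symm

end

theorem lg_tendsto : Tendsto (fun n : ℕ => Real.logb 2 n) atTop atTop :=
  (Real.tendsto_logb_atTop (by norm_num)).comp tendsto_natCast_atTop_atTop

theorem lg_le_mul {c : ℝ} (hc : 0 < c) : ∀ᶠ n : ℕ in atTop, Real.logb 2 n ≤ c * n := by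
  have h := (Real.isLittleO_log_id_atTop.comp_tendsto tendsto_natCast_atTop_atTop)
  have h2 := h.def (c := c * Real.log 2) (by have := Real.log_pos one_lt_two; positivity)
  filter_upwards [h2] with n hn
  simp only [Function.comp, id, Real.norm_eq_abs] at hn
  have hl := Real.log_pos one_lt_two
  rw [Real.logb, div_le_iff₀ hl]
  calc Real.log n ≤ |Real.log n| := le_abs_self _
    _ ≤ _ := hn
    _ = c * n * Real.log 2 := by rw [abs_of_nonneg (by positivity)]; ring

theorem eventually_ge_real (C : ℝ) : ∀ᶠ n : ℕ in atTop, C ≤ n :=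
  tendsto_natCast_atTop_atTop.eventually_ge_atTop C

theorem rpow_lg {n : ℕ} (hn : 0 < n) : (2:ℝ) ^ (Real.logb 2 n) = n :=
  Real.rpow_logb (by norm_num) (by norm_num) (by exact_mod_cast hn)

theorem nU_ge_eventually : ∀ᶠ n : ℕ in atTop,
    (2:ℝ) ^ ((n:ℝ)^2 / 4 + n * Real.logb 2 n / 5) ≤ nU n := by
  filter_upwards [eventually_ge_real 10000, lg_tendsto.eventually_ge_atTop 1] with n hn hl
  have hn' : 10000 ≤ n := by exact_mod_cast hn
  set s := Nat.sqrt n with hs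
  have hs1 : s * s ≤ n := Nat.sqrt_le n
  have hs2 : n < (s+1)*(s+1) := by simpa using Nat.lt_succ_sqrt n
  have hs100 : 100 ≤ s := by rw [hs, Nat.le_sqrt]; omega
  have hb : s + 1 + n/2 ≤ n := by
    have : 100 * s ≤ s * s := Nat.mul_le_mul_right s hs100
    omega
  obtain ⟨b, hbe⟩ : ∃ b, n = n/2 + ((s+1) + b) := ⟨n - n/2 - (s+1), by omega⟩
  have key := nU_ge (n/2) (s+1) b
  rw [← hbe] at key
  refine le_trans ?_ key
  have hM : (2:ℝ) ^ (Real.logb 2 n / 2) ≤ ((s+1:ℕ):ℝ) := by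
    have : (2:ℝ) ^ (Real.logb 2 n / 2) = Real.sqrt n := by
      rw [Real.sqrt_eq_rpow, ← rpow_lg (n := n) (by omega), ← Real.rpow_mul (by norm_num),
        rpow_lg (by omega)]
      congr 1; ring
    rw [this, Real.sqrt_le_left (by positivity)]
    have : (n:ℝ) < ((s+1)*(s+1) : ℕ) := by exact_mod_cast hs2
    push_cast at this ⊢; nlinarith
  have e1 : (2:ℝ) ^ (n/2 * (s+1+b)) = (2:ℝ) ^ (((n/2 * (s+1+b) : ℕ)):ℝ) := by
    rw [Real.rpow_natCast]
  calc (2:ℝ) ^ ((n:ℝ)^2 / 4 + n * Real.logb 2 n / 5)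
      ≤ (2:ℝ) ^ (((n/2 * (s+1+b) : ℕ)):ℝ) * (2 ^ (Real.logb 2 n / 2)) ^ b := by
        rw [← Real.rpow_natCast ((2:ℝ) ^ (Real.logb 2 n / 2)) b, ← Real.rpow_mul (by norm_num),
          ← Real.rpow_add (by norm_num)]
        apply Real.rpow_le_rpow_of_exponent_le (by norm_num)
        have h4 : n * n ≤ 4 * (n/2 * (s+1+b)) + 1 := by
          rcases Nat.even_or_odd' n with ⟨t, ht | ht⟩
          · have h5 : n/2 = t := by omega
            have h6 : s+1+b = t := by omega
            rw [h6, h5, ht]; nlinarith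
          · have h5 : n/2 = t := by omega
            have h6 : s+1+b = t+1 := by omega
            rw [h6, h5, ht]; nlinarith
        have h4' : (n:ℝ) * n ≤ 4 * ((n/2 * (s+1+b) : ℕ):ℝ) + 1 := by exact_mod_cast h4
        have h7 : 0.45 * (n:ℝ) ≤ b := by
          have : 45 * n ≤ 100 * b := by
            have : 100 * s ≤ s * s := Nat.mul_le_mul_right s hs100
            omega
          have : (45:ℝ) * n ≤ 100 * b := by exact_mod_cast this
          linarith
        have h8 : 0.45 * (n:ℝ) * (Real.logb 2 n / 2) ≤ b * (Real.logb 2 n / 2) := by gcongr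
        nlinarith
    _ ≤ (2:ℝ) ^ (n/2 * (s+1+b)) * ((s+1:ℕ):ℝ) ^ b := by
        rw [e1]; gcongr

/-- Outside an exponentially small proportion (relative to the number of unipolar graphs and to the
ratios `nF m / nU m` for smaller `m`), members of the class satisfy `P`. -/
def AA (P : ∀ (V : Type) [Fintype V], SimpleGraph V → Prop) : Prop :=
  ∃ c : ℝ, 0 < c ∧ ∃ n₀ : ℕ, ∀ (V : Type) [Fintype V], n₀ ≤ Fintype.card V → ∀ Γ : ℝ, 1 ≤ Γ →
    (∀ m < Fintype.card V, nF m ≤ Γ * nU m) →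
    cnt (fun G : SimpleGraph V => InF G ∧ ¬ P V G) ≤
      (2:ℝ) ^ (-(c * Fintype.card V)) * (Γ * nU (Fintype.card V))

variable {P Q : ∀ (V : Type) [Fintype V], SimpleGraph V → Prop}

theorem AA.mono (h : AA P) (n₁ : ℕ) (hPQ : ∀ (V : Type) [Fintype V], n₁ ≤ Fintype.card V →
    ∀ G : SimpleGraph V, InF G → P V G → Q V G) : AA Q := by
  obtain ⟨c, hc, n₀, h⟩ := h
  refine ⟨c, hc, max n₀ n₁, fun V _ hn Γ hΓ hm => ?_⟩
  refine le_trans (cnt_mono ?_) (h V (le_trans (le_max_left _ _) hn) Γ hΓ hm)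
  rintro G ⟨h1, h2⟩
  exact ⟨h1, fun hP => h2 (hPQ V (le_trans (le_max_right _ _) hn) G h1 hP)⟩

theorem AA.and (hP : AA P) (hQ : AA Q) : AA (fun V _ G => P V G ∧ Q V G) := by
  obtain ⟨c, hc, n₀, h⟩ := hP
  obtain ⟨d, hd, n₁, h'⟩ := hQ
  set e := min c d with he
  have he0 : 0 < e := lt_min hc hd
  obtain ⟨n₂, hn₂⟩ := (eventually_ge_real (2/e)).exists_forall_of_atTop
  refine ⟨e/2, by linarith, max (max n₀ n₁) n₂, fun V _ hn Γ hΓ hm => ?_⟩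
  set n := Fintype.card V
  have h1 := h V (le_trans ((le_max_left _ _).trans (le_max_left _ _)) hn) Γ hΓ hm
  have h2 := h' V (le_trans ((le_max_right _ _).trans (le_max_left _ _)) hn) Γ hΓ hm
  have h3 := hn₂ n (le_trans (le_max_right _ _) hn)
  have hU : 0 ≤ Γ * nU n := by have := nU_pos n; positivity
  calc cnt (fun G : SimpleGraph V => InF G ∧ ¬ (P V G ∧ Q V G))
      ≤ cnt (fun G : SimpleGraph V => (InF G ∧ ¬ P V G) ∨ (InF G ∧ ¬ Q V G)) := by
        apply cnt_mono; intro G hG; tauto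
    _ ≤ (2:ℝ) ^ (-(c * n)) * (Γ * nU n) + (2:ℝ) ^ (-(d * n)) * (Γ * nU n) :=
        (cnt_or _ _).trans (add_le_add h1 h2)
    _ ≤ (2:ℝ) ^ (-(e * n)) * (Γ * nU n) + (2:ℝ) ^ (-(e * n)) * (Γ * nU n) := by
        gcongr
        · norm_num
        · exact min_le_left _ _
        · norm_num
        · exact min_le_right _ _
    _ = (2:ℝ) ^ (1 + -(e * n)) * (Γ * nU n) := by
        rw [Real.rpow_add (by norm_num)]; ring_nf
    _ ≤ _ := by
        gcongr
        · norm_num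
        · rw [div_le_iff₀ he0] at h3; nlinarith

theorem AA.compl (h : AA P) : AA (fun V _ G => P V Gᶜ) := by
  obtain ⟨c, hc, n₀, h⟩ := h
  refine ⟨c, hc, n₀, fun V _ hn Γ hΓ hm => ?_⟩
  refine le_trans (cnt_inj (fun G => Gᶜ) ?_ ?_) (h V hn Γ hΓ hm)
  · rintro G ⟨h1, h2⟩; exact ⟨h1.compl, h2⟩
  · intro G H _ _ h; exact compl_injective h

theorem AA.of_total {c : ℝ} (hc : 0 < c) (n₀ : ℕ) (h : ∀ (V : Type) [Fintype V],
    n₀ ≤ Fintype.card V → cnt (fun G : SimpleGraph V => InF G ∧ ¬ P V G) ≤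
      (2:ℝ) ^ (-(c * Fintype.card V)) * nU (Fintype.card V)) : AA P := by
  refine ⟨c, hc, n₀, fun V _ hn Γ hΓ hm => (h V hn).trans ?_⟩
  have := nU_pos (Fintype.card V)
  gcongr
  nlinarith

theorem cnt_card_eq_le {V : Type} [Fintype V] (k : ℕ) :
    cnt (fun U : Finset V => U.card = k) ≤ (Fintype.card V : ℝ) ^ k := by
  rw [cnt_eq_card_filter]
  have : (Finset.univ.filter fun U : Finset V => U.card = k) = Finset.powersetCard k Finset.univ := by
    ext; simp [Finset.mem_powersetCard]
  rw [this, Finset.card_powersetCard]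
  exact_mod_cast Nat.choose_le_pow _ _

theorem poly_le_exp (k : ℕ) (C : ℝ) {c : ℝ} (hc : 0 < c) :
    ∀ᶠ n : ℕ in atTop, C + k * Real.logb 2 n ≤ c * n := by
  have hc' : 0 < c / (2 * (k+1)) := by positivity
  filter_upwards [lg_le_mul hc', eventually_ge_real (2 * C / c), eventually_ge_real 1] with n h1 h2 h3
  rw [div_le_iff₀ hc] at h2
  have h4 : k * Real.logb 2 n ≤ (k+1) * (c / (2 * (k+1)) * n) := by
    have : 0 ≤ Real.logb 2 n := Real.logb_nonneg (by norm_num) h3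
    calc k * Real.logb 2 n ≤ (k+1) * Real.logb 2 n := by nlinarith
      _ ≤ _ := by gcongr
  have h5 : (k+1) * (c / (2 * (k+1)) * n) = c / 2 * n := by field_simp
  linarith

theorem AA.of_ext (k : ℕ) (Wit : ∀ (V : Type) [Fintype V], SimpleGraph V → Finset V → Prop)
    {c : ℝ} (hc : 0 < c) (n₀ : ℕ) (h : ∀ (V : Type) [Fintype V], n₀ ≤ Fintype.card V →
      ∀ (U : Finset V), U.card = k → ∀ G₀ : SimpleGraph V, InF G₀ → Wit V G₀ U →
      cnt (fun G : SimpleGraph V => InF G ∧ Wit V G U ∧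
        ∀ x, x ∉ U → ∀ y, y ∉ U → (G.Adj x y ↔ G₀.Adj x y)) ≤
      (2:ℝ) ^ (((k:ℝ) / 2 - c) * Fintype.card V)) (hk : 1 ≤ k) :
    AA (fun V _ G => ∀ U : Finset V, U.card = k → ¬ Wit V G U) := by
  obtain ⟨n₁, hn₁⟩ := (poly_le_exp k ((k:ℝ)^2/2) (half_pos hc)).exists_forall_of_atTop
  refine ⟨c/2, by linarith, max (max n₀ n₁) (k+1), fun V _ hn Γ hΓ hm => ?_⟩
  set n := Fintype.card V with hndef
  have hn0 : n₀ ≤ n := (le_max_left _ _).trans ((le_max_left _ _).trans hn)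
  have hn1 := hn₁ n ((le_max_right _ _).trans ((le_max_left _ _).trans hn))
  have hkn : k + 1 ≤ n := (le_max_right _ _).trans hn
  have hU := nU_pos n
  set M : ℝ := (2:ℝ) ^ (((k:ℝ) / 2 - c) * n) with hM
  have hM0 : 0 ≤ M := by positivity
  have step : ∀ U : Finset V, U.card = k →
      cnt (fun G : SimpleGraph V => InF G ∧ Wit V G U) ≤ Γ * nU (n-k) * M := by
    intro U hUk
    have hcard : Fintype.card {x // x ∉ U} = n - k := by
      rw [Fintype.card_subtype_compl]; simp [hndef, hUk]
    have h1 : cnt (fun H : SimpleGraph {x // x ∉ U} => InF H) ≤ Γ * nU (n-k) := by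
      rw [cnt_inF, hcard]; exact hm _ (by omega)
    refine le_trans (cnt_fiber (Q := fun H : SimpleGraph {x // x ∉ U} => InF H)
      (fun G => G.comap Subtype.val) (M := M) ?_ ?_) (by gcongr)
    · rintro G ⟨hG, _⟩; exact hG.comap _ Subtype.val_injective
    · intro H _
      by_cases hex : ∃ G₀ : SimpleGraph V, InF G₀ ∧ Wit V G₀ U ∧ G₀.comap Subtype.val = H
      · obtain ⟨G₀, hG₀, hW, hGH⟩ := hex
        refine le_trans (cnt_mono ?_) (h V hn0 U hUk G₀ hG₀ hW)
        rintro G ⟨⟨h1, h2⟩, h3⟩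
        refine ⟨h1, h2, fun x hx y hy => ?_⟩
        have : (G.comap (Subtype.val : {x // x ∉ U} → V)).Adj ⟨x, hx⟩ ⟨y, hy⟩ ↔
            (G₀.comap (Subtype.val : {x // x ∉ U} → V)).Adj ⟨x, hx⟩ ⟨y, hy⟩ := by rw [h3, hGH]
        exact this
      · have : cnt (fun x : SimpleGraph V => (InF x ∧ Wit V x U) ∧ x.comap Subtype.val = H) = 0 := by
          unfold cnt
          rw [Nat.cast_eq_zero, Set.ncard_eq_zero]
          ext G
          simp only [Set.mem_ofPred_eq, Set.mem_empty_iff_false, iff_false]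
          rintro ⟨⟨h1, h2⟩, h3⟩
          exact hex ⟨G, h1, h2, h3⟩
        rw [this]; exact hM0
  have h2 : cnt (fun G : SimpleGraph V => InF G ∧ ¬ ∀ U : Finset V, U.card = k → ¬ Wit V G U) ≤
      (n:ℝ) ^ k * (Γ * nU (n-k) * M) := by
    refine le_trans (cnt_mono (Q := fun G => ∃ U : Finset V, U.card = k ∧ (InF G ∧ Wit V G U)) ?_) ?_
    · rintro G ⟨h1, h2⟩
      push Not at h2
      obtain ⟨U, h3, h4⟩ := h2
      exact ⟨U, h3, h1, h4⟩
    · refine (cnt_exists step).trans ?_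
      have := nU_pos (n-k)
      gcongr
      exact cnt_card_eq_le k
  refine h2.trans ?_
  have h3 := nU_add (n-k) k
  rw [Nat.sub_add_cancel (by omega), Nat.cast_sub (by omega)] at h3
  rw [← rpow_lg (n := n) (by omega), ← Real.rpow_natCast, ← Real.rpow_mul (by norm_num),
    rpow_lg (by omega)]
  set A := nU (n-k)
  have hA : 1 ≤ A := nU_pos _
  calc (2:ℝ) ^ (Real.logb 2 n * k) * (Γ * A * M)
      = Γ * (2 ^ (Real.logb 2 n * k + ((k:ℝ)/2 - c) * n) * A) := by
        rw [Real.rpow_add (by norm_num)]; ring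
    _ ≤ Γ * (2 ^ (-(c/2*n) + (k:ℝ) * (n - k) / 2) * A) := by
        gcongr Γ * (?_ * A)
        apply Real.rpow_le_rpow_of_exponent_le (by norm_num)
        nlinarith
    _ = 2 ^ (-(c/2*n)) * (Γ * ((2:ℝ) ^ ((k:ℝ) * (n - k) / 2) * A)) := by
        rw [Real.rpow_add (by norm_num)]; ring
    _ ≤ _ := by gcongr

section rows
variable {V : Type}

/-- The trace on `U` of the neighbourhood of `v`. -/
def row (G : SimpleGraph V) (U : Finset V) (v : V) : Finset V := U.filter (G.Adj v)

theorem mem_row {G : SimpleGraph V} {U : Finset V} {v x : V} :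
    x ∈ row G U v ↔ x ∈ U ∧ G.Adj v x := by simp [row]

theorem row_subset (G : SimpleGraph V) (U : Finset V) (v : V) : row G U v ⊆ U :=
  Finset.filter_subset _ _

theorem eq_of_row_eq {G H G₀ : SimpleGraph V} {U : Finset V}
    (hG : ∀ x, x ∉ U → ∀ y, y ∉ U → (G.Adj x y ↔ G₀.Adj x y))
    (hH : ∀ x, x ∉ U → ∀ y, y ∉ U → (H.Adj x y ↔ G₀.Adj x y))
    (h : row G U = row H U) : G = H := by
  have key : ∀ x y, y ∈ U → (G.Adj x y ↔ H.Adj x y) := by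
    intro x y hy
    have := congrFun h x
    have h2 : y ∈ row G U x ↔ y ∈ row H U x := by rw [this]
    simpa [mem_row, hy] using h2
  ext x y
  by_cases hy : y ∈ U
  · exact key x y hy
  · by_cases hx : x ∈ U
    · rw [G.adj_comm, H.adj_comm]; exact key y x hx
    · rw [hG x hx y hy, hH x hx y hy]

theorem cnt_ext_le [Fintype V] {U : Finset V} {G₀ : SimpleGraph V} {W : SimpleGraph V → Prop}
    (R : (V → Finset V) → Prop) (h : ∀ G, W G →
      (∀ x, x ∉ U → ∀ y, y ∉ U → (G.Adj x y ↔ G₀.Adj x y)) → R (row G U)) :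
    cnt (fun G : SimpleGraph V => W G ∧
        ∀ x, x ∉ U → ∀ y, y ∉ U → (G.Adj x y ↔ G₀.Adj x y)) ≤ cnt R := by
  refine cnt_inj (fun G => row G U) (fun G hG => h G hG.1 hG.2) ?_
  intro G H hG hH heq
  exact eq_of_row_eq hG.2 hH.2 heq
end rows

/-- Counting functions subject to constraints on disjoint tuples of coordinates. -/
theorem cnt_matching {V ι κ α : Type*} [Fintype V] [Fintype ι] [Fintype κ] [Fintype α]
    (c : ι → κ → V) (hc : Function.Injective fun x : ι × κ => c x.1 x.2)
    (opt : V → α → Prop) (K : ι → (κ → α) → Prop) (b : V → ℝ) (ρ : ℝ)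
    (hb : ∀ v, cnt (opt v) ≤ b v)
    (hK : ∀ i, cnt (fun x : κ → α => (∀ j, opt (c i j) (x j)) ∧ K i x) ≤ ρ * ∏ j, b (c i j)) :
    cnt (fun T : V → α => (∀ v, opt v (T v)) ∧ ∀ i, K i (fun j => T (c i j))) ≤
      ρ ^ Fintype.card ι * ∏ v, b v := by
  set r : Set V := Set.range (fun x : ι × κ => c x.1 x.2) with hr
  have h1 : cnt (fun T : V → α => (∀ v, opt v (T v)) ∧ ∀ i, K i (fun j => T (c i j))) ≤
      cnt (fun p : ({v // v ∉ r} → α) × (ι → κ → α) =>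
        (∀ v, opt v.1 (p.1 v)) ∧ ∀ i, (∀ j, opt (c i j) (p.2 i j)) ∧ K i (p.2 i)) := by
    refine cnt_inj (fun T => (fun v => T v.1, fun i j => T (c i j))) ?_ ?_
    · rintro T ⟨h1, h2⟩
      exact ⟨fun v => h1 _, fun i => ⟨fun j => h1 _, h2 i⟩⟩
    · intro T T' _ _ h
      funext v
      by_cases hv : v ∈ r
      · obtain ⟨⟨i, j⟩, rfl⟩ := hv
        exact congrFun (congrFun (congrArg Prod.snd h) i) j
      · exact congrFun (congrArg Prod.fst h) ⟨v, hv⟩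
  refine h1.trans ?_
  have h2 := cnt_prod (fun p : {v // v ∉ r} → α => ∀ v, opt v.1 (p v))
    (fun q : ι → κ → α => ∀ i, (∀ j, opt (c i j) (q i j)) ∧ K i (q i))
  rw [h2, cnt_pi, cnt_pi (fun (i : ι) (x : κ → α) => (∀ j, opt (c i j) (x j)) ∧ K i x)]
  have hb0 : ∀ v, 0 ≤ b v := fun v => (cnt_nonneg _).trans (hb v)
  have h3 : ∏ v, b v = (∏ v : {v // v ∉ r}, b v) * ∏ i, ∏ j, b (c i j) := by
    rw [← Fintype.prod_subtype_mul_prod_subtype (fun v => v ∈ r) b, mul_comm]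
    congr 1
    rw [← Fintype.prod_prod_type' (fun i j => b (c i j))]
    symm
    convert Function.Bijective.prod_comp (e := fun x : ι × κ => (⟨c x.1 x.2, ⟨x, rfl⟩⟩ : {v // v ∈ r}))
      ⟨fun x y h => hc (congrArg Subtype.val h), by rintro ⟨_, ⟨x, rfl⟩⟩; exact ⟨x, rfl⟩⟩ (fun v => b v.1)
      using 1
    convert rfl
  rw [h3]
  calc (∏ v : {v // v ∉ r}, cnt (opt v.1)) *
        ∏ i, cnt (fun x : κ → α => (∀ j, opt (c i j) (x j)) ∧ K i x)
      ≤ (∏ v : {v // v ∉ r}, b v) * ∏ i, (ρ * ∏ j, b (c i j)) := by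
        gcongr with v _ i _
        · exact Finset.prod_nonneg fun _ _ => cnt_nonneg _
        · exact Finset.prod_nonneg fun _ _ => hb0 _
        · exact fun _ _ => cnt_nonneg _
        · exact hb _
        · exact fun _ _ => cnt_nonneg _
        · exact hK i
    _ = _ := by
        rw [Finset.prod_mul_distrib, Finset.prod_const, Finset.card_univ]; ring

/-- Either many disjoint tuples or a small cover. -/
theorem matching_or_cover {V : Type*} [Fintype V] (p : ℕ) (Q : (Fin p → V) → Prop) (t : ℕ) :
    (∃ c : Fin t → Fin p → V, (Function.Injective fun x : Fin t × Fin p => c x.1 x.2) ∧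
      ∀ i, Q (c i)) ∨
    ∃ R : Finset V, R.card ≤ p * t ∧
      ∀ x : Fin p → V, Function.Injective x → (∀ i, x i ∉ R) → ¬ Q x := by
  induction t with
  | zero => exact Or.inl ⟨fun i => i.elim0, fun x => x.1.elim0, fun i => i.elim0⟩
  | succ t ih =>
    rcases ih with ⟨c, hc, hQ⟩ | ⟨R, hR, h⟩
    · set R : Finset V := Finset.univ.image (fun x : Fin t × Fin p => c x.1 x.2) with hRdef
      by_cases hex : ∃ x : Fin p → V, Function.Injective x ∧ (∀ i, x i ∉ R) ∧ Q x
      · obtain ⟨x, hx, hxR, hQx⟩ := hex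
        left
        refine ⟨Fin.cons x c, ?_, ?_⟩
        · rintro ⟨i, j⟩ ⟨i', j'⟩ h
          induction i using Fin.cases with
          | zero =>
            induction i' using Fin.cases with
            | zero => simp only [Fin.cons_zero] at h; rw [hx h]
            | succ i' =>
              simp only [Fin.cons_zero, Fin.cons_succ] at h
              exact absurd (by rw [h, hRdef]; exact Finset.mem_image.2 ⟨(i', j'), by simp⟩) (hxR j)
          | succ i =>
            induction i' using Fin.cases with
            | zero =>
              simp only [Fin.cons_zero, Fin.cons_succ] at h
              exact absurd (by rw [← h, hRdef]; exact Finset.mem_image.2 ⟨(i, j), by simp⟩) (hxR j')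
            | succ i' =>
              simp only [Fin.cons_succ] at h
              have := hc (a₁ := (i, j)) (a₂ := (i', j')) h
              simp only [Prod.mk.injEq] at this
              rw [this.1, this.2]
        · intro i
          induction i using Fin.cases with
          | zero => simpa using hQx
          | succ i => simpa using hQ i
      · right
        refine ⟨R, ?_, fun x hx hxR hQx => hex ⟨x, hx, hxR, hQx⟩⟩
        refine Finset.card_image_le.trans ?_
        simp; nlinarith
    · right
      exact ⟨R, hR.trans (by nlinarith), h⟩

/-- Tuples of subsets of `S` avoiding a given pattern at every element -/
theorem cnt_avoid_pattern {V ι : Type} [Fintype V] [Fintype ι] (S : Finset V) (f₀ : ι → Bool) :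
    cnt (fun x : ι → Finset V => (∀ j, x j ⊆ S) ∧ ∀ u ∈ S, (fun j => decide (u ∈ x j)) ≠ f₀) ≤
      (2 ^ Fintype.card ι - 1) ^ S.card := by
  have h1 : cnt (fun x : ι → Finset V => (∀ j, x j ⊆ S) ∧ ∀ u ∈ S, (fun j => decide (u ∈ x j)) ≠ f₀) ≤
      cnt (fun y : {u // u ∈ S} → ι → Bool => ∀ u, y u ≠ f₀) := by
    refine cnt_inj (fun x u j => decide (u.1 ∈ x j)) ?_ ?_
    · rintro x ⟨_, h⟩ u
      exact h u.1 u.2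
    · rintro x y ⟨hx, _⟩ ⟨hy, _⟩ h
      funext j
      ext u
      by_cases hu : u ∈ S
      · have := congrFun (congrFun h ⟨u, hu⟩) j
        simpa using this
      · exact ⟨fun h => absurd (hx j h) hu, fun h => absurd (hy j h) hu⟩
  refine h1.trans (le_of_eq ?_)
  rw [cnt_pi (fun _ y => y ≠ f₀)]
  have h2 : cnt (fun y : ι → Bool => y ≠ f₀) = 2 ^ Fintype.card ι - 1 := by
    rw [cnt_eq_card_filter]
    rw [Finset.filter_ne' Finset.univ f₀, Finset.card_erase_of_mem (Finset.mem_univ _),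
      Finset.card_univ, Nat.cast_sub (Fintype.card_pos)]
    simp
  simp only [h2, Finset.prod_const]
  simp

section generic
variable {V : Type}

/-- Vertices outside `S` with at least `θ` neighbours and `θ` non-neighbours in `S`. -/
def genericSet [Fintype V] (G : SimpleGraph V) (S : Finset V) (θ : ℕ) : Finset V :=
  Finset.univ.filter fun v => v ∉ S ∧ θ ≤ (row G S v).card ∧ θ ≤ (S \ row G S v).card

theorem mem_genericSet [Fintype V] {G : SimpleGraph V} {S : Finset V} {θ : ℕ} {v : V} :
    v ∈ genericSet G S θ ↔ v ∉ S ∧ θ ≤ (row G S v).card ∧ θ ≤ (S \ row G S v).card := by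
  simp [genericSet]

theorem row_compl {G : SimpleGraph V} {S : Finset V} {v : V} (hv : v ∉ S) :
    row Gᶜ S v = S \ row G S v := by
  ext x
  simp only [mem_row, SimpleGraph.compl_adj, Finset.mem_sdiff]
  constructor
  · rintro ⟨h1, h2, h3⟩; exact ⟨h1, fun h => h3 h.2⟩
  · rintro ⟨h1, h2⟩
    exact ⟨h1, fun h => hv (h ▸ h1), fun h => h2 ⟨h1, h⟩⟩

theorem genericSet_compl [Fintype V] (G : SimpleGraph V) (S : Finset V) (θ : ℕ) :
    genericSet Gᶜ S θ = genericSet G S θ := by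
  ext v
  simp only [mem_genericSet]
  refine and_congr_right fun hv => ?_
  rw [row_compl hv, Finset.sdiff_sdiff_eq_self (row_subset _ _ _), and_comm]

theorem cnt_nongeneric [Fintype V] (S : Finset V) (θ : ℕ) :
    cnt (fun T : Finset V => T ⊆ S ∧ (T.card < θ ∨ (S \ T).card < θ)) ≤ 2 * ballCard S.card θ := by
  have h0 : cnt (fun T : Finset V => T ⊆ S ∧ T.card < θ) ≤ ballCard S.card θ := by
    have := cnt_card_le (V := {u // u ∈ S}) θ
    rw [Fintype.card_coe] at this
    rw [← this]
    refine cnt_inj (fun T => T.subtype (· ∈ S)) ?_ ?_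
    · rintro T ⟨h1, h2⟩
      rw [Finset.card_subtype]
      exact (Finset.card_filter_le _ _).trans h2.le
    · rintro T T' ⟨h1, _⟩ ⟨h2, _⟩ h
      ext u
      by_cases hu : u ∈ S
      · have : (⟨u, hu⟩ : {u // u ∈ S}) ∈ T.subtype (· ∈ S) ↔ (⟨u, hu⟩ : {u // u ∈ S}) ∈ T'.subtype (· ∈ S) := by
          have h' : T.subtype (· ∈ S) = T'.subtype (· ∈ S) := h
          rw [h']
        simpa using this
      · exact ⟨fun h => absurd (h1 h) hu, fun h => absurd (h2 h) hu⟩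
  have h1 : cnt (fun T : Finset V => T ⊆ S ∧ (S \ T).card < θ) ≤ ballCard S.card θ := by
    refine le_trans (cnt_inj (fun T => S \ T) ?_ ?_) h0
    · rintro T ⟨h1, h2⟩; exact ⟨Finset.sdiff_subset, h2⟩
    · rintro T T' ⟨h1, _⟩ ⟨h2, _⟩ h
      have h' : S \ T = S \ T' := h
      rw [← Finset.sdiff_sdiff_eq_self h1, h', Finset.sdiff_sdiff_eq_self h2]
  refine le_trans (cnt_mono ?_) ((cnt_or _ _).trans (add_le_add h0 h1) |>.trans (by linarith))
  rintro T ⟨h1, h2⟩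
  exact h2.imp (fun h => ⟨h1, h⟩) (fun h => ⟨h1, h⟩)

/-- The bound for one row: full freedom on `W`, few options off `W`. -/
def rowOpt (S W : Finset V) (θ : ℕ) (v : V) (T : Finset V) : Prop :=
  T ⊆ S ∧ (v ∉ W → T.card < θ ∨ (S \ T).card < θ)

def rowBd (S W : Finset V) (B : ℝ) (v : V) : ℝ := if v ∈ W then 2 ^ S.card else B

theorem cnt_rowOpt_le [Fintype V] {S W : Finset V} {θ : ℕ} {B : ℝ}
    (hB : 2 * ballCard S.card θ ≤ B) (v : V) : cnt (rowOpt S W θ v) ≤ rowBd S W B v := by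
  unfold rowBd
  split_ifs with h
  · rw [← cnt_finset_subset]
    exact cnt_mono fun T hT => hT.1
  · refine le_trans (cnt_mono ?_) ((cnt_nongeneric S θ).trans hB)
    exact fun T hT => ⟨hT.1, hT.2 h⟩

theorem prod_rowBd_le [Fintype V] {S W : Finset V} {w d : ℝ} (hd : 0 ≤ d) (hW : (W.card:ℝ) ≤ w) :
    ∏ v, rowBd S W ((2:ℝ) ^ d) v ≤ (2:ℝ) ^ (S.card * w + d * Fintype.card V) := by
  unfold rowBd
  rw [Finset.prod_ite, Finset.prod_const, Finset.prod_const, ← pow_mul, ← Real.rpow_natCast,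
    ← Real.rpow_natCast, ← Real.rpow_mul (by norm_num), ← Real.rpow_add (by norm_num)]
  apply Real.rpow_le_rpow_of_exponent_le (by norm_num)
  push_cast
  have h1 : (Finset.univ.filter fun v => v ∈ W) = W := by ext; simp
  have h2 : ((Finset.univ.filter fun v => v ∉ W).card : ℝ) ≤ Fintype.card V := by
    exact_mod_cast Finset.card_le_univ _
  rw [h1]
  gcongr

theorem cnt_finset_true [Fintype V] (P : Finset V → Prop) :
    cnt P ≤ (2:ℝ) ^ (Fintype.card V : ℝ) := by
  refine (cnt_le_card _).trans (le_of_eq ?_)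
  rw [Fintype.card_finset, Real.rpow_natCast]; push_cast; rfl
end generic

theorem aa_genericSet_large {ε : ℝ} (hε : 0 < ε) {s θ : ℕ} (hs : 4 ≤ s * ε)
    (hB : 2 * ballCard s θ ≤ (2:ℝ) ^ (ε / 4 * s)) :
    AA (fun V _ G => ∀ S : Finset V, S.card = s →
      ¬ ((genericSet G S θ).card < (1/2 - ε) * Fintype.card V)) := by
  have hs0 : 1 ≤ s := by
    rcases Nat.eq_zero_or_pos s with h | h
    · subst h; simp at hs; linarith
    · exact h
  obtain ⟨n₀, hn₀⟩ := (eventually_ge_real (4 * s / ε)).exists_forall_of_atTop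
  refine AA.of_ext s (fun V _ G S => (genericSet G S θ).card < (1/2 - ε) * Fintype.card V)
    (c := 1) one_pos n₀ ?_ hs0
  intro V _ hn S hS G₀ _ _
  set n := Fintype.card V with hndef
  have hn1 := hn₀ n hn
  set w : ℝ := (1/2 - ε) * n + s with hw
  have hcnt := cnt_ext_le (U := S) (G₀ := G₀)
    (W := fun G => InF G ∧ (genericSet G S θ).card < (1/2 - ε) * n)
    (fun T => ∃ W : Finset V, (W.card : ℝ) ≤ w ∧ ∀ v, rowOpt S W θ v (T v)) (by
      rintro G ⟨_, hG⟩ _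
      refine ⟨genericSet G S θ ∪ S, ?_, fun v => ⟨row_subset _ _ _, fun hv => ?_⟩⟩
      · have : ((genericSet G S θ ∪ S).card : ℝ) ≤ (genericSet G S θ).card + S.card := by
          exact_mod_cast Finset.card_union_le _ _
        rw [hS] at this
        linarith
      · rw [Finset.mem_union, not_or, mem_genericSet] at hv
        by_contra hcon
        push Not at hcon
        exact hv.1 ⟨hv.2, hcon⟩)
  simp only [and_assoc] at hcnt
  refine hcnt.trans ?_
  refine (cnt_exists (M := (2:ℝ) ^ (s * w + ε / 4 * s * n)) ?_).trans ?_
  · intro W hW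
    rw [cnt_pi]
    have h1 : ∏ v, cnt (rowOpt S W θ v) ≤ ∏ v, rowBd S W ((2:ℝ) ^ (ε / 4 * s)) v := by
      apply Finset.prod_le_prod (fun _ _ => cnt_nonneg _)
      intro v _
      exact cnt_rowOpt_le (by rw [hS]; exact hB) v
    refine h1.trans ?_
    have := prod_rowBd_le (S := S) (d := ε / 4 * s) (by positivity) hW
    rwa [hS] at this
  · calc _ ≤ (2:ℝ) ^ (n:ℝ) * (2:ℝ) ^ (s * w + ε / 4 * s * n) := by
          gcongr; exact cnt_finset_true _
      _ ≤ _ := by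
        rw [← Real.rpow_add (by norm_num)]
        apply Real.rpow_le_rpow_of_exponent_le (by norm_num)
        rw [div_le_iff₀ hε] at hn1
        rw [hw]
        have hs0' : (1:ℝ) ≤ s := by exact_mod_cast hs0
        have hn0 : (0:ℝ) ≤ n := Nat.cast_nonneg _
        nlinarith [mul_le_mul_of_nonneg_left hn1 (by linarith : (0:ℝ) ≤ s), mul_le_mul_of_nonneg_right hs hn0]

/-- The triple induces a path with middle vertex `x 1` -/
def IsP3 {V : Type} (G : SimpleGraph V) (x : Fin 3 → V) : Prop :=
  G.Adj (x 0) (x 1) ∧ G.Adj (x 1) (x 2) ∧ ¬ G.Adj (x 0) (x 2) ∧ x 0 ≠ x 2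

theorem IsP3.injective {V : Type} {G : SimpleGraph V} {x : Fin 3 → V} (h : IsP3 G x) :
    Function.Injective x := by
  obtain ⟨h1, h2, h3, h4⟩ := h
  have h1' := h1.ne
  have h2' := h2.ne
  intro i j hij
  fin_cases i <;> fin_cases j <;> simp_all

theorem pFree_of_no_isP3 {V : Type} {G : SimpleGraph V} {X : Set V}
    (h : ∀ x : Fin 3 → V, (∀ i, x i ∈ X) → ¬ IsP3 G x) : PFree G X := by
  intro u v w hu hv hw h1 h2 h3
  by_contra hcon
  refine h ![u, v, w] ?_ ⟨h1, h2, hcon, h3⟩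
  intro i; fin_cases i <;> assumption

/-- The constraint a clique imposes on the traces of an induced path -/
def P3Rows {V : Type} (x : Fin 3 → Finset V) : Prop :=
  (∀ u, ¬ (u ∈ x 0 ∧ u ∉ x 1 ∧ u ∉ x 2)) ∨ (∀ u, ¬ (u ∈ x 2 ∧ u ∉ x 1 ∧ u ∉ x 0))

theorem p3Rows_of_isP3 {V : Type} {G : SimpleGraph V} (hG : NoC5 G) {S : Finset V}
    (hS : G.IsClique ↑S) {x : Fin 3 → V} (hx : IsP3 G x) :
    P3Rows (fun j => row G S (x j)) := by
  by_contra hcon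
  simp only [P3Rows, not_or, not_forall, not_not, mem_row] at hcon
  obtain ⟨⟨a, ha, ha1, ha2⟩, ⟨b, hb, hb1, hb2⟩⟩ := hcon
  obtain ⟨h1, h2, h3, h4⟩ := hx
  have hab : a ≠ b := by rintro rfl; exact ha2 hb
  refine hG (x 0) (x 1) (x 2) b a h1 h2 hb.2 (hS hb.1 ha.1 hab.symm) ha.2.symm h3
    (fun h => hb2 ⟨hb.1, h⟩) (fun h => hb1 ⟨hb.1, h⟩) (fun h => ha1 ⟨ha.1, h⟩)
    (fun h => ha2 ⟨ha.1, h⟩)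

theorem cnt_p3Rows {V : Type} [Fintype V] (S : Finset V) :
    cnt (fun x : Fin 3 → Finset V => (∀ j, x j ⊆ S) ∧ P3Rows x) ≤ 2 * 7 ^ S.card := by
  have h1 := cnt_avoid_pattern S (![true, false, false] : Fin 3 → Bool)
  have h2 := cnt_avoid_pattern S (![false, false, true] : Fin 3 → Bool)
  norm_num at h1 h2
  refine le_trans (cnt_mono ?_) ((cnt_or _ _).trans (add_le_add h1 h2) |>.trans (by linarith))
  rintro x ⟨hx, h | h⟩
  · left
    refine ⟨hx, fun u hu he => h u ?_⟩
    have e0 := congrFun he 0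
    have e1 := congrFun he 1
    have e2 := congrFun he 2
    simp at e0 e1 e2
    exact ⟨e0, e1, e2⟩
  · right
    refine ⟨hx, fun u hu he => h u ?_⟩
    have e0 := congrFun he 0
    have e1 := congrFun he 1
    have e2 := congrFun he 2
    simp at e0 e1 e2
    exact ⟨e2, e1, e0⟩

theorem seven_pow_bound {s : ℕ} (hs : 16 ≤ s) :
    2 * (7:ℝ) ^ s ≤ (2:ℝ) ^ (-(s:ℝ)/8) * ((2:ℝ)^s) ^ 3 := by
  have h1 : (7:ℝ) ≤ 2 ^ (45/16:ℝ) := by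
    have : (7:ℝ) = (7 ^ 16) ^ (1/16 : ℝ) := by
      rw [← Real.rpow_natCast, ← Real.rpow_mul (by norm_num)]; norm_num
    rw [this, show (45/16:ℝ) = 45 * (1/16) by norm_num, Real.rpow_mul (by norm_num)]
    apply Real.rpow_le_rpow (by norm_num) _ (by norm_num)
    norm_num
  have hs' : (16:ℝ) ≤ s := by exact_mod_cast hs
  calc 2 * (7:ℝ) ^ s ≤ 2 ^ (1:ℝ) * (2 ^ (45/16:ℝ)) ^ s := by
        rw [Real.rpow_one]; gcongr
    _ = 2 ^ (1 + 45/16 * (s:ℝ)) := by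
        rw [← Real.rpow_natCast, ← Real.rpow_mul (by norm_num), ← Real.rpow_add (by norm_num)]
    _ ≤ 2 ^ (-(s:ℝ)/8 + s * 3) := by
        apply Real.rpow_le_rpow_of_exponent_le (by norm_num)
        linarith
    _ = _ := by
        rw [Real.rpow_add (by norm_num), ← pow_mul, ← Real.rpow_natCast]; push_cast; rfl

theorem aa_no_p3_matching {ε ζ : ℝ} (hε : 0 < ε) (hζ : 0 < ζ) (hεζ : 20 * ε ≤ ζ) {s θ : ℕ}
    (hs : 128 ≤ s * ζ) (hs16 : 16 ≤ s) (hB : 2 * ballCard s θ ≤ (2:ℝ) ^ (ε / 4 * s)) :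
    AA (fun V _ G => ∀ S : Finset V, S.card = s →
      ¬ (G.IsClique ↑S ∧ (genericSet G S θ).card ≤ (1/2 + ε) * Fintype.card V ∧
        ∃ c : Fin ⌈ζ * Fintype.card V⌉₊ → Fin 3 → V,
          (Function.Injective fun x : Fin ⌈ζ * Fintype.card V⌉₊ × Fin 3 => c x.1 x.2) ∧
          ∀ i, (∀ j, c i j ∈ genericSet G S θ) ∧ IsP3 G (c i))) := by
  obtain ⟨n₀, hn₀⟩ := (eventually_ge_real (64 * s / ζ)).exists_forall_of_atTop
  refine AA.of_ext s (fun V _ G S => G.IsClique ↑S ∧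
    (genericSet G S θ).card ≤ (1/2 + ε) * Fintype.card V ∧
        ∃ c : Fin ⌈ζ * Fintype.card V⌉₊ → Fin 3 → V,
          (Function.Injective fun x : Fin ⌈ζ * Fintype.card V⌉₊ × Fin 3 => c x.1 x.2) ∧
          ∀ i, (∀ j, c i j ∈ genericSet G S θ) ∧ IsP3 G (c i))
    (c := 1) one_pos n₀ ?_ (by omega)
  intro V _ hn S hS G₀ _ _
  set n := Fintype.card V with hndef
  have hn1 := hn₀ n hn
  set t := ⌈ζ * (n:ℝ)⌉₊ with ht
  have ht' : ζ * n ≤ t := Nat.le_ceil _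
  set w : ℝ := (1/2 + ε) * n + s with hw
  set CW : Finset V → (Fin t → Fin 3 → V) → Prop := fun W c =>
    (Function.Injective fun x : Fin t × Fin 3 => c x.1 x.2) ∧
      ∀ i, (∀ j, c i j ∈ W ∧ c i j ∉ S) ∧ IsP3 G₀ (c i) with hCW
  have hcnt := cnt_ext_le (U := S) (G₀ := G₀)
    (W := fun G => InF G ∧ G.IsClique ↑S ∧
      (genericSet G S θ).card ≤ (1/2 + ε) * n ∧
        ∃ c : Fin t → Fin 3 → V, (Function.Injective fun x : Fin t × Fin 3 => c x.1 x.2) ∧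
          ∀ i, (∀ j, c i j ∈ genericSet G S θ) ∧ IsP3 G (c i))
    (fun T => ∃ W : Finset V, ((W.card : ℝ) ≤ w ∧ ∃ c, CW W c) ∧
      ((∀ v, rowOpt S W θ v (T v)) ∧ ∀ c, CW W c → ∀ i, P3Rows (fun j => T (c i j)))) (by
      rintro G ⟨hF, hcl, hG, c, hc, hc2⟩ hag
      refine ⟨genericSet G S θ ∪ S, ⟨?_, c, hc, fun i => ⟨fun j => ?_, ?_⟩⟩,
        fun v => ⟨row_subset _ _ _, fun hv => ?_⟩, fun c' hc' i => ?_⟩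
      · have : ((genericSet G S θ ∪ S).card : ℝ) ≤ (genericSet G S θ).card + S.card := by
          exact_mod_cast Finset.card_union_le _ _
        rw [hS] at this
        linarith
      · have := (hc2 i).1 j
        exact ⟨Finset.mem_union_left _ this, (mem_genericSet.1 this).1⟩
      · obtain ⟨h1, h2⟩ := hc2 i
        have hS' : ∀ j, c i j ∉ S := fun j => (mem_genericSet.1 (h1 j)).1
        obtain ⟨a, b, d, e⟩ := h2
        exact ⟨(hag _ (hS' _) _ (hS' _)).1 a, (hag _ (hS' _) _ (hS' _)).1 b,
          fun h => d ((hag _ (hS' _) _ (hS' _)).2 h), e⟩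
      · rw [Finset.mem_union, not_or, mem_genericSet] at hv
        by_contra hcon
        push Not at hcon
        exact hv.1 ⟨hv.2, hcon⟩
      · obtain ⟨h1, a, b, d, e⟩ := hc'.2 i
        refine p3Rows_of_isP3 hF.noC5 hcl ⟨?_, ?_, ?_, e⟩
        · exact (hag _ (h1 _).2 _ (h1 _).2).2 a
        · exact (hag _ (h1 _).2 _ (h1 _).2).2 b
        · exact fun h => d ((hag _ (h1 _).2 _ (h1 _).2).1 h))
  refine le_trans (cnt_mono fun G h => ⟨⟨h.1, h.2.1⟩, h.2.2⟩) (hcnt.trans ?_)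
  have hs0' : (16:ℝ) ≤ s := by exact_mod_cast hs16
  refine (cnt_exists (M := (2:ℝ) ^ (-(s:ℝ)/8 * (ζ * n) + (s * w + ε / 4 * s * n))) ?_).trans ?_
  · rintro W ⟨hW, c, hc⟩
    have h1 := cnt_matching c hc.1 (rowOpt S W θ) (fun _ => P3Rows)
      (rowBd S W ((2:ℝ) ^ (ε / 4 * s))) ((2:ℝ) ^ (-(s:ℝ)/8))
      (cnt_rowOpt_le (by rw [hS]; exact hB)) (by
        intro i
        have : ∀ j, rowBd S W ((2:ℝ) ^ (ε / 4 * s)) (c i j) = 2 ^ s := by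
          intro j; rw [rowBd, if_pos ((hc.2 i).1 j).1, hS]
        simp only [this, Finset.prod_const, Finset.card_univ, Fintype.card_fin]
        refine le_trans (cnt_mono ?_) ((cnt_p3Rows S).trans (by rw [hS]; exact seven_pow_bound hs16))
        rintro x ⟨h1, h2⟩
        exact ⟨fun j => (h1 j).1, h2⟩)
    refine (cnt_mono ?_).trans (h1.trans ?_)
    · rintro T ⟨h1, h2⟩
      exact ⟨h1, fun i => h2 c hc i⟩
    · have h2 := prod_rowBd_le (S := S) (d := ε / 4 * s) (by positivity) hW
      rw [hS] at h2
      rw [Real.rpow_add (by norm_num), Fintype.card_fin]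
      gcongr
      · exact Finset.prod_nonneg fun v _ => (cnt_nonneg _).trans (cnt_rowOpt_le (θ := θ) (by rw [hS]; exact hB) v)
      · rw [← Real.rpow_natCast, ← Real.rpow_mul (by norm_num)]
        apply Real.rpow_le_rpow_of_exponent_le (by norm_num)
        nlinarith
  · calc _ ≤ (2:ℝ) ^ (n:ℝ) * (2:ℝ) ^ (-(s:ℝ)/8 * (ζ * n) + (s * w + ε / 4 * s * n)) := by
          gcongr; exact cnt_finset_true _
      _ ≤ _ := by
        rw [← Real.rpow_add (by norm_num)]
        apply Real.rpow_le_rpow_of_exponent_le (by norm_num)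
        rw [div_le_iff₀ hζ] at hn1
        rw [hw]
        have hn0 : (0:ℝ) ≤ n := Nat.cast_nonneg _
        have a1 : s * (64 * s) ≤ s * (n * ζ) := by gcongr
        have a2 : s * n * (20 * ε) ≤ s * n * ζ := by gcongr
        have a3 : 128 * n ≤ s * ζ * n := by gcongr
        nlinarith

theorem aa_clean_of_clique {ε ζ : ℝ} (hε : 0 < ε) (hζ : 0 < ζ) (hεζ : 20 * ε ≤ ζ) {s θ : ℕ}
    (hs : 128 ≤ s * ζ) (hs16 : 16 ≤ s) (hB : 2 * ballCard s θ ≤ (2:ℝ) ^ (ε / 4 * s)) :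
    AA (fun V _ G => ∀ S : Finset V, S.card = s → G.IsClique ↑S →
      (genericSet G S θ).card ≤ (1/2 + ε) * Fintype.card V →
      ∃ R : Finset V, R.card ≤ 4 * ζ * Fintype.card V ∧ PFree G ↑(genericSet G S θ \ R)) := by
  obtain ⟨n₁, hn₁⟩ := (eventually_ge_real (3 / ζ)).exists_forall_of_atTop
  refine (aa_no_p3_matching hε hζ hεζ hs hs16 hB).mono n₁ ?_
  intro V _ hn G _ hP S hS hcl hW
  set n := Fintype.card V
  have h1 := hn₁ n hn
  rw [div_le_iff₀ hζ] at h1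
  have := hP S hS
  rcases matching_or_cover 3 (fun x => (∀ j, x j ∈ genericSet G S θ) ∧ IsP3 G x) ⌈ζ * (n:ℝ)⌉₊ with h | ⟨R, hR, h⟩
  · exact absurd ⟨hcl, hW, h⟩ this
  · refine ⟨R, ?_, pFree_of_no_isP3 ?_⟩
    · have h2 : (R.card : ℝ) ≤ 3 * ⌈ζ * (n:ℝ)⌉₊ := by exact_mod_cast hR
      have h3 := Nat.ceil_lt_add_one (a := ζ * (n:ℝ)) (by positivity)
      nlinarith
    · intro x hx hp
      simp only [Finset.coe_sdiff, Set.mem_sdiff, Finset.mem_coe] at hx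
      exact h x hp.injective (fun i => (hx i).2) ⟨fun j => (hx j).1, hp⟩

theorem aa_clean_of_hom {ε ζ : ℝ} (hε : 0 < ε) (hζ : 0 < ζ) (hεζ : 20 * ε ≤ ζ) {s θ : ℕ}
    (hs : 128 ≤ s * ζ) (hs16 : 16 ≤ s) (hB : 2 * ballCard s θ ≤ (2:ℝ) ^ (ε / 4 * s)) :
    AA (fun V _ G => ∀ S : Finset V, S.card = s → Hom G S →
      (genericSet G S θ).card ≤ (1/2 + ε) * Fintype.card V →
      ∃ R : Finset V, R.card ≤ 4 * ζ * Fintype.card V ∧ Clean G ↑(genericSet G S θ \ R)) := by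
  have h := aa_clean_of_clique hε hζ hεζ hs hs16 hB
  refine (h.and h.compl).mono 0 ?_
  rintro V _ _ G _ ⟨h1, h2⟩ S hS hcl hW
  rcases hcl with hcl | hcl
  · obtain ⟨R, hR, hP⟩ := h1 S hS hcl hW
    exact ⟨R, hR, Or.inl hP⟩
  · obtain ⟨R, hR, hP⟩ := h2 S hS hcl (by rw [genericSet_compl]; exact hW)
    rw [genericSet_compl] at hP
    exact ⟨R, hR, Or.inr hP⟩

theorem aa_many_rows (r : ℕ) (hr : 0 < r) :
    AA (fun V _ G => ∀ H : Finset V, H.card = r →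
      ¬ ((Finset.univ.image (row G H)).card < (2:ℝ) ^ ((r:ℝ)/2 - 2))) := by
  refine AA.of_ext r (fun V _ G H => (Finset.univ.image (row G H)).card < (2:ℝ) ^ ((r:ℝ)/2 - 2))
    (c := 1) one_pos (2 ^ r) ?_ hr
  intro V _ hn H hH G₀ _ _
  set n := Fintype.card V with hndef
  have hcnt := cnt_ext_le (U := H) (G₀ := G₀)
    (W := fun G => InF G ∧ (Finset.univ.image (row G H)).card < (2:ℝ) ^ ((r:ℝ)/2 - 2))
    (fun T => ∃ F : Finset (Finset V), (F ⊆ H.powerset ∧ F.card < (2:ℝ) ^ ((r:ℝ)/2 - 2)) ∧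
      ∀ v, T v ∈ F) (by
      rintro G ⟨_, hG⟩ _
      refine ⟨Finset.univ.image (row G H), ⟨?_, hG⟩, fun v => Finset.mem_image_of_mem _ (Finset.mem_univ _)⟩
      intro X hX
      obtain ⟨v, _, rfl⟩ := Finset.mem_image.1 hX
      exact Finset.mem_powerset.2 (row_subset _ _ _))
  refine le_trans (cnt_mono fun G h => ⟨⟨h.1, h.2.1⟩, h.2.2⟩) (hcnt.trans ?_)
  refine (cnt_exists (M := ((2:ℝ) ^ ((r:ℝ)/2 - 2)) ^ n) ?_).trans ?_
  · rintro F ⟨_, hF⟩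
    rw [cnt_pi (fun _ X => X ∈ F), Finset.prod_const, Finset.card_univ]
    gcongr
    · exact cnt_nonneg _
    · rw [cnt_eq_card_filter]
      refine le_trans ?_ hF.le
      rw [Finset.filter_univ_mem]
  · have h1 : cnt (fun F : Finset (Finset V) => F ⊆ H.powerset ∧ F.card < (2:ℝ) ^ ((r:ℝ)/2 - 2)) ≤
        (2:ℝ) ^ (n:ℝ) := by
      refine (cnt_mono (Q := fun F => F ⊆ H.powerset) fun F h => h.1).trans ?_
      rw [cnt_finset_subset, Finset.card_powerset, hH, Real.rpow_natCast]
      exact pow_le_pow_right₀ (by norm_num) hn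
    calc _ ≤ (2:ℝ) ^ (n:ℝ) * ((2:ℝ) ^ ((r:ℝ)/2 - 2)) ^ n := by gcongr
      _ = _ := by
        rw [← Real.rpow_natCast, ← Real.rpow_mul (by norm_num), ← Real.rpow_add (by norm_num)]
        congr 1; ring

section rich
variable {V : Type}

/-- Two homogeneous sets; all vertices of the second one have different traces on the first. -/
structure TracePair (G : SimpleGraph V) (S₁ S₂ : Finset V) : Prop where
  hom₁ : Hom G S₁
  hom₂ : Hom G S₂
  disj : Disjoint S₁ S₂
  inj : Set.InjOn (row G S₁) ↑S₂

theorem exists_tracePair [Fintype V] {G : SimpleGraph V} (hG : InF G) {H : Finset V} {r s : ℕ}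
    (hH : H.card = r) (hom : Hom G H) (hs : 0 < s)
    (hN : ballCard r (s-1) ^ 2 + r < (Finset.univ.image (row G H)).card) :
    ∃ S₁ S₂ : Finset V, S₁.card = s ∧ S₂.card = 2 ^ s ∧ TracePair G S₁ S₂ := by
  obtain ⟨R, hRH, hRinj, hRimg⟩ : ∃ R ⊆ Hᶜ, Set.InjOn (row G H) ↑R ∧
      R.image (row G H) = Hᶜ.image (row G H) := by
    have : ∀ X ∈ Hᶜ.image (row G H), ∃ v, v ∈ Hᶜ ∧ row G H v = X := fun X hX => by
      simpa using hX
    have : ∀ X, ∃ v, X ∈ Hᶜ.image (row G H) → v ∈ Hᶜ ∧ row G H v = X := fun X => by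
      by_cases hX : X ∈ Hᶜ.image (row G H)
      · obtain ⟨v, hv⟩ := this X hX
        exact ⟨v, fun _ => hv⟩
      · by_cases hne : Nonempty V
        · exact ⟨hne.some, fun h => absurd h hX⟩
        · rw [not_nonempty_iff] at hne
          have h0 : ((Finset.univ.image (row G H)).card : ℝ) = 0 := by simp
          rw [h0] at hN
          have := ballCard_pos r (s-1)
          have : (0:ℝ) ≤ r := Nat.cast_nonneg _
          nlinarith
    choose g hg using this
    have hg1 := fun X hX => (hg X hX).1
    have hg2 := fun X hX => (hg X hX).2
    clear hg
    refine ⟨(Hᶜ.image (row G H)).image g, ?_, ?_, ?_⟩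
    · intro v hv
      obtain ⟨X, hX, rfl⟩ := Finset.mem_image.1 hv
      exact hg1 X hX
    · intro v hv w hw h
      obtain ⟨X, hX, rfl⟩ := Finset.mem_image.1 (Finset.mem_coe.1 hv)
      obtain ⟨Y, hY, rfl⟩ := Finset.mem_image.1 (Finset.mem_coe.1 hw)
      rw [hg2 X hX, hg2 Y hY] at h
      rw [h]
    · rw [Finset.image_image]
      conv_rhs => rw [← Finset.image_id (s := Hᶜ.image (row G H))]
      exact Finset.image_congr fun X hX => hg2 X hX
  have hRcard : ((Finset.univ.image (row G H)).card : ℝ) ≤ R.card + r := by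
    have h1 : R.card = (Hᶜ.image (row G H)).card := by
      rw [← hRimg, Finset.card_image_of_injOn hRinj]
    have h2 : Finset.univ.image (row G H) = Hᶜ.image (row G H) ∪ H.image (row G H) := by
      rw [← Finset.image_union]; congr 1; ext; simp [em']
    have h3 := Finset.card_union_le (Hᶜ.image (row G H)) (H.image (row G H))
    have h4 : (H.image (row G H)).card ≤ r := hH ▸ Finset.card_image_le
    rw [← h2, ← h1] at h3
    exact_mod_cast h3.trans (by omega)
  obtain ⟨R', hR', homR, hcard⟩ := hG.hom R
  have hB : ballCard r (s-1) < R'.card := by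
    have h1 : (R.card : ℝ) ≤ (R'.card:ℝ) ^ 2 := by exact_mod_cast hcard
    have h2 := ballCard_pos r (s-1)
    have h3 : (0:ℝ) ≤ r := Nat.cast_nonneg _
    by_contra hcon
    push Not at hcon
    have : (R'.card:ℝ) ^ 2 ≤ ballCard r (s-1) ^ 2 := by gcongr
    linarith
  have hinj' : Set.InjOn (row G H) ↑R' := hRinj.mono (by exact_mod_cast hR')
  set 𝒜 := R'.image (row G H) with h𝒜
  have hA : 𝒜.card = R'.card := Finset.card_image_of_injOn hinj'
  obtain ⟨X, hX, hXs⟩ : ∃ X ∈ 𝒜.shatterer, s ≤ X.card := by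
    by_contra hcon
    push Not at hcon
    have h1 : (𝒜.shatterer.card : ℝ) ≤ ballCard r (s-1) := by
      have h2 := cnt_card_le (V := {u // u ∈ H}) (s-1)
      rw [Fintype.card_coe, hH] at h2
      rw [← h2]
      have h3 : (𝒜.shatterer.card : ℝ) = cnt (fun X => X ∈ 𝒜.shatterer) := by
        rw [cnt_eq_card_filter, Finset.filter_univ_mem]
      rw [h3]
      have hsub : ∀ X ∈ 𝒜.shatterer, X ⊆ H := by
        intro X hX
        obtain ⟨u, hu, h⟩ := (Finset.mem_shatterer.1 hX).exists_superset
        obtain ⟨v, _, rfl⟩ := Finset.mem_image.1 hu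
        exact h.trans (row_subset _ _ _)
      refine cnt_inj (fun T => T.subtype (· ∈ H)) ?_ ?_
      · intro T hT
        rw [Finset.card_subtype]
        have := hcon T hT
        exact (Finset.card_filter_le _ _).trans (by omega)
      · rintro T T' h1 h2 h
        ext u
        by_cases hu : u ∈ H
        · have : (⟨u, hu⟩ : {u // u ∈ H}) ∈ T.subtype (· ∈ H) ↔
              (⟨u, hu⟩ : {u // u ∈ H}) ∈ T'.subtype (· ∈ H) := by
            have h' : T.subtype (· ∈ H) = T'.subtype (· ∈ H) := h
            rw [h']
          simpa using this
        · exact ⟨fun h => absurd (hsub _ h1 h) hu, fun h => absurd (hsub _ h2 h) hu⟩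
    have h2 : (𝒜.card : ℝ) ≤ 𝒜.shatterer.card := by exact_mod_cast Finset.card_le_card_shatterer 𝒜
    rw [hA] at h2
    linarith
  obtain ⟨S₁, hS₁X, hS₁⟩ := Finset.exists_subset_card_eq hXs
  have hsh : 𝒜.Shatters S₁ := (Finset.mem_shatterer.1 hX).mono_right hS₁X
  have hS₁H : S₁ ⊆ H := by
    obtain ⟨u, hu, h⟩ := hsh.exists_superset
    obtain ⟨v, _, rfl⟩ := Finset.mem_image.1 hu
    exact h.trans (row_subset _ _ _)
  have hy : ∀ t : Finset V, ∃ y, t ⊆ S₁ → y ∈ R' ∧ row G S₁ y = t := by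
    intro t
    by_cases ht : t ⊆ S₁
    · obtain ⟨u, hu, h⟩ := hsh ht
      obtain ⟨y, hy, rfl⟩ := Finset.mem_image.1 hu
      refine ⟨y, fun _ => ⟨hy, ?_⟩⟩
      rw [← h]
      ext z
      simp only [mem_row, Finset.mem_inter]
      exact ⟨fun h => ⟨h.1, hS₁H h.1, h.2⟩, fun h => ⟨h.1, h.2.2⟩⟩
    · obtain ⟨y, -⟩ : R'.Nonempty := by
        rw [← Finset.card_pos]
        have := ballCard_pos r (s-1)
        have : (0:ℝ) < R'.card := by linarith
        exact_mod_cast this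
      exact ⟨y, fun h => absurd h ht⟩
  choose y hy using hy
  refine ⟨S₁, S₁.powerset.image y, hS₁, ?_, hom.mono hS₁H, homR.mono ?_, ?_, ?_⟩
  · rw [Finset.card_image_of_injOn, Finset.card_powerset, hS₁]
    intro t ht t' ht' h
    simp only [Finset.coe_powerset, Set.mem_preimage, Set.mem_powerset_iff, Finset.coe_subset] at ht ht'
    rw [← (hy t ht).2, ← (hy t' ht').2, h]
  · intro z hz
    obtain ⟨t, ht, rfl⟩ := Finset.mem_image.1 hz
    exact (hy t (Finset.mem_powerset.1 ht)).1
  · rw [Finset.disjoint_right]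
    intro z hz hz'
    obtain ⟨t, ht, rfl⟩ := Finset.mem_image.1 hz
    exact Finset.mem_compl.1 (hRH (hR' (hy t (Finset.mem_powerset.1 ht)).1)) (hS₁H hz')
  · intro a ha b hb h
    obtain ⟨t, ht, rfl⟩ := Finset.mem_image.1 (Finset.mem_coe.1 ha)
    obtain ⟨t', ht', rfl⟩ := Finset.mem_image.1 (Finset.mem_coe.1 hb)
    rw [(hy t (Finset.mem_powerset.1 ht)).2, (hy t' (Finset.mem_powerset.1 ht')).2] at h
    rw [h]

/-- Elements with different traces that avoid a fixed pattern on disjoint pairs are few. -/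
theorem card_avoid_le [Fintype V] {ι : Type} [Fintype ι] {G : SimpleGraph V} {S Q : Finset V}
    (hinj : Set.InjOn (row G S) ↑Q) (c : ι → Fin 2 → V)
    (hc : Function.Injective fun x : ι × Fin 2 => c x.1 x.2) (hcS : ∀ i j, c i j ∈ S)
    (pat : Fin 2 → Bool) (h : ∀ i, ∀ y ∈ Q, (fun j => decide (G.Adj y (c i j))) ≠ pat) :
    (Q.card : ℝ) ≤ (3/4) ^ Fintype.card ι * 2 ^ S.card := by
  have h1 := cnt_matching c hc (fun v (b : Bool) => v ∉ S → b = false) (fun _ x => x ≠ pat)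
    (fun v => if v ∈ S then 2 else 1) (3/4) (by
      intro v
      split_ifs with hv
      · refine (cnt_le_card _).trans (by simp)
      · simp only [hv, not_false_eq_true, forall_true_left]
        rw [cnt_eq_card_filter, Finset.filter_eq']; simp) (by
      intro i
      simp only [hcS, if_true, not_true_eq_false, false_imp_iff, implies_true, true_and]
      rw [cnt_eq_card_filter, Finset.filter_ne' Finset.univ pat,
        Finset.card_erase_of_mem (Finset.mem_univ _), Finset.card_univ]
      simp; norm_num)
  have h2 : ∏ v : V, (if v ∈ S then (2:ℝ) else 1) = 2 ^ S.card := by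
    rw [Finset.prod_ite_mem]; simp
  rw [h2] at h1
  refine le_trans ?_ h1
  have h3 : (Q.card : ℝ) = cnt (fun y => y ∈ Q) := by
    rw [cnt_eq_card_filter, Finset.filter_univ_mem]
  rw [h3]
  refine cnt_inj (fun y v => decide (v ∈ row G S y)) ?_ ?_
  · intro y hy
    refine ⟨fun v hv => by simp [mem_row, hv], fun i => ?_⟩
    simpa [mem_row, hcS] using h i y hy
  · intro y y' hy hy' h
    apply hinj hy hy'
    ext v
    have := congrFun h v
    simpa using this

theorem card_avoid_half [Fintype V] {G : SimpleGraph V} {S Q Q' : Finset V} {j : ℕ}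
    (hinj : Set.InjOn (row G S) ↑Q) (hinj' : Set.InjOn (row G S) ↑Q') (c : Fin (4*j) → Fin 2 → V)
    (hc : Function.Injective fun x : Fin (4*j) × Fin 2 => c x.1 x.2) (hcS : ∀ i k, c i k ∈ S)
    (pat pat' : Fin 2 → Bool)
    (h : ∀ i, (∀ y ∈ Q, (fun k => decide (G.Adj y (c i k))) ≠ pat) ∨
      (∀ y ∈ Q', (fun k => decide (G.Adj y (c i k))) ≠ pat')) :
    (Q.card : ℝ) ≤ (3/4) ^ (2*j) * 2 ^ S.card ∨ (Q'.card : ℝ) ≤ (3/4) ^ (2*j) * 2 ^ S.card := by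
  set I := Finset.univ.filter fun i => ∀ y ∈ Q, (fun k => decide (G.Adj y (c i k))) ≠ pat with hI
  have key : ∀ J : Finset (Fin (4*j)), 2*j ≤ J.card → ∀ (P : Finset V) (p : Fin 2 → Bool),
      Set.InjOn (row G S) ↑P → (∀ i ∈ J, ∀ y ∈ P, (fun k => decide (G.Adj y (c i k))) ≠ p) →
      (P.card : ℝ) ≤ (3/4) ^ (2*j) * 2 ^ S.card := by
    intro J hJ P p hP h
    have := card_avoid_le hP (fun i : {i // i ∈ J} => c i.1) (by
      rintro ⟨⟨i, hi⟩, k⟩ ⟨⟨i', hi'⟩, k'⟩ h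
      have := @hc (i, k) (i', k') h
      simp only [Prod.mk.injEq] at this
      obtain ⟨rfl, rfl⟩ := this
      rfl) (fun i => hcS i.1) p (fun i => h i.1 i.2)
    rw [Fintype.card_coe] at this
    refine this.trans ?_
    gcongr ?_ * _
    exact pow_le_pow_of_le_one (by norm_num) (by norm_num) hJ
  by_cases hIc : 2*j ≤ I.card
  · left
    exact key I hIc Q pat hinj (fun i hi => (Finset.mem_filter.1 hi).2)
  · right
    refine key Iᶜ ?_ Q' pat' hinj' (fun i hi => ?_)
    · rw [Finset.card_compl, Fintype.card_fin]; omega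
    · rcases h i with h | h
      · exact absurd (Finset.mem_filter.2 ⟨Finset.mem_univ _, h⟩) (Finset.mem_compl.1 hi)
      · exact h

theorem not_generic_both_of_clique [Fintype V] {G : SimpleGraph V} (hG : NoC5 G) {S₁ S₂ : Finset V}
    {j θ : ℕ} (hcl : G.IsClique ↑S₁) (hom : Hom G S₂) (hinj : Set.InjOn (row G S₁) ↑S₂)
    (hθ : (3/4 : ℝ) ^ (2*j) * 2 ^ S₁.card < θ) {v : V} (h₁ : v ∈ genericSet G S₁ (8*j))
    (h₂ : v ∈ genericSet G S₂ θ) : False := by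
  rw [mem_genericSet] at h₁ h₂
  obtain ⟨hv1, hx, hz⟩ := h₁
  obtain ⟨hv2, hy, hw⟩ := h₂
  have hθ1 : (3/4 : ℝ) ^ (2*j) * 2 ^ S₁.card < (row G S₂ v).card :=
    hθ.trans_le (by exact_mod_cast hy)
  have hθ2 : (3/4 : ℝ) ^ (2*j) * 2 ^ S₁.card < (S₂ \ row G S₂ v).card :=
    hθ.trans_le (by exact_mod_cast hw)
  have i1 : Set.InjOn (row G S₁) ↑(row G S₂ v) := hinj.mono (by exact_mod_cast row_subset _ _ _)
  have i2 : Set.InjOn (row G S₁) ↑(S₂ \ row G S₂ v) := hinj.mono (by exact_mod_cast Finset.sdiff_subset)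
  have memz : ∀ z, z ∈ S₁ \ row G S₁ v → z ∈ S₁ ∧ ¬ G.Adj v z := by
    intro z hz
    simp only [Finset.mem_sdiff, mem_row, not_and] at hz
    exact ⟨hz.1, hz.2 hz.1⟩
  rcases hom with hom | hom
  · obtain ⟨f⟩ : Nonempty (Fin (4*j) ↪ {u // u ∈ row G S₁ v}) :=
      Function.Embedding.nonempty_of_card_le (by rw [Fintype.card_fin, Fintype.card_coe]; omega)
    obtain ⟨g⟩ : Nonempty (Fin (4*j) ↪ {u // u ∈ S₁ \ row G S₁ v}) :=
      Function.Embedding.nonempty_of_card_le (by rw [Fintype.card_fin, Fintype.card_coe]; omega)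
    have hf : ∀ i, (f i).1 ∈ S₁ ∧ G.Adj v (f i).1 := fun i => mem_row.1 (f i).2
    have hg := fun i => memz _ (g i).2
    rcases card_avoid_half i1 i2 (fun i => ![(f i).1, (g i).1]) (by
        rintro ⟨i, k⟩ ⟨i', k'⟩ h
        have hne : ∀ a b, (f a).1 ≠ (g b).1 := fun a b h => (hg b).2 (h ▸ (hf a).2)
        fin_cases k <;> fin_cases k' <;> simp at h ⊢
        · exact h
        · exact hne _ _ h
        · exact hne _ _ h.symm
        · exact h)
        (by intro i k; fin_cases k
            · exact (hf i).1
            · exact (hg i).1) ![false, false] ![false, true] (by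
        intro i
        by_contra hcon
        push Not at hcon
        obtain ⟨⟨y, hy, hyp⟩, ⟨w, hw, hwp⟩⟩ := hcon
        have a0 : ¬ G.Adj y (f i) := of_decide_eq_false (congrFun hyp 0)
        have a1 : ¬ G.Adj y (g i) := of_decide_eq_false (congrFun hyp 1)
        have b0 : ¬ G.Adj w (f i) := of_decide_eq_false (congrFun hwp 0)
        have b1 : G.Adj w (g i) := of_decide_eq_true (congrFun hwp 1)
        obtain ⟨hyS, hvy⟩ := mem_row.1 hy
        obtain ⟨hwS, hvw⟩ : w ∈ S₂ ∧ ¬ G.Adj v w := by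
          simp only [Finset.mem_sdiff, mem_row, not_and] at hw
          exact ⟨hw.1, hw.2 hw.1⟩
        refine hG v (f i) (g i) w y (hf i).2 (hcl (hf i).1 (hg i).1 ?_) b1.symm (hom hwS hyS ?_) hvy.symm
          (hg i).2 hvw (fun h => b0 h.symm) (fun h => a0 h.symm) (fun h => a1 h.symm)
        · intro h; exact (hg i).2 (h ▸ (hf i).2)
        · rintro rfl; exact hvw hvy) with h | h
    · linarith
    · linarith
  · obtain ⟨g⟩ : Nonempty (Fin (4*j) × Fin 2 ↪ {u // u ∈ S₁ \ row G S₁ v}) :=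
      Function.Embedding.nonempty_of_card_le (by
        rw [Fintype.card_prod, Fintype.card_fin, Fintype.card_fin, Fintype.card_coe]; omega)
    have hg := fun i => memz _ (g i).2
    rcases card_avoid_half i1 i1 (fun i k => (g (i, k)).1) (by
        rintro ⟨i, k⟩ ⟨i', k'⟩ h
        exact g.injective (Subtype.ext h))
        (fun i k => (hg _).1) ![true, false] ![false, true] (by
        intro i
        by_contra hcon
        push Not at hcon
        obtain ⟨⟨y, hy, hyp⟩, ⟨w, hw, hwp⟩⟩ := hcon
        have a0 := congrFun hyp 0
        have a1 := congrFun hyp 1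
        have b0 := congrFun hwp 0
        have b1 := congrFun hwp 1
        simp only [Matrix.cons_val_zero, Matrix.cons_val_one, decide_eq_false_iff_not,
          decide_eq_true_eq] at a0 a1 b0 b1
        obtain ⟨hyS, hvy⟩ := mem_row.1 hy
        obtain ⟨hwS, hvw⟩ := mem_row.1 hw
        refine hG v y (g (i,0)) (g (i,1)) w hvy a0 (hcl (hg _).1 (hg _).1 ?_) b1.symm hvw.symm
          (hg _).2 (hg _).2 a1 ?_ (fun h => b0 h.symm)
        · intro h
          have := g.injective (Subtype.ext h)
          simp at this
        · intro h
          have h2 := hom hyS hwS h.ne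
          exact h2.2 h) with h | h
    · linarith
    · linarith

theorem not_generic_both [Fintype V] {G : SimpleGraph V} (hG : NoC5 G) {S₁ S₂ : Finset V}
    {j θ : ℕ} (hp : TracePair G S₁ S₂)
    (hθ : (3/4 : ℝ) ^ (2*j) * 2 ^ S₁.card < θ) {v : V} (h₁ : v ∈ genericSet G S₁ (8*j))
    (h₂ : v ∈ genericSet G S₂ θ) : False := by
  rcases hp.hom₁ with h | h
  · exact not_generic_both_of_clique hG h hp.hom₂ hp.inj hθ h₁ h₂
  · refine not_generic_both_of_clique hG.compl h hp.hom₂.compl ?_ hθ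
      (by rwa [genericSet_compl]) (by rwa [genericSet_compl])
    intro a ha b hb hab
    have ha' : a ∉ S₁ := Finset.disjoint_right.1 hp.disj ha
    have hb' : b ∉ S₁ := Finset.disjoint_right.1 hp.disj hb
    rw [row_compl ha', row_compl hb'] at hab
    apply hp.inj ha hb
    rw [← Finset.sdiff_sdiff_eq_self (row_subset G S₁ a), hab,
      Finset.sdiff_sdiff_eq_self (row_subset G S₁ b)]
end rich

theorem exists_generic_params {ε ζ : ℝ} (hε : 0 < ε) (hζ : 0 < ζ) : ∃ j θ : ℕ,
    128 ≤ (j^2 : ℕ) * ζ ∧ 16 ≤ j^2 ∧ 4 ≤ (j^2 : ℕ) * ε ∧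
    2 * ballCard (j^2) (8*j) ≤ (2:ℝ) ^ (ε / 4 * (j^2 : ℕ)) ∧
    2 * ballCard (2^(j^2)) θ ≤ (2:ℝ) ^ (ε / 4 * (2^(j^2) : ℕ)) ∧
    (3/4 : ℝ) ^ (2*j) * 2 ^ (j^2) < θ := by
  obtain ⟨lam, hl0, hl1, hlam⟩ := ballCard_small (κ := ε/8) (by positivity)
  have key : ∀ n d : ℕ, (d:ℝ) ≤ lam * n → 8 ≤ n * ε →
      2 * ballCard n d ≤ (2:ℝ) ^ (ε / 4 * n) := by
    intro n d h1 h2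
    calc 2 * ballCard n d ≤ 2 ^ (1:ℝ) * 2 ^ (ε/8*n) := by
          rw [Real.rpow_one]; gcongr; exact hlam n d h1
      _ ≤ _ := by
        rw [← Real.rpow_add (by norm_num)]
        apply Real.rpow_le_rpow_of_exponent_le (by norm_num)
        linarith
  have e1 := eventually_ge_real (128/ζ + 8/ε + 8/lam + 16 + 2/lam)
  have e2 : ∀ᶠ j : ℕ in atTop, (3/4:ℝ) ^ j < lam/2 :=
    (tendsto_pow_atTop_nhds_zero_of_lt_one (by norm_num) (by norm_num)).eventually_lt_const (by positivity)
  obtain ⟨j, h1, h2⟩ := (e1.and e2).exists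
  have p1 : 0 < 128/ζ := by positivity
  have p2 : 0 < 8/ε := by positivity
  have p3 : 0 < 8/lam := by positivity
  have p4 : 0 < 2/lam := by positivity
  have hj16 : (16:ℝ) ≤ j := by linarith
  have hjsq : (j:ℝ) ≤ (j^2 : ℕ) := by push_cast; nlinarith
  have hq : ((j^2 : ℕ):ℝ) ≤ (2^(j^2) : ℕ) := by exact_mod_cast Nat.lt_two_pow_self.le
  have b1 : 128 ≤ (j^2 : ℕ) * ζ := by
    rw [← div_le_iff₀ hζ]; linarith
  have b2 : 8 ≤ (j^2 : ℕ) * ε := by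
    rw [← div_le_iff₀ hε]; linarith
  refine ⟨j, ⌊(3/4 : ℝ) ^ (2*j) * 2 ^ (j^2)⌋₊ + 1, b1, ?_, by linarith, ?_, ?_, ?_⟩
  · have : (16:ℝ) ≤ (j^2 : ℕ) := by linarith
    exact_mod_cast this
  · apply key _ _ _ b2
    have : 8/lam ≤ j := by linarith
    rw [div_le_iff₀ hl0] at this
    push_cast
    nlinarith
  · apply key _ _ _ (b2.trans (by gcongr))
    push_cast
    have f1 := Nat.floor_le (a := (3/4 : ℝ) ^ (2*j) * 2 ^ (j^2)) (by positivity)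
    have f2 : (3/4:ℝ) ^ (2*j) ≤ lam/2 :=
      (pow_le_pow_of_le_one (by norm_num) (by norm_num) (by omega)).trans h2.le
    have f3 : 2/lam ≤ (2:ℝ)^(j^2) := by push_cast at hq hjsq; linarith
    rw [div_le_iff₀ hl0] at f3
    have f4 : (3/4 : ℝ) ^ (2*j) * 2 ^ (j^2) ≤ lam/2 * 2^(j^2) := by gcongr
    linarith
  · push_cast
    exact Nat.lt_floor_add_one _

theorem exists_ramsey_param (s : ℕ) : ∃ r : ℕ, 0 < r ∧
    ballCard r (s-1) ^ 2 + r < (2:ℝ) ^ ((r:ℝ)/2 - 2) := by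
  obtain ⟨lam, hl0, hl1, hlam⟩ := ballCard_small (κ := 1/16) (by positivity)
  obtain ⟨r, h1, h2⟩ := ((eventually_ge_real (s/lam + 48)).and
    (poly_le_exp 1 0 (show (0:ℝ) < 1/8 by norm_num))).exists
  have p : (0:ℝ) ≤ s/lam := by positivity
  have hr0 : 0 < r := by
    have : (0:ℝ) < r := by linarith
    exact_mod_cast this
  refine ⟨r, hr0, ?_⟩
  have h3 : s ≤ lam * r := by
    have : s/lam ≤ r := by linarith
    rw [div_le_iff₀ hl0] at this; linarith
  have h4 : ballCard r (s-1) ≤ 2 ^ (1/16*(r:ℝ)) := by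
    apply hlam
    refine le_trans ?_ h3
    exact_mod_cast Nat.sub_le _ _
  have h5 : (r:ℝ) ≤ 2 ^ (1/8*(r:ℝ)) := by
    conv_lhs => rw [← rpow_lg (n := r) hr0]
    apply Real.rpow_le_rpow_of_exponent_le (by norm_num)
    linarith
  have h6 : ballCard r (s-1) ^ 2 ≤ 2 ^ (1/8*(r:ℝ)) := by
    have := ballCard_pos r (s-1)
    calc _ ≤ ((2:ℝ) ^ (1/16*(r:ℝ)))^2 := by gcongr
      _ = _ := by
        rw [← Real.rpow_natCast, ← Real.rpow_mul (by norm_num)]; congr 1; push_cast; ring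
  calc _ ≤ (2:ℝ) ^ (1:ℝ) * 2 ^ (1/8*(r:ℝ)) := by rw [Real.rpow_one]; linarith
    _ < _ := by
      rw [← Real.rpow_add (by norm_num)]
      apply Real.rpow_lt_rpow_of_exponent_lt (by norm_num)
      linarith

/-- Two large disjoint sets cover nearly everything, and both are clean. -/
structure TwoClean {V : Type} [Fintype V] (G : SimpleGraph V) (ζ : ℝ) (A B : Finset V) : Prop where
  disj : Disjoint A B
  rest : ((A ∪ B)ᶜ.card : ℝ) ≤ ζ * Fintype.card V
  cleanA : Clean G ↑A
  cleanB : Clean G ↑B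
  cardA : (A.card : ℝ) ≤ (1/2 + ζ) * Fintype.card V
  cardB : (B.card : ℝ) ≤ (1/2 + ζ) * Fintype.card V

theorem aa_twoClean {ζ : ℝ} (hζ : 0 < ζ) :
    AA (fun _ _ G => ∃ A B, TwoClean G ζ A B) := by
  obtain ⟨j, θ, h1, h2, h3, h4, h5, h6⟩ := exists_generic_params (ε := ζ/400) (ζ := ζ/20)
    (by positivity) (by positivity)
  obtain ⟨r, hr0, hr⟩ := exists_ramsey_param (j^2)
  have hqs : j^2 ≤ 2^(j^2) := Nat.lt_two_pow_self.le
  have hqs' : ((j^2 : ℕ):ℝ) ≤ (2^(j^2) : ℕ) := by exact_mod_cast hqs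
  have a1 := aa_genericSet_large (ε := ζ/400) (by positivity) h3 h4
  have a2 := aa_genericSet_large (ε := ζ/400) (by positivity) (h3.trans (by gcongr)) h5
  have a3 := aa_clean_of_hom (ε := ζ/400) (ζ := ζ/20) (by positivity) (by positivity) (by linarith)
    h1 h2 h4
  have a4 := aa_clean_of_hom (ε := ζ/400) (ζ := ζ/20) (by positivity) (by positivity) (by linarith)
    (h1.trans (by gcongr)) (h2.trans hqs) h5
  refine (((a1.and a2).and (a3.and a4)).and (aa_many_rows r hr0)).mono (r^2) ?_
  rintro V _ hn G hG ⟨⟨⟨c1, c2⟩, ⟨c3, c4⟩⟩, c5⟩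
  set n := Fintype.card V with hndef
  obtain ⟨H, hH, hom⟩ : ∃ H : Finset V, H.card = r ∧ Hom G H := by
    obtain ⟨Q, -, hQ, hc⟩ := hG.hom Finset.univ
    rw [Finset.card_univ] at hc
    obtain ⟨H, hHQ, hH⟩ := Finset.exists_subset_card_eq (n := r) (s := Q)
      ((Nat.pow_le_pow_iff_left (by norm_num)).1 (hn.trans hc))
    exact ⟨H, hH, hQ.mono hHQ⟩
  obtain ⟨S₁, S₂, hS₁, hS₂, hp⟩ := exists_tracePair hG (s := j^2) hH hom (by omega)
    (hr.trans_le (by have := c5 H hH; push Not at this; exact this))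
  have d := c1 S₁ hS₁
  have d' := c2 S₂ hS₂
  push Not at d d'
  have hdisj : Disjoint (genericSet G S₁ (8*j)) (genericSet G S₂ θ) := by
    rw [Finset.disjoint_left]
    intro v hv hv'
    exact not_generic_both hG.noC5 hp (by rw [hS₁]; exact h6) hv hv'
  set P := genericSet G S₁ (8*j)
  set Q := genericSet G S₂ θ
  have hsum : (P.card : ℝ) + Q.card ≤ n := by
    have := Finset.card_le_univ (P ∪ Q)
    rw [Finset.card_union_of_disjoint hdisj] at this
    exact_mod_cast this
  have hP : (P.card : ℝ) ≤ (1/2 + ζ/400) * n := by linarith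
  have hQ : (Q.card : ℝ) ≤ (1/2 + ζ/400) * n := by linarith
  obtain ⟨R, hR, hRc⟩ := c3 S₁ hS₁ hp.hom₁ hP
  obtain ⟨R', hR', hRc'⟩ := c4 S₂ hS₂ hp.hom₂ hQ
  have hn0 : (0:ℝ) ≤ ζ * n := by positivity
  refine ⟨P \ R, Q \ R', ?_, ?_, hRc, hRc', ?_, ?_⟩
  · exact hdisj.mono Finset.sdiff_subset Finset.sdiff_subset
  · have e1 : (P \ R ∪ Q \ R')ᶜ ⊆ (P ∪ Q)ᶜ ∪ (R ∪ R') := by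
      intro v hv
      simp only [Finset.mem_compl, Finset.mem_union, Finset.mem_sdiff] at hv ⊢
      tauto
    have e2 := (Finset.card_le_card e1).trans ((Finset.card_union_le _ _).trans
      (Nat.add_le_add_left (Finset.card_union_le _ _) _))
    have e3 : ((P ∪ Q)ᶜ.card : ℝ) = n - (P.card + Q.card) := by
      rw [Finset.card_compl, Nat.cast_sub (Finset.card_le_univ _), Finset.card_union_of_disjoint hdisj]
      push_cast; rfl
    have e4 : ((P \ R ∪ Q \ R')ᶜ.card : ℝ) ≤ (P ∪ Q)ᶜ.card + (R.card + R'.card) := by exact_mod_cast e2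
    rw [e3] at e4
    linarith
  · have : ((P \ R).card : ℝ) ≤ P.card := by exact_mod_cast Finset.card_le_card Finset.sdiff_subset
    linarith
  · have : ((Q \ R').card : ℝ) ≤ Q.card := by exact_mod_cast Finset.card_le_card Finset.sdiff_subset
    linarith

section str
variable {V : Type}

/-- `c` lists pairwise disjoint pairs of elements of `S`. -/
def Pairs {ι : Type} (c : ι → Fin 2 → V) (S : Finset V) : Prop :=
  (Function.Injective fun x : ι × Fin 2 => c x.1 x.2) ∧ ∀ i k, c i k ∈ S

theorem exists_pairs {S : Finset V} {l : ℕ} (h : 2 * l ≤ S.card) : ∃ c : Fin l → Fin 2 → V, Pairs c S := by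
  obtain ⟨g⟩ : Nonempty (Fin l × Fin 2 ↪ {u // u ∈ S}) :=
    Function.Embedding.nonempty_of_card_le (by
      rw [Fintype.card_prod, Fintype.card_fin, Fintype.card_fin, Fintype.card_coe]; omega)
  exact ⟨fun i k => (g (i, k)).1, fun x y h => g.injective (Subtype.ext h), fun i k => (g (i, k)).2⟩

/-- Among any `l` disjoint pairs in `A` and any `l` disjoint pairs in `B`, all bipartite
patterns occur. -/
def Rich (G : SimpleGraph V) (l : ℕ) (A B : Finset V) : Prop :=
  ∀ c d : Fin l → Fin 2 → V, Pairs c A → Pairs d B → ∀ p : Fin 2 → Fin 2 → Bool,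
    ∃ i j, ∀ x y, G.Adj (c i x) (d j y) ↔ p x y = true

theorem Rich.symm {G : SimpleGraph V} {l : ℕ} {A B : Finset V} (h : Rich G l A B) :
    Rich G l B A := by
  intro c d hc hd p
  obtain ⟨i, j, hij⟩ := h d c hd hc (fun x y => p y x)
  exact ⟨j, i, fun x y => by rw [G.adj_comm]; exact hij y x⟩

theorem Rich.compl {G : SimpleGraph V} {l : ℕ} {A B : Finset V} (h : Rich G l A B)
    (hd : Disjoint A B) : Rich Gᶜ l A B := by
  intro c d hc hd' p
  obtain ⟨i, j, hij⟩ := h c d hc hd' (fun x y => !p x y)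
  refine ⟨i, j, fun x y => ?_⟩
  have hne : c i x ≠ d j y := fun h => Finset.disjoint_left.1 hd (hc.2 i x) (h ▸ hd'.2 j y)
  rw [SimpleGraph.compl_adj, hij]
  simp [hne]

theorem Rich.mono {G : SimpleGraph V} {l : ℕ} {A B A' B' : Finset V} (h : Rich G l A B)
    (hA : A' ⊆ A) (hB : B' ⊆ B) : Rich G l A' B' :=
  fun c d hc hd => h c d ⟨hc.1, fun i k => hA (hc.2 i k)⟩ ⟨hd.1, fun i k => hB (hd.2 i k)⟩

theorem Rich.not_pFree {G : SimpleGraph V} {l : ℕ} {A B Q : Finset V} (h : Rich G l A B)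
    (hAB : Disjoint A B) (hQ : PFree G ↑Q) : (Q ∩ A).card < 2 * l ∨ (Q ∩ B).card < 2 * l := by
  by_contra hcon
  push Not at hcon
  obtain ⟨c, hc⟩ := exists_pairs hcon.1
  obtain ⟨d, hd⟩ := exists_pairs hcon.2
  obtain ⟨i, j, hij⟩ := h c d ⟨hc.1, fun i k => Finset.mem_of_mem_inter_right (hc.2 i k)⟩
    ⟨hd.1, fun i k => Finset.mem_of_mem_inter_right (hd.2 i k)⟩ ![![true, true], ![true, false]]
  have h00 : G.Adj (c i 0) (d j 0) := (hij 0 0).2 rfl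
  have h01 : G.Adj (c i 0) (d j 1) := (hij 0 1).2 rfl
  have h10 : G.Adj (c i 1) (d j 0) := (hij 1 0).2 rfl
  have h11 : ¬ G.Adj (c i 1) (d j 1) := fun h => by simpa using (hij 1 1).1 h
  have mc : ∀ k, c i k ∈ (Q : Set V) := fun k => Finset.mem_of_mem_inter_left (hc.2 i k)
  have md : ∀ k, d j k ∈ (Q : Set V) := fun k => Finset.mem_of_mem_inter_left (hd.2 j k)
  have hne : c i 0 ≠ c i 1 := fun h => by simpa using @hc.1 (i, 0) (i, 1) h
  have e1 := hQ (mc 0) (md 0) (mc 1) h00 h10.symm hne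
  have hne2 : c i 1 ≠ d j 1 := fun h => Finset.disjoint_left.1 hAB
    (Finset.mem_of_mem_inter_right (hc.2 i 1)) (h ▸ Finset.mem_of_mem_inter_right (hd.2 j 1))
  exact h11 (hQ (mc 1) (mc 0) (md 1) e1.symm h01 hne2)

theorem Rich.not_clean {G : SimpleGraph V} {l : ℕ} {A B Q : Finset V} (h : Rich G l A B)
    (hAB : Disjoint A B) (hQ : Clean G ↑Q) : (Q ∩ A).card < 2 * l ∨ (Q ∩ B).card < 2 * l := by
  rcases hQ with hQ | hQ
  · exact h.not_pFree hAB hQ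
  · exact (h.compl hAB).not_pFree hAB hQ

variable [Fintype V]

theorem TwoClean.symm {G : SimpleGraph V} {ζ : ℝ} {A B : Finset V} (h : TwoClean G ζ A B) :
    TwoClean G ζ B A :=
  ⟨h.disj.symm, by rw [Finset.union_comm]; exact h.rest, h.cleanB, h.cleanA, h.cardB, h.cardA⟩

theorem TwoClean.compl {G : SimpleGraph V} {ζ : ℝ} {A B : Finset V} (h : TwoClean G ζ A B) :
    TwoClean Gᶜ ζ A B :=
  ⟨h.disj, h.rest, h.cleanA.compl, h.cleanB.compl, h.cardA, h.cardB⟩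

structure Str (G : SimpleGraph V) (ζ : ℝ) (l : ℕ) (A B : Finset V) : Prop
    extends TwoClean G ζ A B where
  rich : Rich G l A B

theorem Str.symm {G : SimpleGraph V} {ζ : ℝ} {l : ℕ} {A B : Finset V} (h : Str G ζ l A B) :
    Str G ζ l B A := ⟨h.toTwoClean.symm, h.rich.symm⟩

theorem Str.compl {G : SimpleGraph V} {ζ : ℝ} {l : ℕ} {A B : Finset V} (h : Str G ζ l A B) :
    Str Gᶜ ζ l A B := ⟨h.toTwoClean.compl, h.rich.compl h.disj⟩

theorem TwoClean.le_cardA {G : SimpleGraph V} {ζ : ℝ} {A B : Finset V} (h : TwoClean G ζ A B) :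
    (1/2 - 2 * ζ) * Fintype.card V ≤ A.card := by
  have h1 := h.rest
  have h2 := h.cardB
  rw [Finset.card_compl, Nat.cast_sub (Finset.card_le_univ _),
    Finset.card_union_of_disjoint h.disj] at h1
  push_cast at h1
  linarith

/-- Deleting a small set from both parts, and changing the graph on the deleted set. -/
theorem Str.sdiff {G G₀ : SimpleGraph V} {ζ : ℝ} {l : ℕ} {A B U : Finset V} (h : Str G ζ l A B)
    (hU : (U.card : ℝ) ≤ ζ * Fintype.card V)
    (hG : ∀ x, x ∉ U → ∀ y, y ∉ U → (G.Adj x y ↔ G₀.Adj x y)) :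
    Str G₀ (2 * ζ) l (A \ U) (B \ U) := by
  have hζ : 0 ≤ ζ * Fintype.card V := le_trans (Nat.cast_nonneg _) hU
  have clean : ∀ A : Finset V, Clean G ↑A → Clean G₀ ↑(A \ U) := by
    intro A hA
    have hm : ∀ x ∈ ((A \ U : Finset V) : Set V), x ∈ (A : Set V) ∧ x ∉ U := by
      intro x hx
      simpa using hx
    refine hA.imp (fun hA => ?_) (fun hA => ?_)
    · intro u v w hu hv hw h1 h2 h3
      rw [← hG _ (hm _ hu).2 _ (hm _ hw).2]
      rw [← hG _ (hm _ hu).2 _ (hm _ hv).2] at h1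
      rw [← hG _ (hm _ hv).2 _ (hm _ hw).2] at h2
      exact hA (hm _ hu).1 (hm _ hv).1 (hm _ hw).1 h1 h2 h3
    · intro u v w hu hv hw h1 h2 h3
      rw [SimpleGraph.compl_adj, ← hG _ (hm _ hu).2 _ (hm _ hw).2]
      rw [SimpleGraph.compl_adj, ← hG _ (hm _ hu).2 _ (hm _ hv).2] at h1
      rw [SimpleGraph.compl_adj, ← hG _ (hm _ hv).2 _ (hm _ hw).2] at h2
      exact hA (hm _ hu).1 (hm _ hv).1 (hm _ hw).1 h1 h2 h3
  have card : ∀ A : Finset V, (A.card : ℝ) ≤ (1/2 + ζ) * Fintype.card V →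
      ((A \ U).card : ℝ) ≤ (1/2 + 2 * ζ) * Fintype.card V := by
    intro A hA
    have : ((A \ U).card : ℝ) ≤ A.card := by exact_mod_cast Finset.card_le_card Finset.sdiff_subset
    linarith
  refine ⟨⟨h.disj.mono Finset.sdiff_subset Finset.sdiff_subset, ?_, clean A h.cleanA,
    clean B h.cleanB, card A h.cardA, card B h.cardB⟩, ?_⟩
  · have e1 : (A \ U ∪ B \ U)ᶜ ⊆ (A ∪ B)ᶜ ∪ U := by
      intro v hv
      simp only [Finset.mem_compl, Finset.mem_union, Finset.mem_sdiff] at hv ⊢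
      tauto
    have e2 : ((A \ U ∪ B \ U)ᶜ.card : ℝ) ≤ (A ∪ B)ᶜ.card + U.card := by
      exact_mod_cast (Finset.card_le_card e1).trans (Finset.card_union_le _ _)
    have := h.rest
    linarith
  · intro c d hc hd p
    obtain ⟨i, j, hij⟩ := h.rich.mono Finset.sdiff_subset Finset.sdiff_subset c d hc hd p
    refine ⟨i, j, fun x y => ?_⟩
    rw [← hij, hG _ (Finset.mem_sdiff.1 (hc.2 i x)).2 _ (Finset.mem_sdiff.1 (hd.2 j y)).2]

theorem Str.near {G : SimpleGraph V} {ζ : ℝ} {l D : ℕ} {A B A' B' : Finset V} (h : Str G ζ l A B)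
    (h' : Str G ζ l A' B') (hs : 4 * l + 3 * ζ * Fintype.card V ≤ Fintype.card V / 2)
    (hD : 4 * l + 2 * ζ * Fintype.card V ≤ D) (hAB : (A' ∩ B).card < 2 * l) :
    (symmDiff A A').card ≤ D ∧ (symmDiff B B').card ≤ D := by
  have hAB' : ((A' ∩ B).card : ℝ) < 2 * l := by exact_mod_cast hAB
  have hB : B ⊆ (A' ∪ B')ᶜ ∪ (A' ∩ B) ∪ (B' ∩ B) := by
    intro v hv
    simp only [Finset.mem_compl, Finset.mem_union, Finset.mem_inter]
    tauto
  have hB1 : (B.card : ℝ) ≤ (A' ∪ B')ᶜ.card + (A' ∩ B).card + (B' ∩ B).card := by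
    exact_mod_cast (Finset.card_le_card hB).trans ((Finset.card_union_le _ _).trans
      (Nat.add_le_add_right (Finset.card_union_le _ _) _))
  have hB2 := h.toTwoClean.symm.le_cardA
  have r1 := h.rest
  have r2 := h'.rest
  have hBA : (B' ∩ A).card < 2 * l := by
    rcases h.rich.not_clean h.disj h'.cleanB with h | h
    · exact h
    · have : ((B' ∩ B).card : ℝ) < 2 * l := by exact_mod_cast h
      linarith
  have hBA' : ((B' ∩ A).card : ℝ) < 2 * l := by exact_mod_cast hBA
  have e1 : symmDiff A A' ⊆ (A' ∪ B')ᶜ ∪ (A ∪ B)ᶜ ∪ ((B' ∩ A) ∪ (A' ∩ B)) := by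
    intro v hv
    simp only [Finset.mem_symmDiff, Finset.mem_compl, Finset.mem_union, Finset.mem_inter] at hv ⊢
    tauto
  have e2 : symmDiff B B' ⊆ (A' ∪ B')ᶜ ∪ (A ∪ B)ᶜ ∪ ((B' ∩ A) ∪ (A' ∩ B)) := by
    intro v hv
    simp only [Finset.mem_symmDiff, Finset.mem_compl, Finset.mem_union, Finset.mem_inter] at hv ⊢
    tauto
  have e3 : (((A' ∪ B')ᶜ ∪ (A ∪ B)ᶜ ∪ ((B' ∩ A) ∪ (A' ∩ B))).card : ℝ) ≤
      ((A' ∪ B')ᶜ.card + (A ∪ B)ᶜ.card) + ((B' ∩ A).card + (A' ∩ B).card) := by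
    exact_mod_cast (Finset.card_union_le _ _).trans
      (Nat.add_le_add (Finset.card_union_le _ _) (Finset.card_union_le _ _))
  have e4 : ((A' ∪ B')ᶜ ∪ (A ∪ B)ᶜ ∪ ((B' ∩ A) ∪ (A' ∩ B))).card ≤ D := by
    have : (((A' ∪ B')ᶜ ∪ (A ∪ B)ᶜ ∪ ((B' ∩ A) ∪ (A' ∩ B))).card : ℝ) ≤ D := by linarith
    exact_mod_cast this
  exact ⟨(Finset.card_le_card e1).trans e4, (Finset.card_le_card e2).trans e4⟩

theorem cnt_symmDiff_le (A : Finset V) (D : ℕ) :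
    cnt (fun X => (symmDiff A X).card ≤ D) ≤ ballCard (Fintype.card V) D := by
  rw [← cnt_card_le]
  exact cnt_inj (fun X => symmDiff A X) (fun _ h => h)
    (fun x y _ _ h => symmDiff_right_injective A h)

theorem cnt_str_le {G : SimpleGraph V} {ζ : ℝ} {l D : ℕ}
    (hs : 4 * l + 3 * ζ * Fintype.card V ≤ Fintype.card V / 2)
    (hD : 4 * l + 2 * ζ * Fintype.card V ≤ D) :
    cnt (fun p : Finset V × Finset V => Str G ζ l p.1 p.2) ≤ 2 * ballCard (Fintype.card V) D ^ 2 := by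
  set b := ballCard (Fintype.card V) D with hb
  have hb0 : 1 ≤ b := ballCard_pos _ _
  by_cases hex : ∃ A B, Str G ζ l A B
  · obtain ⟨A, B, h⟩ := hex
    have key : ∀ X Y : Finset V, cnt (fun p : Finset V × Finset V =>
        (symmDiff X p.1).card ≤ D ∧ (symmDiff Y p.2).card ≤ D) ≤ b ^ 2 := by
      intro X Y
      have := cnt_prod (fun p : Finset V => (symmDiff X p).card ≤ D) (fun p => (symmDiff Y p).card ≤ D)
      rw [this, sq]
      exact mul_le_mul (cnt_symmDiff_le X D) (cnt_symmDiff_le Y D) (cnt_nonneg _) (by linarith)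
    refine le_trans (cnt_mono ?_) ((cnt_or _ _).trans
      (add_le_add (key A B) (key B A)) |>.trans (by linarith))
    rintro ⟨A', B'⟩ h'
    rcases h.rich.not_clean h.disj h'.cleanA with h1 | h1
    · exact Or.inr (h.symm.near h' hs hD h1)
    · exact Or.inl (h.near h' hs hD h1)
  · have : cnt (fun p : Finset V × Finset V => Str G ζ l p.1 p.2) ≤ cnt (fun _ : Finset V × Finset V => False) :=
      cnt_mono fun p h => hex ⟨_, _, h⟩
    refine this.trans ?_
    have : cnt (fun _ : Finset V × Finset V => False) = 0 := by simp [cnt]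
    rw [this]; positivity
end str

section codes
variable {V : Type}

/-- The graph on `A` is described by the partition into level sets of `q.1`, up to complementation. -/
def Coded (G : SimpleGraph V) (A : Finset V) (q : (V → V) × Bool) : Prop :=
  ∀ u ∈ A, ∀ v ∈ A, u ≠ v → (G.Adj u v ↔ (q.1 u = q.1 v ↔ q.2 = true))

theorem PFree.exists_coded [Fintype V] {G : SimpleGraph V} {A : Finset V} (h : PFree G ↑A) :
    ∃ f, Coded G A (f, true) := by
  set f : V → V := fun v => @Classical.epsilon V ⟨v⟩ (fun x => x ∈ blk G ↑A v) with hf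
  have hmem : ∀ v ∈ A, f v ∈ blk G ↑A v := by
    intro v hv
    exact @Classical.epsilon_spec V (fun x => x ∈ blk G ↑A v) ⟨v, by simp [blk, hv]⟩
  refine ⟨f, fun u hu v hv huv => ?_⟩
  simp only [iff_true]
  constructor
  · intro hadj
    have : blk G (↑A) u = blk G (↑A) v := blk_eq h hu hv hadj
    simp only [hf]
    congr 1
    rw [this]
  · intro heq
    have h1 := hmem u hu
    have h2 := hmem v hv
    rw [← heq] at h2
    simp only [blk, Finset.mem_filter, Finset.mem_univ, true_and] at h1 h2
    rcases h1.2 with h3 | h3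
    · rcases h2.2 with h4 | h4
      · exact absurd (h3.symm.trans h4) huv
      · rw [h3] at h4; exact h4.symm
    · rcases h2.2 with h4 | h4
      · rw [h4] at h3; exact h3
      · exact h hu h1.1 hv h3 h4.symm huv

theorem Clean.exists_coded [Fintype V] {G : SimpleGraph V} {A : Finset V} (h : Clean G ↑A) :
    ∃ q, Coded G A q := by
  rcases h with h | h
  · obtain ⟨f, hf⟩ := h.exists_coded
    exact ⟨_, hf⟩
  · obtain ⟨f, hf⟩ := h.exists_coded
    refine ⟨(f, false), fun u hu v hv huv => ?_⟩
    have := hf u hu v hv huv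
    simp only [SimpleGraph.compl_adj, ne_eq, huv, not_false_eq_true, true_and, iff_true] at this
    simp only [Bool.false_eq_true, iff_false]
    rw [← this, not_not]

/-- The bipartite part of a graph between `A` and `B`. -/
def bip (G : SimpleGraph V) (A B : Finset V) (p : V × V) : Bool :=
  decide (p.1 ∈ A ∧ p.2 ∈ B ∧ G.Adj p.1 p.2)

theorem bip_eq_true {G : SimpleGraph V} {A B : Finset V} {p : V × V} :
    bip G A B p = true ↔ p.1 ∈ A ∧ p.2 ∈ B ∧ G.Adj p.1 p.2 := by simp [bip]

theorem eq_of_coded {G H : SimpleGraph V} {A B D : Finset V} (hD : ∀ v, v ∉ D → v ∈ A ∨ v ∈ B)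
    {q r : (V → V) × Bool} (hG : Coded G A q) (hH : Coded H A q) (hG' : Coded G B r)
    (hH' : Coded H B r) (hb : bip G A B = bip H A B) (hr : row G D = row H D) : G = H := by
  have k1 : ∀ x y, y ∈ D → (G.Adj x y ↔ H.Adj x y) := by
    intro x y hy
    have h2 : y ∈ row G D x ↔ y ∈ row H D x := by rw [hr]
    simpa [mem_row, hy] using h2
  have k2 : ∀ x y, x ∈ A → y ∈ B → (G.Adj x y ↔ H.Adj x y) := by
    intro x y hx hy
    have h2 : bip G A B (x, y) = true ↔ bip H A B (x, y) = true := by rw [hb]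
    simpa [bip_eq_true, hx, hy] using h2
  ext x y
  by_cases hxy : x = y
  · subst hxy; simp
  by_cases hy : y ∈ D
  · exact k1 x y hy
  by_cases hx : x ∈ D
  · rw [G.adj_comm, H.adj_comm]; exact k1 y x hx
  rcases hD x hx with hx | hx <;> rcases hD y hy with hy | hy
  · rw [hG x hx y hy hxy, hH x hx y hy hxy]
  · exact k2 x y hx hy
  · rw [G.adj_comm, H.adj_comm]; exact k2 y x hy hx
  · rw [hG' x hx y hy hxy, hH' x hx y hy hxy]

theorem cnt_split [Fintype V] (A B D : Finset V) (hD : ∀ v, v ∉ D → v ∈ A ∨ v ∈ B)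
    (FA FB : (V → V) × Bool → Prop) (K : (V × V → Bool) → Prop) :
    cnt (fun G : SimpleGraph V => (∃ q, FA q ∧ Coded G A q) ∧ (∃ q, FB q ∧ Coded G B q) ∧
      K (bip G A B)) ≤ cnt FA * cnt FB * (2 ^ (D.card * Fintype.card V) *
        cnt (fun T : V × V → Bool => (∀ p, T p = true → p.1 ∈ A ∧ p.2 ∈ B) ∧ K T)) := by
  set M := (2:ℝ) ^ (D.card * Fintype.card V) *
        cnt (fun T : V × V → Bool => (∀ p, T p = true → p.1 ∈ A ∧ p.2 ∈ B) ∧ K T) with hM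
  rw [← cnt_prod FA FB]
  refine (cnt_mono (Q := fun G => ∃ q : ((V → V) × Bool) × ((V → V) × Bool), (FA q.1 ∧ FB q.2) ∧
    ((Coded G A q.1 ∧ Coded G B q.2) ∧ K (bip G A B))) ?_).trans (cnt_exists ?_)
  · rintro G ⟨⟨q, h1, h2⟩, ⟨r, h3, h4⟩, h5⟩
    exact ⟨(q, r), ⟨h1, h3⟩, ⟨h2, h4⟩, h5⟩
  · rintro ⟨q, r⟩ _
    have e : (2:ℝ) ^ (D.card * Fintype.card V) = cnt (fun T : V → Finset V => ∀ v, T v ⊆ D) := by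
      rw [cnt_pi (fun _ X => X ⊆ D), Finset.prod_const, Finset.card_univ, cnt_finset_subset, pow_mul]
    rw [hM, e, ← cnt_prod (fun T : V → Finset V => ∀ v, T v ⊆ D)]
    refine cnt_inj (fun G => (row G D, bip G A B)) ?_ ?_
    · rintro G ⟨_, h⟩
      exact ⟨fun v => row_subset _ _ _, fun p hp => ⟨(bip_eq_true.1 hp).1, (bip_eq_true.1 hp).2.1⟩, h⟩
    · rintro G H ⟨⟨h1, h2⟩, _⟩ ⟨⟨h3, h4⟩, _⟩ h
      exact eq_of_coded hD h1 h3 h2 h4 (congrArg Prod.snd h) (congrArg Prod.fst h)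

theorem prod_bip_le [Fintype V] (A B : Finset V) :
    ∏ p : V × V, (if p.1 ∈ A ∧ p.2 ∈ B then (2:ℝ) else 1) = 2 ^ (A.card * B.card) := by
  rw [Finset.prod_ite, Finset.prod_const, Finset.prod_const_one, mul_one]
  congr 1
  rw [← Finset.card_product]
  congr 1
  ext p; simp

theorem cnt_bip_opt (A B : Finset V) (p : V × V) :
    cnt (fun x : Bool => x = true → p.1 ∈ A ∧ p.2 ∈ B) ≤ if p.1 ∈ A ∧ p.2 ∈ B then (2:ℝ) else 1 := by
  split_ifs with h
  · refine (cnt_le_card _).trans ?_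
    simp
  · rw [cnt_eq_card_filter]
    have : (Finset.univ.filter fun x : Bool => x = true → p.1 ∈ A ∧ p.2 ∈ B) = {false} := by
      ext x; cases x <;> simp [h]
    rw [this]; simp

theorem cnt_bip [Fintype V] (A B : Finset V) :
    cnt (fun T : V × V → Bool => ∀ p, T p = true → p.1 ∈ A ∧ p.2 ∈ B) ≤ 2 ^ (A.card * B.card) := by
  rw [cnt_pi (fun (p : V × V) (x : Bool) => x = true → p.1 ∈ A ∧ p.2 ∈ B), ← prod_bip_le]
  exact Finset.prod_le_prod (fun _ _ => cnt_nonneg _) fun p _ => cnt_bip_opt A B p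

/-- Bipartite patterns violating richness. -/
def NonRich (l : ℕ) (A B : Finset V) (T : V × V → Bool) : Prop :=
  ∃ q : ((Fin l → Fin 2 → V) × (Fin l → Fin 2 → V)) × (Fin 2 → Fin 2 → Bool),
    (Pairs q.1.1 A ∧ Pairs q.1.2 B) ∧
    ∀ i j, ¬ ∀ x y, T (q.1.1 i x, q.1.2 j y) = q.2 x y

theorem nonRich_of_not_rich {G : SimpleGraph V} {l : ℕ} {A B : Finset V} (h : ¬ Rich G l A B) :
    NonRich l A B (bip G A B) := by
  unfold Rich at h
  push Not at h
  obtain ⟨c, d, hc, hd, p, hp⟩ := h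
  refine ⟨((c, d), p), ⟨hc, hd⟩, fun i j hij => ?_⟩
  obtain ⟨x, y, hxy⟩ := hp i j
  have := hij x y
  simp only at this
  have h2 : bip G A B (c i x, d j y) = true ↔ G.Adj (c i x) (d j y) := by
    rw [bip_eq_true]; simp [hc.2 i x, hd.2 j y]
  rw [this] at h2
  rcases hxy with h3 | h3 <;> tauto

theorem cnt_nonRich [Fintype V] (l : ℕ) (A B : Finset V) :
    cnt (fun T : V × V → Bool => (∀ p, T p = true → p.1 ∈ A ∧ p.2 ∈ B) ∧ NonRich l A B T) ≤
      16 * (Fintype.card V : ℝ) ^ (4 * l) * ((15/16) ^ (l ^ 2) * 2 ^ (A.card * B.card)) := by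
  refine (cnt_mono (Q := fun T => ∃ q : ((Fin l → Fin 2 → V) × (Fin l → Fin 2 → V)) × (Fin 2 → Fin 2 → Bool),
    (Pairs q.1.1 A ∧ Pairs q.1.2 B) ∧ ((∀ p, T p = true → p.1 ∈ A ∧ p.2 ∈ B) ∧
    ∀ i j, ¬ ∀ x y, T (q.1.1 i x, q.1.2 j y) = q.2 x y)) ?_).trans
    ((cnt_exists (M := ((15/16:ℝ) ^ (l ^ 2) * 2 ^ (A.card * B.card))) ?_).trans ?_)
  · rintro T ⟨h1, q, h2, h3⟩
    exact ⟨q, h2, h1, h3⟩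
  · rintro ⟨⟨c, d⟩, p⟩ ⟨hc, hd⟩
    simp only at hc hd
    have hinj : Function.Injective fun x : (Fin l × Fin l) × (Fin 2 × Fin 2) =>
        ((c x.1.1 x.2.1, d x.1.2 x.2.2) : V × V) := by
      rintro ⟨⟨i, j⟩, x, y⟩ ⟨⟨i', j'⟩, x', y'⟩ h
      simp only [Prod.mk.injEq] at h
      have h1 := @hc.1 (i, x) (i', x') h.1
      have h2 := @hd.1 (j, y) (j', y') h.2
      simp only [Prod.mk.injEq] at h1 h2
      rw [h1.1, h1.2, h2.1, h2.2]
    have h1 := cnt_matching (fun (i : Fin l × Fin l) (k : Fin 2 × Fin 2) => ((c i.1 k.1, d i.2 k.2) : V × V))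
      hinj (fun p (x : Bool) => x = true → p.1 ∈ A ∧ p.2 ∈ B)
      (fun _ z => ¬ ∀ k, z k = p k.1 k.2) (fun p => if p.1 ∈ A ∧ p.2 ∈ B then (2:ℝ) else 1)
      (15/16) (cnt_bip_opt A B) (by
        rintro ⟨i, j⟩
        have : ∀ k : Fin 2 × Fin 2, (if (c i k.1 ∈ A ∧ d j k.2 ∈ B) then (2:ℝ) else 1) = 2 := by
          intro k; rw [if_pos ⟨hc.2 i _, hd.2 j _⟩]
        simp only [this, Finset.prod_const, Finset.card_univ, Fintype.card_prod, Fintype.card_fin]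
        refine (cnt_mono (Q := fun z => z ≠ fun k => p k.1 k.2) ?_).trans ?_
        · rintro z ⟨_, h⟩ rfl
          exact h fun k => rfl
        · rw [cnt_eq_card_filter]
          have : (Finset.univ.filter fun z : Fin 2 × Fin 2 → Bool => z ≠ fun k => p k.1 k.2) =
            Finset.univ.erase (fun k => p k.1 k.2) := by ext; simp
          rw [this, Finset.card_erase_of_mem (Finset.mem_univ _), Finset.card_univ]
          simp only [Fintype.card_pi, Fintype.card_bool, Finset.prod_const, Finset.card_univ,
            Fintype.card_prod, Fintype.card_fin]
          norm_num)
    rw [prod_bip_le, Fintype.card_prod, Fintype.card_fin, ← sq] at h1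
    refine (cnt_mono ?_).trans h1
    rintro T ⟨h2, h3⟩
    exact ⟨h2, fun i hi => h3 i.1 i.2 fun x y => hi (x, y)⟩
  · gcongr
    refine (cnt_le_card _).trans (le_of_eq ?_)
    simp only [Fintype.card_prod, Fintype.card_pi, Fintype.card_bool, Finset.prod_const,
      Finset.card_univ, Fintype.card_fin]
    push_cast
    rw [show 4 * l = 2 * l + 2 * l by ring, pow_add, pow_mul]
    ring

theorem card_mul_card_le [Fintype V] {A B : Finset V} (h : Disjoint A B) :
    ((A.card * B.card : ℕ) : ℝ) ≤ (Fintype.card V : ℝ) ^ 2 / 4 := by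
  have h1 : ((A.card + B.card : ℕ) : ℝ) ≤ Fintype.card V := by
    rw [← Finset.card_union_of_disjoint h]; exact_mod_cast Finset.card_le_univ _
  push_cast at h1 ⊢
  have : (0:ℝ) ≤ A.card + B.card := by positivity
  nlinarith [sq_nonneg ((A.card : ℝ) - B.card)]

theorem cnt_codes_le [Fintype V] (F : (V → V) × Bool → Prop) :
    cnt F ≤ 2 * (Fintype.card V : ℝ) ^ Fintype.card V := by
  refine (cnt_le_card _).trans (le_of_eq ?_)
  rw [Fintype.card_prod, Fintype.card_bool, Fintype.card_fun]
  push_cast; ring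

theorem cnt_finset_pair_le [Fintype V] (P : Finset V × Finset V → Prop) :
    cnt P ≤ (2:ℝ) ^ (2 * (Fintype.card V : ℝ)) := by
  refine (cnt_le_card _).trans (le_of_eq ?_)
  rw [Fintype.card_prod, Fintype.card_finset]
  push_cast
  rw [two_mul, Real.rpow_add (by norm_num), Real.rpow_natCast]

end codes

theorem aa_str {ζ lam : ℝ} (hlam : 0 < lam) (hlam1 : lam ≤ 1) (hζ : 0 < ζ) (h : ζ ≤ lam ^ 2 / 22) :
    AA (fun V _ G => ∃ A B, Str G ζ ⌈lam * Fintype.card V⌉₊ A B) := by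
  suffices hmain : AA (fun V _ G => ∀ A B, TwoClean G ζ A B → Rich G ⌈lam * Fintype.card V⌉₊ A B) by
    refine ((aa_twoClean hζ).and hmain).mono 0 ?_
    rintro V _ _ G _ ⟨⟨A, B, h1⟩, h2⟩
    exact ⟨A, B, h1, h2 A B h1⟩
  obtain ⟨n₀, hn₀⟩ := (((poly_le_exp 10 9 (c := lam^2/22) (by positivity)).and
    nU_ge_eventually).and (eventually_ge_real 1)).exists_forall_of_atTop
  refine AA.of_total one_pos n₀ ?_
  intro V _ hn
  set n := Fintype.card V with hndef
  obtain ⟨⟨b1, b2⟩, b3⟩ := hn₀ n hn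
  set l := ⌈lam * (n:ℝ)⌉₊ with hl
  have hl1 : lam * n ≤ l := Nat.le_ceil _
  have hl2 : (l:ℝ) ≤ 2 * n := by
    have := (Nat.ceil_lt_add_one (a := lam * (n:ℝ)) (by positivity)).le
    nlinarith
  set L := Real.logb 2 n with hL
  have hL0 : 0 ≤ L := Real.logb_nonneg (by norm_num) b3
  have hnL : ∀ k : ℕ, (n:ℝ) ^ k = (2:ℝ) ^ (L * k) := by
    intro k
    rw [Real.rpow_mul (by norm_num), hL, rpow_lg (by exact_mod_cast b3), Real.rpow_natCast]
  set M : ℝ := (2:ℝ) ^ (2 + 2 * (L * n) + ζ * n * n + (4 + L * (4 * l) + (-(l ^ 2 : ℝ) / 11 + n ^ 2 / 4))) with hM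
  refine (cnt_mono (Q := fun G => ∃ p : Finset V × Finset V,
    (Disjoint p.1 p.2 ∧ ((p.1 ∪ p.2)ᶜ.card : ℝ) ≤ ζ * n) ∧
    ((∃ q, True ∧ Coded G p.1 q) ∧ (∃ q, True ∧ Coded G p.2 q) ∧
      NonRich l p.1 p.2 (bip G p.1 p.2))) ?_).trans ((cnt_exists (M := M) ?_).trans ?_)
  · rintro G ⟨_, hG⟩
    push Not at hG
    obtain ⟨A, B, h1, h2⟩ := hG
    obtain ⟨q, hq⟩ := h1.cleanA.exists_coded
    obtain ⟨r, hr⟩ := h1.cleanB.exists_coded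
    exact ⟨(A, B), ⟨h1.disj, h1.rest⟩, ⟨q, trivial, hq⟩, ⟨r, trivial, hr⟩, nonRich_of_not_rich h2⟩
  · rintro ⟨A, B⟩ ⟨h1, h2⟩
    simp only at h1 h2
    refine (cnt_split A B (A ∪ B)ᶜ (by
      intro v hv; simp only [Finset.mem_compl, Finset.mem_union, not_not] at hv; exact hv) (fun _ => True) (fun _ => True)
      (NonRich l A B)).trans ?_
    have c1 := cnt_codes_le (V := V) (fun _ => True)
    have c2 := cnt_nonRich l A B
    have c3 := card_mul_card_le h1
    have c4 : (15/16:ℝ) ≤ 2 ^ (-(1:ℝ)/11) := by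
      have : (15/16:ℝ) = ((15/16)^11) ^ ((1:ℝ)/11) := by
        rw [← Real.rpow_natCast, ← Real.rpow_mul (by norm_num)]; norm_num
      rw [this, show (-(1:ℝ)/11) = (-1) * (1/11) by ring, Real.rpow_mul (by norm_num)]
      gcongr
      rw [Real.rpow_neg_one]; norm_num
    calc _ ≤ (2 * (n:ℝ)^n) * (2 * (n:ℝ)^n) * (2 ^ ((A ∪ B)ᶜ.card * n) *
          (16 * (n:ℝ) ^ (4 * l) * ((15/16) ^ (l ^ 2) * 2 ^ (A.card * B.card)))) := by
          gcongr
          · exact mul_nonneg (by positivity) (cnt_nonneg _)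
          · exact cnt_nonneg _
      _ ≤ (2 * (n:ℝ)^n) * (2 * (n:ℝ)^n) * ((2:ℝ) ^ (ζ * n * n) *
          (16 * (n:ℝ) ^ (4 * l) * (((2:ℝ) ^ (-(1:ℝ)/11)) ^ (l ^ 2) * 2 ^ ((n:ℝ)^2/4)))) := by
          gcongr
          · rw [← Real.rpow_natCast]
            apply Real.rpow_le_rpow_of_exponent_le (by norm_num)
            push_cast
            gcongr
          · rw [← Real.rpow_natCast]
            exact Real.rpow_le_rpow_of_exponent_le (by norm_num) c3
      _ = M := by
          rw [hM, hnL, hnL, Real.rpow_add (by norm_num), Real.rpow_add (by norm_num),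
            Real.rpow_add (by norm_num), Real.rpow_add (by norm_num), Real.rpow_add (by norm_num),
            show 2 * (L * n) = L * n + L * n by ring, Real.rpow_add (by norm_num),
            ← Real.rpow_natCast ((2:ℝ) ^ (-(1:ℝ)/11)), ← Real.rpow_mul (by norm_num)]
          have e1 : ((2:ℝ) ^ (2:ℝ)) = 4 := by norm_num
          have e2 : ((2:ℝ) ^ (4:ℝ)) = 16 := by
            rw [show (4:ℝ) = ((4:ℕ):ℝ) by norm_num, Real.rpow_natCast]; norm_num
          have e3 : -(1:ℝ)/11 * ((l ^ 2 : ℕ) : ℝ) = -(l^2:ℝ)/11 := by push_cast; ring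
          rw [e1, e2, e3, Real.rpow_add (by norm_num) (-(l^2:ℝ)/11)]
          push_cast
          ring
  · calc _ ≤ (2:ℝ) ^ (2 * (n:ℝ)) * M := by
          gcongr; exact cnt_finset_pair_le _
      _ ≤ (2:ℝ) ^ (-(1 * (n:ℝ))) * 2 ^ ((n:ℝ)^2 / 4 + n * L / 5) := by
          rw [hM, ← Real.rpow_add (by norm_num), ← Real.rpow_add (by norm_num)]
          apply Real.rpow_le_rpow_of_exponent_le (by norm_num)
          have a1 : (lam * n) ^ 2 ≤ (l:ℝ) ^ 2 := by gcongr
          have a2 : ζ * n * n ≤ lam ^ 2 / 22 * n * n := by gcongr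
          have a3 : L * (4 * l) ≤ L * (4 * (2 * n)) := by gcongr
          have a4 : n * (9 + (10:ℕ) * L) ≤ n * (lam ^ 2 / 22 * n) := by gcongr
          push_cast at a4
          have a5 : 0 ≤ n * L := by positivity
          nlinarith
      _ ≤ _ := by gcongr

section triv
variable {V : Type}

/-- The trace of `N(v)` on `A \ {v}` is nearly empty, nearly full, or nearly equal to the trace of
several elements of `A`. -/
def TrivTo (G : SimpleGraph V) (d : ℕ) (A : Finset V) (v : V) : Prop :=
  (row G (A.erase v) v).card ≤ d ∨ (A.erase v \ row G (A.erase v) v).card ≤ d ∨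
    ∃ I ⊆ A.erase v, 4 ≤ I.card ∧
      ∀ i ∈ I, (symmDiff (row G (A.erase v) v) (row G (A.erase v) i)).card ≤ d

theorem TrivTo.mono {G : SimpleGraph V} {d d' : ℕ} {A : Finset V} {v : V} (h : TrivTo G d A v)
    (hd : d ≤ d') : TrivTo G d' A v := by
  rcases h with h | h | ⟨I, h1, h2, h3⟩
  · exact Or.inl (h.trans hd)
  · exact Or.inr (Or.inl (h.trans hd))
  · exact Or.inr (Or.inr ⟨I, h1, h2, fun i hi => (h3 i hi).trans hd⟩)

theorem row_compl_eq {G : SimpleGraph V} {A : Finset V} {v : V} (hv : v ∉ A) :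
    row Gᶜ A v = A \ row G A v := by
  ext x
  simp only [mem_row, SimpleGraph.compl_adj, Finset.mem_sdiff]
  constructor
  · rintro ⟨h1, h2, h3⟩; exact ⟨h1, fun h => h3 h.2⟩
  · rintro ⟨h1, h2⟩
    exact ⟨h1, fun h => hv (h ▸ h1), fun h => h2 ⟨h1, h⟩⟩

theorem TrivTo.compl {G : SimpleGraph V} {d : ℕ} {A : Finset V} {v : V} (h : TrivTo G d A v) :
    TrivTo Gᶜ (d + 1) A v := by
  unfold TrivTo
  rw [row_compl_eq (Finset.notMem_erase v A), Finset.sdiff_sdiff_eq_self (row_subset _ _ _)]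
  rcases h with h | h | ⟨I, h1, h2, h3⟩
  · exact Or.inr (Or.inl (by omega))
  · exact Or.inl (by omega)
  · refine Or.inr (Or.inr ⟨I, h1, h2, fun i hi => ?_⟩)
    have hsub : symmDiff (A.erase v \ row G (A.erase v) v) (row Gᶜ (A.erase v) i) ⊆
        insert i (symmDiff (row G (A.erase v) v) (row G (A.erase v) i)) := by
      intro x hx
      simp only [Finset.mem_symmDiff, Finset.mem_sdiff, mem_row, SimpleGraph.compl_adj,
        Finset.mem_insert] at hx ⊢
      by_cases hxi : x = i
      · exact Or.inl hxi
      · have : i ≠ x := Ne.symm hxi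
        tauto
    exact (Finset.card_le_card hsub).trans ((Finset.card_insert_le _ _).trans
      (Nat.add_le_add_right (h3 i hi) 1))

theorem trivTo_of_pFree {G : SimpleGraph V} {A : Finset V} (h : PFree G ↑A) {v : V} (hv : v ∈ A) :
    TrivTo G 4 A v := by
  by_cases hX : (row G (A.erase v) v).card ≤ 4
  · exact Or.inl hX
  · refine Or.inr (Or.inr ⟨row G (A.erase v) v, row_subset _ _ _, by omega, fun i hi => ?_⟩)
    have : symmDiff (row G (A.erase v) v) (row G (A.erase v) i) ⊆ {i} := by
      intro x hx
      simp only [Finset.mem_symmDiff, mem_row, Finset.mem_singleton, Finset.mem_erase] at hx hi ⊢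
      by_contra hne
      rcases hx with ⟨⟨⟨h1, h2⟩, h3⟩, h4⟩ | ⟨⟨⟨h1, h2⟩, h3⟩, h4⟩
      · exact h4 ⟨⟨h1, h2⟩, h (u := i) (v := v) (w := x) hi.1.2 hv h2 hi.2.symm h3 (Ne.symm hne)⟩
      · exact h4 ⟨⟨h1, h2⟩, h (u := v) (v := i) (w := x) hv hi.1.2 h2 hi.2 h3 (Ne.symm h1)⟩
    exact (Finset.card_le_card this).trans (by simp)

theorem trivTo_of_clean {G : SimpleGraph V} {A : Finset V} (h : Clean G ↑A) {v : V} (hv : v ∈ A) :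
    TrivTo G 5 A v := by
  rcases h with h | h
  · exact (trivTo_of_pFree h hv).mono (by norm_num)
  · have := (trivTo_of_pFree h hv).compl
    rwa [_root_.compl_compl] at this

/-- Off a small set, no two elements of `A` satisfy `Q`. -/
def Cov (A : Finset V) (m : ℕ) (Q : V → V → Prop) : Prop :=
  ∃ R : Finset V, R.card ≤ m ∧ ∀ a ∈ A, a ∉ R → ∀ b ∈ A, b ∉ R → a ≠ b → ¬ Q a b

theorem pairs_or_cov [Fintype V] (A : Finset V) (t : ℕ) (Q : V → V → Prop) :
    (∃ c : Fin t → Fin 2 → V, Pairs c A ∧ ∀ i, Q (c i 0) (c i 1)) ∨ Cov A (2 * t) Q := by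
  rcases matching_or_cover 2 (fun x => (∀ k, x k ∈ A) ∧ Q (x 0) (x 1)) t with ⟨c, h1, h2⟩ | ⟨R, h1, h2⟩
  · exact Or.inl ⟨c, ⟨h1, fun i => (h2 i).1⟩, fun i => (h2 i).2⟩
  · refine Or.inr ⟨R, h1, fun a ha haR b hb hbR hab hQ => h2 ![a, b] ?_ ?_ ⟨?_, hQ⟩⟩
    · intro i j hij
      fin_cases i <;> fin_cases j <;> simp_all
    · intro i; fin_cases i <;> simpa
    · intro i; fin_cases i <;> simpa

theorem Rich.cov_or_cov [Fintype V] {G : SimpleGraph V} {l : ℕ} {A B : Finset V} (h : Rich G l A B)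
    (QA QB : V → V → Prop) (p : Fin 2 → Fin 2 → Bool)
    (hbad : ∀ a b : Fin 2 → V, (∀ k, a k ∈ A) → (∀ k, b k ∈ B) → QA (a 0) (a 1) → QB (b 0) (b 1) →
      (∀ x y, G.Adj (a x) (b y) ↔ p x y = true) → False) :
    Cov A (2 * l) QA ∨ Cov B (2 * l) QB := by
  rcases pairs_or_cov A l QA with ⟨c, hc, hQ⟩ | h1
  · rcases pairs_or_cov B l QB with ⟨d, hd, hQ'⟩ | h2
    · obtain ⟨i, j, hij⟩ := h c d hc hd p
      exact (hbad (c i) (d j) (hc.2 i) (hd.2 j) (hQ i) (hQ' j) hij).elim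
    · exact Or.inr h2
  · exact Or.inl h1

theorem trivTo_of_cov_cov {G : SimpleGraph V} {m d : ℕ} {A : Finset V} {v : V} (hv : v ∉ A)
    (h1 : Cov A m fun a b => G.Adj v a ∧ ¬ G.Adj v b ∧ G.Adj a b)
    (h2 : Cov A m fun a b => G.Adj v a ∧ ¬ G.Adj v b ∧ ¬ G.Adj a b) (hd : 2 * m ≤ d) :
    TrivTo G d A v := by
  obtain ⟨R, hR, h1⟩ := h1
  obtain ⟨S, hS, h2⟩ := h2
  have hc : (R ∪ S).card ≤ d := (Finset.card_union_le _ _).trans (by omega)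
  unfold TrivTo
  rw [Finset.erase_eq_of_notMem hv]
  by_cases hX : row G A v ⊆ R ∪ S
  · exact Or.inl ((Finset.card_le_card hX).trans hc)
  · refine Or.inr (Or.inl ((Finset.card_le_card ?_).trans hc))
    obtain ⟨a, ha, haR⟩ := Finset.not_subset.1 hX
    intro b hb
    by_contra hbR
    simp only [mem_row, Finset.mem_sdiff, Finset.mem_union, not_or, not_and] at ha haR hb hbR
    have hvb := hb.2 hb.1
    have hab : a ≠ b := fun h => hvb (h ▸ ha.2)
    exact h2 a ha.1 haR.2 b hb.1 hbR.2 hab ⟨ha.2, hvb, fun h =>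
      h1 a ha.1 haR.1 b hb.1 hbR.1 hab ⟨ha.2, hvb, h⟩⟩

theorem trivTo_of_cov_edges {G : SimpleGraph V} {m d : ℕ} {A : Finset V} {v : V} (hv : v ∉ A)
    (h1 : Cov A m fun a b => G.Adj v a ∧ ¬ G.Adj v b ∧ G.Adj a b)
    (h2 : Cov A m fun a b => G.Adj v a ∧ G.Adj v b ∧ ¬ G.Adj a b) (hd : 2 * m + 4 ≤ d) :
    TrivTo G d A v := by
  obtain ⟨R, hR, h1⟩ := h1
  obtain ⟨S, hS, h2⟩ := h2
  have hc : (R ∪ S).card ≤ 2 * m := (Finset.card_union_le _ _).trans (by omega)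
  unfold TrivTo
  rw [Finset.erase_eq_of_notMem hv]
  by_cases hX : (row G A v).card ≤ d
  · exact Or.inl hX
  · refine Or.inr (Or.inr ⟨row G A v \ (R ∪ S), Finset.sdiff_subset.trans (row_subset _ _ _), ?_,
      fun i hi => ?_⟩)
    · have := Finset.le_card_sdiff (R ∪ S) (row G A v)
      omega
    · have : symmDiff (row G A v) (row G A i) ⊆ insert i (R ∪ S) := by
        intro x hx
        by_contra hcon
        simp only [Finset.mem_symmDiff, mem_row, Finset.mem_sdiff, Finset.mem_insert,
          Finset.mem_union, not_or] at hx hi hcon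
        obtain ⟨hxi, hxR, hxS⟩ := hcon
        obtain ⟨⟨hiA, hvi⟩, hiR, hiS⟩ := hi
        have hix : i ≠ x := Ne.symm hxi
        rcases hx with ⟨⟨a1, a2⟩, a3⟩ | ⟨⟨a1, a2⟩, a3⟩
        · exact h2 i hiA hiS x a1 hxS hix ⟨hvi, a2, fun h => a3 ⟨a1, h⟩⟩
        · exact h1 i hiA hiR x a1 hxR hix ⟨hvi, fun h => a3 ⟨a1, h⟩, a2⟩
      have := (Finset.card_le_card this).trans (Finset.card_insert_le _ _)
      omega

theorem trivTo_of_cov_nonedges {G : SimpleGraph V} {m d : ℕ} {A : Finset V} {v : V} (hv : v ∉ A)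
    (h1 : Cov A m fun a b => G.Adj v a ∧ ¬ G.Adj v b ∧ ¬ G.Adj a b)
    (h2 : Cov A m fun a b => ¬ G.Adj v a ∧ ¬ G.Adj v b ∧ G.Adj a b) (hd : 2 * m + 4 ≤ d) :
    TrivTo G d A v := by
  obtain ⟨R, hR, h1⟩ := h1
  obtain ⟨S, hS, h2⟩ := h2
  have hc : (R ∪ S).card ≤ 2 * m := (Finset.card_union_le _ _).trans (by omega)
  unfold TrivTo
  rw [Finset.erase_eq_of_notMem hv]
  by_cases hX : (A \ row G A v).card ≤ d
  · exact Or.inr (Or.inl hX)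
  · refine Or.inr (Or.inr ⟨(A \ row G A v) \ (R ∪ S), Finset.sdiff_subset.trans Finset.sdiff_subset, ?_,
      fun i hi => ?_⟩)
    · have := Finset.le_card_sdiff (R ∪ S) (A \ row G A v)
      omega
    · have : symmDiff (row G A v) (row G A i) ⊆ insert i (R ∪ S) := by
        intro x hx
        by_contra hcon
        simp only [Finset.mem_symmDiff, mem_row, Finset.mem_sdiff, Finset.mem_insert,
          Finset.mem_union, not_or, not_and] at hx hi hcon
        obtain ⟨hxi, hxR, hxS⟩ := hcon
        obtain ⟨⟨hiA, hvi⟩, hiR, hiS⟩ := hi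
        have hix : i ≠ x := Ne.symm hxi
        rcases hx with ⟨⟨a1, a2⟩, a3⟩ | ⟨⟨a1, a2⟩, a3⟩
        · exact h1 x a1 hxR i hiA hiR hxi ⟨a2, hvi hiA, fun h => a3 a1 h.symm⟩
        · exact h2 i hiA hiS x a1 hxS hix ⟨hvi hiA, a3 a1, a2⟩
      have := (Finset.card_le_card this).trans (Finset.card_insert_le _ _)
      omega

theorem trivTo_or_trivTo [Fintype V] {G : SimpleGraph V} (hG : NoC5 G) {l d : ℕ} {A B : Finset V}
    (hA : Clean G ↑A) (hB : Clean G ↑B) (h : Rich G l A B) (hd : 4 * l + 5 ≤ d) (v : V) :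
    TrivTo G d A v ∨ TrivTo G d B v := by
  by_cases hvA : v ∈ A
  · exact Or.inl ((trivTo_of_clean hA hvA).mono (by omega))
  by_cases hvB : v ∈ B
  · exact Or.inr ((trivTo_of_clean hB hvB).mono (by omega))
  have d1 := h.cov_or_cov (fun a b => G.Adj v a ∧ ¬ G.Adj v b ∧ G.Adj a b)
    (fun a b => G.Adj v a ∧ ¬ G.Adj v b ∧ G.Adj a b) ![![false, false], ![false, true]] (by
      rintro a b - - ⟨a1, a2, a3⟩ ⟨b1, b2, b3⟩ hp
      have p00 : ¬ G.Adj (a 0) (b 0) := by simp [hp]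
      have p01 : ¬ G.Adj (a 0) (b 1) := by simp [hp]
      have p10 : ¬ G.Adj (a 1) (b 0) := by simp [hp]
      have p11 : G.Adj (a 1) (b 1) := by simp [hp]
      exact hG v (a 0) (a 1) (b 1) (b 0) a1 a3 p11 b3.symm b1.symm a2 b2 p01 p00 p10)
  have d2 := h.cov_or_cov (fun a b => G.Adj v a ∧ ¬ G.Adj v b ∧ ¬ G.Adj a b)
    (fun a b => G.Adj v a ∧ ¬ G.Adj v b ∧ ¬ G.Adj a b) ![![false, true], ![true, true]] (by
      rintro a b - - ⟨a1, a2, a3⟩ ⟨b1, b2, b3⟩ hp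
      have p00 : ¬ G.Adj (a 0) (b 0) := by simp [hp]
      have p01 : G.Adj (a 0) (b 1) := by simp [hp]
      have p10 : G.Adj (a 1) (b 0) := by simp [hp]
      have p11 : G.Adj (a 1) (b 1) := by simp [hp]
      exact hG v (a 0) (b 1) (a 1) (b 0) a1 p01 p11.symm p10 b1.symm b2 a2 a3 p00
        (fun h => b3 h.symm))
  have d3 := h.cov_or_cov (fun a b => G.Adj v a ∧ G.Adj v b ∧ ¬ G.Adj a b)
    (fun a b => ¬ G.Adj v a ∧ ¬ G.Adj v b ∧ G.Adj a b) ![![true, false], ![false, true]] (by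
      rintro a b - - ⟨a1, a2, a3⟩ ⟨b1, b2, b3⟩ hp
      have p00 : G.Adj (a 0) (b 0) := by simp [hp]
      have p01 : ¬ G.Adj (a 0) (b 1) := by simp [hp]
      have p10 : ¬ G.Adj (a 1) (b 0) := by simp [hp]
      have p11 : G.Adj (a 1) (b 1) := by simp [hp]
      exact hG v (a 0) (b 0) (b 1) (a 1) a1 p00 b3 p11.symm a2.symm b1 b2 p01 a3
        (fun h => p10 h.symm))
  have d4 := h.symm.cov_or_cov (fun a b => G.Adj v a ∧ G.Adj v b ∧ ¬ G.Adj a b)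
    (fun a b => ¬ G.Adj v a ∧ ¬ G.Adj v b ∧ G.Adj a b) ![![true, false], ![false, true]] (by
      rintro a b - - ⟨a1, a2, a3⟩ ⟨b1, b2, b3⟩ hp
      have p00 : G.Adj (a 0) (b 0) := by simp [hp]
      have p01 : ¬ G.Adj (a 0) (b 1) := by simp [hp]
      have p10 : ¬ G.Adj (a 1) (b 0) := by simp [hp]
      have p11 : G.Adj (a 1) (b 1) := by simp [hp]
      exact hG v (a 0) (b 0) (b 1) (a 1) a1 p00 b3 p11.symm a2.symm b1 b2 p01 a3
        (fun h => p10 h.symm))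
  rcases d1 with e1 | e1 <;> rcases d2 with e2 | e2
  · exact Or.inl (trivTo_of_cov_cov hvA e1 e2 (by omega))
  · rcases d3 with e3 | e3
    · exact Or.inl (trivTo_of_cov_edges hvA e1 e3 (by omega))
    · exact Or.inr (trivTo_of_cov_nonedges hvB e2 e3 (by omega))
  · rcases d4 with e3 | e3
    · exact Or.inr (trivTo_of_cov_edges hvB e1 e3 (by omega))
    · exact Or.inl (trivTo_of_cov_nonedges hvA e2 e3 (by omega))
  · exact Or.inr (trivTo_of_cov_cov hvB e1 e2 (by omega))

/-- Subsets of `S` that are nearly trivial, or close to the trace of an element of `S`. -/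
def NearRow (G : SimpleGraph V) (d : ℕ) (S Z : Finset V) : Prop :=
  Z.card ≤ d ∨ (S \ Z).card ≤ d ∧ Z ⊆ S ∨ ∃ i, (symmDiff Z (row G S i)).card ≤ d

theorem cnt_nearRow [Fintype V] (G : SimpleGraph V) (d : ℕ) (S : Finset V) :
    cnt (NearRow G d S) ≤ (Fintype.card V + 2) * ballCard (Fintype.card V) d := by
  set b := ballCard (Fintype.card V) d
  have h1 : cnt (fun Z : Finset V => Z.card ≤ d) ≤ b := (cnt_card_le d).le
  have h2 : cnt (fun Z : Finset V => (S \ Z).card ≤ d ∧ Z ⊆ S) ≤ b := by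
    refine le_trans (cnt_inj (fun Z => S \ Z) (fun Z h => h.1) ?_) h1
    intro Z W hZ hW h
    have := congrArg (S \ ·) h
    simpa [Finset.sdiff_sdiff_eq_self hZ.2, Finset.sdiff_sdiff_eq_self hW.2] using this
  have h3 : cnt (fun Z : Finset V => ∃ i : V, True ∧ (symmDiff Z (row G S i)).card ≤ d) ≤
      Fintype.card V * b := by
    refine (cnt_exists (R := fun _ : V => True) (M := b) fun i _ => ?_).trans (by rw [cnt_true])
    refine le_trans (cnt_mono fun Z hZ => ?_) (cnt_symmDiff_le (row G S i) d)
    rwa [symmDiff_comm] at hZ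
  refine (cnt_mono (Q := fun Z => Z.card ≤ d ∨ ((S \ Z).card ≤ d ∧ Z ⊆ S ∨
    ∃ i : V, True ∧ (symmDiff Z (row G S i)).card ≤ d)) ?_).trans ?_
  · rintro Z (h | h | ⟨i, h⟩)
    · exact Or.inl h
    · exact Or.inr (Or.inl h)
    · exact Or.inr (Or.inr ⟨i, trivial, h⟩)
  · refine (cnt_or _ _).trans ((add_le_add h1 ((cnt_or _ _).trans (add_le_add h2 h3))).trans ?_)
    linarith

theorem TrivTo.nearRow {G G₀ : SimpleGraph V} {d : ℕ} {A U : Finset V} {u : V} (h : TrivTo G d A u)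
    (hu : u ∈ U) (hU : U.card ≤ 3)
    (hG : ∀ x, x ∉ U → ∀ y, y ∉ U → (G.Adj x y ↔ G₀.Adj x y)) :
    NearRow G₀ d (A \ U) ((A \ U).filter fun x => u ∈ row G U x) := by
  have e : ((A \ U).filter fun x => u ∈ row G U x) = (row G (A.erase u) u) \ U := by
    ext x
    simp only [Finset.mem_filter, Finset.mem_sdiff, mem_row, Finset.mem_erase, G.adj_comm x u]
    have : x = u → x ∈ U := fun h => h ▸ hu
    tauto
  rw [e]
  rcases h with h | h | ⟨I, h1, h2, h3⟩
  · exact Or.inl ((Finset.card_le_card Finset.sdiff_subset).trans h)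
  · refine Or.inr (Or.inl ⟨(Finset.card_le_card ?_).trans h, ?_⟩)
    · intro x
      simp only [Finset.mem_sdiff, mem_row, Finset.mem_erase]
      have : x = u → x ∈ U := fun h => h ▸ hu
      tauto
    · exact Finset.sdiff_subset_sdiff ((row_subset _ _ _).trans (Finset.erase_subset _ _)) le_rfl
  · obtain ⟨i, hi, hiU⟩ : ∃ i ∈ I, i ∉ U := by
      by_contra hcon
      push Not at hcon
      have := Finset.card_le_card (show I ⊆ U from hcon)
      omega
    refine Or.inr (Or.inr ⟨i, (Finset.card_le_card ?_).trans (h3 i hi)⟩)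
    intro x
    simp only [Finset.mem_symmDiff, Finset.mem_sdiff, mem_row, Finset.mem_erase]
    have : x = u → x ∈ U := fun h => h ▸ hu
    by_cases hxU : x ∈ U
    · tauto
    · have := hG i hiU x hxU
      tauto

theorem cnt_trace [Fintype V] {U S : Finset V} {O : V → Finset V} (hO : ∀ v, O v ⊆ U)
    (Bd : Finset V → Prop) (K : (V → Finset V) → Prop) :
    cnt (fun T : V → Finset V => (∀ v, T v ⊆ O v) ∧ (∀ u ∈ U, Bd (S.filter fun x => u ∈ T x)) ∧
      K (fun v => if v ∈ S then ∅ else T v)) ≤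
    cnt Bd ^ U.card * cnt (fun T : V → Finset V => (∀ v, T v ⊆ if v ∈ S then ∅ else O v) ∧ K T) := by
  have e : cnt Bd ^ U.card = cnt (fun z : {u // u ∈ U} → Finset V => ∀ u, Bd (z u)) := by
    rw [cnt_pi (fun _ X => Bd X), Finset.prod_const, Finset.card_univ, Fintype.card_coe]
  rw [e, ← cnt_prod (fun z : {u // u ∈ U} → Finset V => ∀ u, Bd (z u))]
  refine cnt_inj (fun T => ((fun u => S.filter fun x => u.1 ∈ T x), fun v => if v ∈ S then ∅ else T v)) ?_ ?_
  · rintro T ⟨h1, h2, h3⟩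
    refine ⟨fun u => h2 u.1 u.2, fun v => ?_, h3⟩
    simp only
    split_ifs
    · exact Finset.Subset.refl _
    · exact h1 v
  · rintro T T' ⟨h1, -, -⟩ ⟨h1', -, -⟩ h
    funext v
    by_cases hv : v ∈ S
    · ext u
      by_cases hu : u ∈ U
      · have := congrFun (congrArg Prod.fst h) ⟨u, hu⟩
        simp only at this
        have h2 : v ∈ (S.filter fun x => u ∈ T x) ↔ v ∈ (S.filter fun x => u ∈ T' x) := by rw [this]
        simpa [hv] using h2
      · exact ⟨fun h => (hu (hO v (h1 v h))).elim, fun h => (hu (hO v (h1' v h))).elim⟩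
    · have := congrFun (congrArg Prod.snd h) v
      simpa [hv] using this

end triv

/-- The hierarchy of constants used in the structural part. -/
structure Params (κ μ ζ lam : ℝ) : Prop where
  κ_pos : 0 < κ
  μ_pos : 0 < μ
  ζ_pos : 0 < ζ
  lam_pos : 0 < lam
  ball : ∀ n d : ℕ, (d : ℝ) ≤ μ * n → ballCard n d ≤ (2 : ℝ) ^ (κ * n)
  ζ_le : ζ ≤ μ / 32
  lam_le : lam ≤ μ / 32
  μ_le : μ ≤ 1
  ζ_le_κ : ζ ≤ κ
  ζ_le_lam : ζ ≤ lam ^ 2 / 22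

theorem exists_params {κ : ℝ} (hκ : 0 < κ) : ∃ μ ζ lam : ℝ, Params κ μ ζ lam ∧ μ ≤ κ := by
  obtain ⟨μ, hμ0, hμ1, hμ⟩ := ballCard_small hκ
  set ν := min μ κ with hν
  have hν0 : 0 < ν := lt_min hμ0 hκ
  have hν1 : ν ≤ 1 := (min_le_left _ _).trans hμ1
  refine ⟨ν, (ν/32)^2/22, ν/32, ⟨hκ, hν0, by positivity, by positivity, ?_, by nlinarith, le_rfl,
    hν1, ?_, le_rfl⟩, min_le_right _ _⟩
  · intro n d h
    refine hμ n d (h.trans ?_)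
    gcongr
    exact min_le_left _ _
  · have : ν ≤ κ := min_le_right _ _
    nlinarith

/-- The number `n` is large with respect to the constants. -/
structure Large (κ μ ζ lam : ℝ) (n : ℕ) : Prop where
  n_pos : (2:ℝ) ≤ n
  str : 4 * ⌈lam * n⌉₊ + 3 * (2 * ζ) * n ≤ (n:ℝ) / 2
  str' : 4 * ⌈lam * n⌉₊ + 2 * (2 * ζ) * n ≤ (⌊μ * n⌋₊ : ℝ)
  triv : 4 * ⌈lam * n⌉₊ + 6 ≤ ⌊μ * n⌋₊
  lg : 1 + Real.logb 2 n ≤ κ * n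
  ζ_three : 3 ≤ ζ * n

theorem Params.large {κ μ ζ lam : ℝ} (h : Params κ μ ζ lam) : ∀ᶠ n : ℕ in atTop, Large κ μ ζ lam n := by
  have := h.μ_pos
  have hl := h.lam_le
  have hz := h.ζ_le
  have hm := h.μ_le
  filter_upwards [eventually_ge_real 100, eventually_ge_real (100/μ), eventually_ge_real (3/ζ),
    poly_le_exp 1 1 h.κ_pos] with n h1 h2 h3 h4
  rw [div_le_iff₀ h.μ_pos] at h2
  rw [div_le_iff₀ h.ζ_pos] at h3
  have a1 : (⌈lam * n⌉₊ : ℝ) ≤ lam * n + 1 :=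
    (Nat.ceil_lt_add_one (a := lam * (n:ℝ)) (by have := h.lam_pos; positivity)).le
  have a2 : lam * n ≤ μ / 32 * n := by gcongr
  have a3 : ζ * n ≤ μ / 32 * n := by gcongr
  have a4 : μ * n ≤ 1 * n := by gcongr
  have a5 : μ * n < ⌊μ * n⌋₊ + 1 := Nat.lt_floor_add_one _
  refine ⟨by linarith, by linarith, by linarith, ?_, ?_, by linarith⟩
  · have : ((4 * ⌈lam * n⌉₊ + 6 : ℕ) : ℝ) ≤ (⌊μ * n⌋₊ : ℕ) := by push_cast; linarith
    exact_mod_cast this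
  · simpa using h4

section large
variable {V : Type} [Fintype V] {κ μ ζ lam : ℝ}

theorem Large.cnt_str (hP : Params κ μ ζ lam) (h : Large κ μ ζ lam (Fintype.card V))
    (G : SimpleGraph V) :
    cnt (fun p : Finset V × Finset V => Str G (2 * ζ) ⌈lam * Fintype.card V⌉₊ p.1 p.2) ≤
      (2:ℝ) ^ (3 * κ * Fintype.card V) := by
  set n := Fintype.card V
  refine (cnt_str_le h.str h.str').trans ?_
  have h1 := hP.ball n ⌊μ * n⌋₊ (Nat.floor_le (by have := hP.μ_pos; positivity))
  have hlg : 0 ≤ Real.logb 2 n := Real.logb_nonneg (by norm_num) (by linarith [h.n_pos])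
  calc 2 * ballCard n ⌊μ * n⌋₊ ^ 2 ≤ 2 * ((2:ℝ) ^ (κ * n)) ^ 2 := by
        gcongr
        linarith [ballCard_pos n ⌊μ * n⌋₊]
    _ = (2:ℝ) ^ (1 + 2 * (κ * n)) := by
        rw [Real.rpow_add (by norm_num), two_mul (κ * n), Real.rpow_add (by norm_num)]
        norm_num; ring
    _ ≤ _ := by
        apply Real.rpow_le_rpow_of_exponent_le (by norm_num)
        linarith [h.lg]

theorem Large.cnt_nearRow (hP : Params κ μ ζ lam) (h : Large κ μ ζ lam (Fintype.card V))
    (G : SimpleGraph V) (S : Finset V) :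
    cnt (NearRow G ⌊μ * Fintype.card V⌋₊ S) ≤ (2:ℝ) ^ (2 * κ * Fintype.card V) := by
  refine (_root_.cnt_nearRow _ _ _).trans ?_
  set n := Fintype.card V
  have hn := h.n_pos
  have h1 := hP.ball n ⌊μ * n⌋₊ (Nat.floor_le (by have := hP.μ_pos; positivity))
  have h2 : (n:ℝ) + 2 ≤ 2 ^ (κ * n) := by
    calc (n:ℝ) + 2 ≤ 2 * n := by linarith
      _ = 2 ^ (1 + Real.logb 2 n) := by
        rw [Real.rpow_add (by norm_num), rpow_lg (by have : 2 ≤ n := by exact_mod_cast hn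
                                                     omega), Real.rpow_one]
      _ ≤ _ := by
        apply Real.rpow_le_rpow_of_exponent_le (by norm_num)
        exact h.lg
  calc ((n:ℝ) + 2) * ballCard n ⌊μ * n⌋₊ ≤ 2 ^ (κ * n) * 2 ^ (κ * n) := by
        gcongr
        linarith [ballCard_pos n ⌊μ * n⌋₊]
    _ = _ := by rw [← Real.rpow_add (by norm_num)]; ring_nf

theorem prod_ite_pow {D : Finset V} (k : ℕ) : ∏ v : V, (if v ∈ D then (1:ℝ) else 2 ^ k) = 2 ^ (k * Dᶜ.card) := by
  rw [Finset.prod_ite, Finset.prod_const_one, one_mul, Finset.prod_const, pow_mul]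
  congr 2
  ext; simp
end large

theorem aa_not_trivTo_both {κ μ ζ lam : ℝ} (hP : Params κ μ ζ lam) (hκ : κ ≤ 1/36) :
    AA (fun V _ G => ∀ A B, Str G ζ ⌈lam * Fintype.card V⌉₊ A B → ∀ v,
      ¬ (TrivTo G ⌊μ * Fintype.card V⌋₊ A v ∧ TrivTo G ⌊μ * Fintype.card V⌋₊ B v)) := by
  obtain ⟨n₀, hn₀⟩ := hP.large.exists_forall_of_atTop
  suffices hmain : AA (fun V _ G => ∀ U : Finset V, U.card = 1 → ¬ ∃ A B,
      Str G ζ ⌈lam * Fintype.card V⌉₊ A B ∧ ∀ u ∈ U,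
        TrivTo G ⌊μ * Fintype.card V⌋₊ A u ∧ TrivTo G ⌊μ * Fintype.card V⌋₊ B u) by
    refine hmain.mono 0 ?_
    intro V _ _ G _ h A B hAB v hv
    exact h {v} (by simp) ⟨A, B, hAB, by simpa using hv⟩
  refine AA.of_ext 1 (fun V _ G U => ∃ A B,
      Str G ζ ⌈lam * Fintype.card V⌉₊ A B ∧ ∀ u ∈ U,
        TrivTo G ⌊μ * Fintype.card V⌋₊ A u ∧ TrivTo G ⌊μ * Fintype.card V⌋₊ B u)
    (c := 1/4) (by norm_num) n₀ ?_ le_rfl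
  intro V _ hn U hU G₀ _ _
  have hL := hn₀ _ hn
  set n := Fintype.card V with hndef
  set l := ⌈lam * n⌉₊ with hl
  set d := ⌊μ * n⌋₊ with hd
  set K : Finset V × Finset V → (V → Finset V) → Prop := fun p T =>
    (∀ u ∈ U, NearRow G₀ d p.2 (p.2.filter fun x => u ∈ T x)) ∧ True with hK
  have hcnt := cnt_ext_le (U := U) (G₀ := G₀) (W := fun G => InF G ∧ ∃ A B, Str G ζ l A B ∧
      ∀ u ∈ U, TrivTo G d A u ∧ TrivTo G d B u)
    (fun T => ∃ p : Finset V × Finset V, Str G₀ (2 * ζ) l p.1 p.2 ∧ (∀ v, T v ⊆ U) ∧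
      (∀ u ∈ U, NearRow G₀ d p.1 (p.1.filter fun x => u ∈ T x)) ∧
      K p (fun v => if v ∈ p.1 then ∅ else T v)) (by
      rintro G ⟨_, A, B, hAB, ht⟩ hag
      have hst := hAB.sdiff (U := U) (by rw [hU]; push_cast; linarith [hL.ζ_three]) hag
      refine ⟨(A \ U, B \ U), hst, fun v => row_subset _ _ _,
        fun u hu => (ht u hu).1.nearRow hu (by omega) hag, fun u hu => ?_, trivial⟩
      have h1 := (ht u hu).2.nearRow hu (by omega) hag
      have : ((B \ U).filter fun x => u ∈ (if x ∈ A \ U then ∅ else row G U x)) =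
          (B \ U).filter fun x => u ∈ row G U x := by
        refine Finset.filter_congr fun x hx => ?_
        rw [if_neg fun h => Finset.disjoint_left.1 hst.disj h hx]
      simp only
      rw [this]
      exact h1)
  refine le_trans (cnt_mono fun G h => ⟨⟨h.1, h.2.1⟩, h.2.2⟩) (hcnt.trans ?_)
  refine (cnt_exists (M := (2:ℝ) ^ (2 * κ * n) * ((2:ℝ) ^ (2 * κ * n) * 2 ^ (2 * ζ * n))) ?_).trans ?_
  · rintro ⟨A, B⟩ hAB
    simp only at hAB
    refine (cnt_trace (fun _ => Finset.Subset.refl U) _ _).trans ?_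
    have hO : ∀ v : V, (if v ∈ A then ∅ else U) ⊆ U := fun v => by split_ifs <;> simp
    have hcnt2 := cnt_trace (S := B) hO (NearRow G₀ d B) (fun _ => True)
    rw [hU, pow_one] at hcnt2 ⊢
    have e1 : cnt (fun T : V → Finset V => (∀ v, T v ⊆ if v ∈ B then ∅ else if v ∈ A then ∅ else U) ∧ True)
        ≤ (2:ℝ) ^ (2 * ζ * n) := by
      simp only [and_true]
      rw [cnt_pi (fun v X => X ⊆ if v ∈ B then ∅ else if v ∈ A then ∅ else U)]
      have : ∀ v, cnt (fun X : Finset V => X ⊆ if v ∈ B then ∅ else if v ∈ A then ∅ else U) =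
          if v ∈ A ∪ B then (1:ℝ) else 2 ^ 1 := by
        intro v
        rw [cnt_finset_subset]
        by_cases h1 : v ∈ B <;> by_cases h2 : v ∈ A <;> simp [h1, h2, hU]
      rw [Finset.prod_congr rfl fun v _ => this v, prod_ite_pow, one_mul, ← Real.rpow_natCast]
      apply Real.rpow_le_rpow_of_exponent_le (by norm_num)
      exact hAB.rest
    have e2 := hL.cnt_nearRow hP G₀ A
    have e3 := hL.cnt_nearRow hP G₀ B
    gcongr
    · exact cnt_nonneg _
    refine hcnt2.trans ?_
    gcongr
    exact cnt_nonneg _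
  · calc _ ≤ (2:ℝ) ^ (3 * κ * n) * ((2:ℝ) ^ (2 * κ * n) * ((2:ℝ) ^ (2 * κ * n) * 2 ^ (2 * ζ * n))) := by
          gcongr
          exact hL.cnt_str hP G₀
      _ ≤ _ := by
        rw [← Real.rpow_add (by norm_num), ← Real.rpow_add (by norm_num), ← Real.rpow_add (by norm_num)]
        apply Real.rpow_le_rpow_of_exponent_le (by norm_num)
        have h1 : ζ * n ≤ κ * n := by gcongr; exact hP.ζ_le_κ
        have h2 : κ * n ≤ 1/36 * n := by gcongr
        push_cast
        linarith

theorem aa_no_p3_with_matching {κ μ ζ lam β : ℝ} (hP : Params κ μ ζ lam) (hβ : 0 < β)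
    (hκ : κ ≤ β / 2000) :
    AA (fun V _ G => ∀ A B, Str G ζ ⌈lam * Fintype.card V⌉₊ A B → ∀ x : Fin 3 → V, IsP3 G x →
      (∀ j, TrivTo G ⌊μ * Fintype.card V⌋₊ A (x j)) →
      ∀ c : Fin ⌈β * Fintype.card V⌉₊ → Fin 2 → V,
        Pairs c (B \ Finset.univ.image x) → ¬ ∀ i, G.Adj (c i 0) (c i 1)) := by
  obtain ⟨n₀, hn₀⟩ := hP.large.exists_forall_of_atTop
  suffices hmain : AA (fun V _ G => ∀ U : Finset V, U.card = 3 → ¬ ∃ A B,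
      Str G ζ ⌈lam * Fintype.card V⌉₊ A B ∧ ∃ x : Fin 3 → V, (∀ j, x j ∈ U) ∧ IsP3 G x ∧
      (∀ u ∈ U, TrivTo G ⌊μ * Fintype.card V⌋₊ A u) ∧
      ∃ c : Fin ⌈β * Fintype.card V⌉₊ → Fin 2 → V, Pairs c (B \ U) ∧ ∀ i, G.Adj (c i 0) (c i 1)) by
    refine hmain.mono 0 ?_
    intro V _ _ G _ h A B hAB x hx ht c hc hadj
    refine h (Finset.univ.image x) ?_ ⟨A, B, hAB, x, by simp, hx, by simpa using ht, c, hc, hadj⟩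
    rw [Finset.card_image_of_injective _ hx.injective]; simp
  refine AA.of_ext 3 (fun V _ G U => ∃ A B,
      Str G ζ ⌈lam * Fintype.card V⌉₊ A B ∧ ∃ x : Fin 3 → V, (∀ j, x j ∈ U) ∧ IsP3 G x ∧
      (∀ u ∈ U, TrivTo G ⌊μ * Fintype.card V⌋₊ A u) ∧
      ∃ c : Fin ⌈β * Fintype.card V⌉₊ → Fin 2 → V, Pairs c (B \ U) ∧ ∀ i, G.Adj (c i 0) (c i 1))
    (c := β/100) (by positivity) n₀ ?_ (by norm_num)
  intro V _ hn U hU G₀ _ _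
  have hL := hn₀ _ hn
  set n := Fintype.card V with hndef
  set l := ⌈lam * n⌉₊ with hl
  set d := ⌊μ * n⌋₊ with hd
  set t := ⌈β * n⌉₊ with ht
  have htβ : β * n ≤ t := Nat.le_ceil _
  set CW : Finset V → (Fin t → Fin 2 → V) → Prop := fun B c =>
    Pairs c B ∧ ∀ i, G₀.Adj (c i 0) (c i 1) with hCW
  set K : (Finset V × Finset V) × (Fin 3 → V) → (V → Finset V) → Prop := fun q T =>
    ∀ c, CW q.1.2 c → ∀ i, ¬ (T (c i 0) = {q.2 2} ∧ T (c i 1) = {q.2 0}) with hK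
  have hcnt := cnt_ext_le (U := U) (G₀ := G₀) (W := fun G => InF G ∧ ∃ A B,
      Str G ζ l A B ∧ ∃ x : Fin 3 → V, (∀ j, x j ∈ U) ∧ IsP3 G x ∧
      (∀ u ∈ U, TrivTo G d A u) ∧
      ∃ c : Fin t → Fin 2 → V, Pairs c (B \ U) ∧ ∀ i, G.Adj (c i 0) (c i 1))
    (fun T => ∃ q : (Finset V × Finset V) × (Fin 3 → V),
      (Str G₀ (2 * ζ) l q.1.1 q.1.2 ∧ ((∀ j, q.2 j ∈ U) ∧ ∃ c, CW q.1.2 c)) ∧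
      ((∀ v, T v ⊆ U) ∧
      (∀ u ∈ U, NearRow G₀ d q.1.1 (q.1.1.filter fun x => u ∈ T x)) ∧
      K q (fun v => if v ∈ q.1.1 then ∅ else T v))) (by
      rintro G ⟨hF, A, B, hAB, x, hxU, hx, ht, c, hc, hadj⟩ hag
      have hst := hAB.sdiff (U := U) (by rw [hU]; push_cast; linarith [hL.ζ_three]) hag
      have hagc : ∀ {c : Fin t → Fin 2 → V}, Pairs c (B \ U) → ∀ i, (G.Adj (c i 0) (c i 1) ↔
          G₀.Adj (c i 0) (c i 1)) := fun hc i =>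
        hag _ (Finset.mem_sdiff.1 (hc.2 i 0)).2 _ (Finset.mem_sdiff.1 (hc.2 i 1)).2
      refine ⟨((A \ U, B \ U), x), ⟨hst, hxU, c, hc, fun i => (hagc hc i).1 (hadj i)⟩,
        fun v => row_subset _ _ _,
        fun u hu => (ht u hu).nearRow hu (by omega) hag, ?_⟩
      rintro c' ⟨hc', hadj'⟩ i
      simp only at hc' ⊢
      rw [if_neg fun h => Finset.disjoint_left.1 hst.disj h (hc'.2 i 0),
        if_neg fun h => Finset.disjoint_left.1 hst.disj h (hc'.2 i 1)]
      rintro ⟨h0, h1⟩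
      obtain ⟨p1, p2, p3, p4⟩ := hx
      have hinj : Function.Injective x := IsP3.injective ⟨p1, p2, p3, p4⟩
      have m0 : ∀ j, G.Adj (c' i 0) (x j) ↔ j = 2 := by
        intro j
        have : x j ∈ row G U (c' i 0) ↔ x j = x 2 := by rw [h0, Finset.mem_singleton]
        rw [mem_row, hinj.eq_iff] at this
        simpa [hxU j] using this
      have m1 : ∀ j, G.Adj (c' i 1) (x j) ↔ j = 0 := by
        intro j
        have : x j ∈ row G U (c' i 1) ↔ x j = x 0 := by rw [h1, Finset.mem_singleton]
        rw [mem_row, hinj.eq_iff] at this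
        simpa [hxU j] using this
      have e := (hagc hc' i).2 (hadj' i)
      refine hF.noC5 (x 0) (x 1) (x 2) (c' i 0) (c' i 1) p1 p2 ((m0 2).2 rfl).symm e
        ((m1 0).2 rfl) p3 (fun h => ?_) (fun h => ?_) (fun h => ?_) (fun h => ?_)
      · exact absurd ((m0 0).1 h.symm) (by decide)
      · exact absurd ((m0 1).1 h.symm) (by decide)
      · exact absurd ((m1 1).1 h.symm) (by decide)
      · exact absurd ((m1 2).1 h.symm) (by decide))
  refine le_trans (cnt_mono fun G h => ⟨⟨h.1, h.2.1⟩, h.2.2⟩) (hcnt.trans ?_)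
  have hρ : (63/64:ℝ) ≤ 2 ^ (-(1:ℝ)/45) := by
    have : (63/64:ℝ) = ((63/64)^45) ^ ((1:ℝ)/45) := by
      rw [← Real.rpow_natCast, ← Real.rpow_mul (by norm_num)]; norm_num
    rw [this, show (-(1:ℝ)/45) = (-1) * (1/45) by ring, Real.rpow_mul (by norm_num)]
    gcongr
    rw [Real.rpow_neg_one]; norm_num
  refine (cnt_exists (M := ((2:ℝ) ^ (2 * κ * n)) ^ 3 * ((2:ℝ) ^ (-(1:ℝ)/45 * (β * n)) *
    2 ^ (3 * ((1/2 + 4 * ζ) * n)))) ?_).trans ?_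
  · rintro ⟨⟨A, B⟩, x⟩ ⟨hAB, hxU, c, hc, hadj⟩
    simp only at hAB hc hxU
    refine (cnt_trace (fun _ => Finset.Subset.refl U) _ _).trans ?_
    have e2 := hL.cnt_nearRow hP G₀ A
    rw [hU]
    have hcA : ∀ i j, c i j ∉ A := fun i j h => Finset.disjoint_left.1 hAB.disj h (hc.2 i j)
    have hb : ∀ v : V, cnt (fun X : Finset V => X ⊆ if v ∈ A then ∅ else U) = if v ∈ A then (1:ℝ) else 2 ^ 3 := by
      intro v
      rw [cnt_finset_subset]
      by_cases h2 : v ∈ A <;> simp [h2, hU]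
    have h1 := cnt_matching c hc.1 (fun v X => X ⊆ if v ∈ A then ∅ else U)
      (fun i z => ¬ (z 0 = {x 2} ∧ z 1 = {x 0})) (fun v => if v ∈ A then (1:ℝ) else 2 ^ 3) (63/64)
      (fun v => (hb v).le) (by
        intro i
        simp only [if_neg (hcA i _), Finset.prod_const, Finset.card_univ, Fintype.card_fin]
        rw [cnt_eq_card_filter]
        have e1 : (Finset.univ.filter fun z : Fin 2 → Finset V => (∀ j, z j ⊆ U) ∧ ¬ (z 0 = {x 2} ∧ z 1 = {x 0})) =
            (Fintype.piFinset fun _ : Fin 2 => U.powerset).erase ![{x 2}, {x 0}] := by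
          ext z
          simp only [Finset.mem_filter, Finset.mem_univ, true_and, Finset.mem_erase,
            Fintype.mem_piFinset, Finset.mem_powerset]
          rw [and_comm]
          refine and_congr_left fun _ => not_congr ⟨?_, ?_⟩
          · rintro ⟨h1, h2⟩; funext j; fin_cases j <;> simpa
          · rintro rfl; simp
        rw [e1, Finset.card_erase_of_mem, Fintype.card_piFinset]
        · simp only [Finset.card_powerset, hU, Finset.prod_const, Finset.card_univ, Fintype.card_fin]
          norm_num
        · rw [Fintype.mem_piFinset]
          intro j
          fin_cases j <;> simp [hxU])
    have h2 : cnt (fun T : V → Finset V => (∀ v, T v ⊆ if v ∈ A then ∅ else U) ∧ K ((A, B), x) T) ≤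
        (63/64) ^ t * 2 ^ (3 * Aᶜ.card) := by
      refine (cnt_mono ?_).trans (h1.trans (by rw [prod_ite_pow, Fintype.card_fin]))
      rintro T ⟨h3, h4⟩
      exact ⟨h3, fun i => h4 c ⟨hc, hadj⟩ i⟩
    have h3 : (2:ℝ) ^ (3 * Aᶜ.card) ≤ 2 ^ (3 * ((1/2 + 4 * ζ) * n)) := by
      rw [← Real.rpow_natCast]
      apply Real.rpow_le_rpow_of_exponent_le (by norm_num)
      have := hAB.le_cardA
      rw [Finset.card_compl, Nat.cast_mul, Nat.cast_sub (Finset.card_le_univ _)]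
      push_cast
      linarith
    have h4 : (63/64:ℝ) ^ t ≤ 2 ^ (-(1:ℝ)/45 * (β * n)) := by
      calc (63/64:ℝ) ^ t ≤ ((2:ℝ) ^ (-(1:ℝ)/45)) ^ t := by gcongr
        _ = 2 ^ (-(1:ℝ)/45 * t) := by rw [← Real.rpow_natCast, ← Real.rpow_mul (by norm_num)]
        _ ≤ _ := by
          apply Real.rpow_le_rpow_of_exponent_le (by norm_num)
          linarith
    have h5 := h2.trans (mul_le_mul h4 h3 (by positivity) (by positivity))
    gcongr
    · exact cnt_nonneg _
    · exact cnt_nonneg _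
  · have e1 : cnt (fun q : (Finset V × Finset V) × (Fin 3 → V) =>
        Str G₀ (2 * ζ) l q.1.1 q.1.2 ∧ ((∀ j, q.2 j ∈ U) ∧ ∃ c, CW q.1.2 c)) ≤
        (2:ℝ) ^ (3 * κ * n) * (2:ℝ) ^ (3 * (κ * n)) := by
      refine (cnt_mono (Q := fun q => Str G₀ (2 * ζ) l q.1.1 q.1.2 ∧ True) fun q h => ⟨h.1, trivial⟩).trans ?_
      rw [cnt_prod (fun p : Finset V × Finset V => Str G₀ (2 * ζ) l p.1 p.2) (fun _ : Fin 3 → V => True)]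
      gcongr
      · exact cnt_nonneg _
      · exact hL.cnt_str hP G₀
      · rw [cnt_true, Fintype.card_fun, Fintype.card_fin, mul_comm, Real.rpow_mul (by norm_num),
          show ((3:ℝ)) = ((3:ℕ):ℝ) by norm_num, Real.rpow_natCast]
        push_cast
        gcongr
        have hn2 := hL.n_pos
        have hn0 : 0 < n := by
          have : 2 ≤ n := by exact_mod_cast hn2
          omega
        calc (n:ℝ) = 2 ^ Real.logb 2 n := (rpow_lg hn0).symm
          _ ≤ _ := by
            apply Real.rpow_le_rpow_of_exponent_le (by norm_num)
            linarith [hL.lg]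
    calc _ ≤ ((2:ℝ) ^ (3 * κ * n) * (2:ℝ) ^ (3 * (κ * n))) * (((2:ℝ) ^ (2 * κ * n)) ^ 3 *
          ((2:ℝ) ^ (-(1:ℝ)/45 * (β * n)) * 2 ^ (3 * ((1/2 + 4 * ζ) * n)))) := by
          gcongr
      _ ≤ _ := by
        rw [← Real.rpow_natCast, ← Real.rpow_mul (by norm_num), ← Real.rpow_add (by norm_num),
          ← Real.rpow_add (by norm_num), ← Real.rpow_add (by norm_num), ← Real.rpow_add (by norm_num)]
        apply Real.rpow_le_rpow_of_exponent_le (by norm_num)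
        have h1 : ζ * n ≤ κ * n := by gcongr; exact hP.ζ_le_κ
        have h2 : κ * n ≤ β / 2000 * n := by gcongr
        have h3 : 0 ≤ β * n := by positivity
        push_cast
        linarith

section structure_final
variable {V : Type}

theorem PFree.hom_of_compl {G : SimpleGraph V} {X : Set V} (h : PFree G X) (h' : PFree Gᶜ X) :
    G.IsClique X ∨ Gᶜ.IsClique X := by
  by_cases he : ∃ u ∈ X, ∃ v ∈ X, G.Adj u v
  · obtain ⟨u, hu, v, hv, huv⟩ := he
    have key : ∀ w ∈ X, w ≠ u → G.Adj u w := by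
      intro w hw hwu
      by_contra hn
      have hwv : w ≠ v := fun e => hn (e ▸ huv)
      have hvw : G.Adj v w := by
        by_contra hvw
        have := h' hu hw hv (by simp [SimpleGraph.compl_adj, hn, hwu.symm])
          (by rw [SimpleGraph.compl_adj]; exact ⟨hwv, fun e => hvw e.symm⟩) huv.ne
        exact this.2 huv
      exact hn (h hu hv hw huv hvw hwu.symm)
    left
    intro a ha b hb hab
    rcases eq_or_ne a u with rfl | hau
    · exact key b hb hab.symm
    rcases eq_or_ne b u with rfl | hbu
    · exact (key a ha hau).symm
    exact h ha hu hb (key a ha hau).symm (key b hb hbu) hab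
  · right
    intro a ha b hb hab
    exact ⟨hab, fun h => he ⟨a, ha, b, hb, h⟩⟩

variable [Fintype V]

/-- No induced three-vertex path trivial to `A` sees a `t`-matching in `B`. -/
def NoP3Matching (G : SimpleGraph V) (A B : Finset V) (d t : ℕ) : Prop :=
  ∀ x : Fin 3 → V, IsP3 G x → (∀ j, TrivTo G d A (x j)) →
      ∀ c : Fin t → Fin 2 → V, Pairs c (B \ Finset.univ.image x) → ¬ ∀ i, G.Adj (c i 0) (c i 1)

theorem NoP3Matching.pFree_or_cov {G : SimpleGraph V} {A B : Finset V} {d t : ℕ}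
    (h : NoP3Matching G A B d t) {X : Set V} (hX : ∀ v ∈ X, TrivTo G d A v) :
    PFree G X ∨ Cov B (2 * t + 3) G.Adj := by
  by_cases hp : PFree G X
  · exact Or.inl hp
  right
  have : ∃ x : Fin 3 → V, (∀ i, x i ∈ X) ∧ IsP3 G x := by
    by_contra hcon
    push Not at hcon
    exact hp (pFree_of_no_isP3 hcon)
  obtain ⟨x, hxX, hx⟩ := this
  rcases pairs_or_cov (B \ Finset.univ.image x) t G.Adj with ⟨c, hc, hadj⟩ | ⟨R, hR, hcov⟩
  · exact absurd hadj (h x hx (fun j => hX _ (hxX j)) c hc)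
  · refine ⟨R ∪ Finset.univ.image x, (Finset.card_union_le _ _).trans (Nat.add_le_add hR ?_), ?_⟩
    · exact Finset.card_image_le.trans (by simp)
    · intro a ha haR b hb hbR hab
      rw [Finset.mem_union, not_or] at haR hbR
      exact hcov a (Finset.mem_sdiff.2 ⟨ha, haR.2⟩) haR.1 b (Finset.mem_sdiff.2 ⟨hb, hbR.2⟩) hbR.1 hab

/-- Both parts of a partition into two clean sets are almost homogeneous. -/
def Degen (G : SimpleGraph V) (γ : ℝ) : Prop :=
  ∃ X R S : Finset V, Clean G ↑X ∧ Clean G ↑Xᶜ ∧ (R.card : ℝ) ≤ γ * Fintype.card V ∧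
    (S.card : ℝ) ≤ γ * Fintype.card V ∧ Hom G (X \ R) ∧ Hom G (Xᶜ \ S)

theorem Cov.not_both {G : SimpleGraph V} {B : Finset V} {m : ℕ} (h1 : Cov B m G.Adj)
    (h2 : Cov B m Gᶜ.Adj) (hB : 2 * m + 2 ≤ B.card) : False := by
  obtain ⟨R, hR, h1⟩ := h1
  obtain ⟨S, hS, h2⟩ := h2
  have hc : 1 < (B \ (R ∪ S)).card := by
    have := Finset.le_card_sdiff (R ∪ S) B
    have := Finset.card_union_le R S
    omega
  obtain ⟨a, ha, b, hb, hab⟩ := Finset.one_lt_card.1 hc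
  simp only [Finset.mem_sdiff, Finset.mem_union, not_or] at ha hb
  have h3 := h1 a ha.1 ha.2.1 b hb.1 hb.2.1 hab
  exact h2 a ha.1 ha.2.2 b hb.1 hb.2.2 hab ⟨hab, h3⟩

theorem Cov.hom {G : SimpleGraph V} {B : Finset V} {m : ℕ} (h : Cov B m G.Adj) :
    ∃ R : Finset V, R.card ≤ m ∧ Hom G (B \ R) := by
  obtain ⟨R, hR, h⟩ := h
  refine ⟨R, hR, Or.inr fun a ha b hb hab => ⟨hab, ?_⟩⟩
  simp only [Finset.coe_sdiff, Set.mem_sdiff, Finset.mem_coe] at ha hb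
  exact h a ha.1 ha.2 b hb.1 hb.2 hab

theorem Cov.not_of_isClique {G : SimpleGraph V} {B : Finset V} {m : ℕ} (h : Cov B m G.Adj)
    (hB : 2 * m + 2 ≤ B.card) (hcl : G.IsClique ↑B) : False := by
  refine h.not_both ⟨∅, by simp, fun a ha _ b hb _ hab h => ?_⟩ hB
  exact h.2 (hcl ha hb hab)

/-- The four alternatives for one side. -/
structure SideAlt (G : SimpleGraph V) (X : Set V) (B : Finset V) (m : ℕ) : Prop where
  pos : PFree G X ∨ Cov B m G.Adj
  neg : PFree Gᶜ X ∨ Cov B m Gᶜ.Adj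
  card : 2 * m + 2 ≤ B.card

theorem SideAlt.clean {G : SimpleGraph V} {X : Set V} {B : Finset V} {m : ℕ} (h : SideAlt G X B m) :
    Clean G X := by
  rcases h.pos with h1 | h1
  · exact Or.inl h1
  · rcases h.neg with h2 | h2
    · exact Or.inr h2
    · exact (h1.not_both h2 h.card).elim

theorem SideAlt.hom {G : SimpleGraph V} {X : Set V} {B : Finset V} {m : ℕ} (h : SideAlt G X B m)
    (hX : ¬ (PFree G X ∧ PFree Gᶜ X)) : ∃ R : Finset V, R.card ≤ m ∧ Hom G (B \ R) := by
  rcases h.pos with h1 | h1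
  · rcases h.neg with h2 | h2
    · exact absurd ⟨h1, h2⟩ hX
    · obtain ⟨R, hR, h3⟩ := h2.hom
      have := h3.compl
      rw [_root_.compl_compl] at this
      exact ⟨R, hR, this⟩
  · exact h1.hom

theorem isGenSplit_of_sideAlt {G : SimpleGraph V} {X : Set V} {A : Finset V} {m : ℕ}
    (hAX : ↑A ⊆ X) (h : SideAlt G Xᶜ A m) (hX : PFree G X ∧ PFree Gᶜ X) : IsGenSplit G := by
  rcases hX.1.hom_of_compl hX.2 with hc | hc
  · left
    refine ⟨X, isUnipolarArrangement_iff.2 ⟨hc, ?_⟩⟩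
    rcases h.pos with h1 | h1
    · exact h1
    · exact (h1.not_of_isClique h.card (hc.subset hAX)).elim
  · right
    refine ⟨X, isUnipolarArrangement_iff.2 ⟨hc, ?_⟩⟩
    rcases h.neg with h1 | h1
    · exact h1
    · exact (h1.not_of_isClique h.card (hc.subset hAX)).elim

theorem isGenSplit_or_degen {G : SimpleGraph V} {X : Finset V} {A B : Finset V} {m : ℕ} {ζ γ : ℝ}
    (hAX : A ⊆ X) (hBX : B ⊆ Xᶜ) (hX : SideAlt G ↑X B m) (hX' : SideAlt G ↑Xᶜ A m)
    (hrest : ((A ∪ B)ᶜ.card : ℝ) ≤ ζ * Fintype.card V)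
    (hγ : m + ζ * Fintype.card V ≤ γ * Fintype.card V) : IsGenSplit G ∨ Degen G γ := by
  have hcc : ((X : Set V))ᶜ = ↑(Xᶜ) := by simp
  by_cases h1 : PFree G (X : Set V) ∧ PFree Gᶜ (X : Set V)
  · left
    refine isGenSplit_of_sideAlt (A := A) (m := m) (by exact_mod_cast hAX) ?_ h1
    rwa [hcc]
  by_cases h2 : PFree G (↑Xᶜ : Set V) ∧ PFree Gᶜ (↑Xᶜ : Set V)
  · left
    refine isGenSplit_of_sideAlt (A := B) (m := m) (by exact_mod_cast hBX) ?_ h2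
    rwa [← hcc, _root_.compl_compl]
  right
  obtain ⟨R, hR, hRh⟩ := hX'.hom h2
  obtain ⟨S, hS, hSh⟩ := hX.hom h1
  have key : ∀ T : Finset V, T.card ≤ m → ((T ∪ (A ∪ B)ᶜ).card : ℝ) ≤ γ * Fintype.card V := by
    intro T hT
    have h3 : ((T ∪ (A ∪ B)ᶜ).card : ℝ) ≤ T.card + (A ∪ B)ᶜ.card := by
      exact_mod_cast Finset.card_union_le _ _
    have h4 : (T.card : ℝ) ≤ m := by exact_mod_cast hT
    linarith
  refine ⟨X, R ∪ (A ∪ B)ᶜ, S ∪ (A ∪ B)ᶜ, hX.clean, hX'.clean, key R hR, key S hS,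
    hRh.mono ?_, hSh.mono ?_⟩
  · intro v hv
    have := @hBX v
    simp only [Finset.mem_sdiff, Finset.mem_union, Finset.mem_compl] at hv this ⊢
    tauto
  · intro v hv
    have := @hAX v
    simp only [Finset.mem_sdiff, Finset.mem_union, Finset.mem_compl] at hv this ⊢
    tauto
end structure_final

theorem aa_isGenSplit_or_degen : AA (fun V _ G => IsGenSplit G ∨ Degen G (1/20)) := by
  obtain ⟨μ, ζ, lam, hP, -⟩ := exists_params (κ := 1/200000) (by norm_num)
  have h1 := aa_str hP.lam_pos (hP.lam_le.trans (by linarith [hP.μ_le])) hP.ζ_pos hP.ζ_le_lam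
  have h2 := aa_not_trivTo_both hP (by norm_num)
  have h3 := aa_no_p3_with_matching hP (β := 1/100) (by norm_num) (by norm_num)
  obtain ⟨n₀, hn₀⟩ := (hP.large.and (eventually_ge_real 10000)).exists_forall_of_atTop
  refine (((h1.and h2).and h3).and h3.compl).mono n₀ ?_
  rintro V _ hn G hF ⟨⟨⟨⟨A, B, hAB⟩, hnb⟩, hm⟩, hmc⟩
  obtain ⟨hL, hn'⟩ := hn₀ _ hn
  set n := Fintype.card V with hndef
  set l := ⌈lam * n⌉₊ with hl
  set d := ⌊μ * n⌋₊ with hd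
  set t := ⌈(1/100 : ℝ) * n⌉₊ with ht
  have htr := hL.triv
  have htt : (t : ℝ) ≤ n / 100 + 1 := by
    have := Nat.ceil_lt_add_one (a := (1/100:ℝ) * n) (by positivity)
    linarith
  have hζn : ζ * n ≤ 1/200000 * n := by
    gcongr
    exact hP.ζ_le_κ
  have hcard : ∀ A B, Str G ζ l A B → 2 * (2 * t + 3) + 2 ≤ A.card := by
    intro A B h
    have h1 := h.le_cardA
    have : ((2 * (2 * t + 3) + 2 : ℕ) : ℝ) ≤ A.card := by
      push_cast
      linarith
    exact_mod_cast this
  have side : ∀ A B, Str G ζ l A B → ∀ X : Set V, (∀ v ∈ X, TrivTo G (4 * l + 5) A v) →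
      SideAlt G X B (2 * t + 3) := by
    intro A B h X hX
    refine ⟨NoP3Matching.pFree_or_cov (fun x => hm A B h x) fun v hv => (hX v hv).mono (by omega),
      NoP3Matching.pFree_or_cov (fun x => hmc A B h.compl x) fun v hv => (hX v hv).compl.mono (by omega),
      hcard _ _ h.symm⟩
  have tor := trivTo_or_trivTo hF.noC5 hAB.cleanA hAB.cleanB hAB.rich le_rfl
  set X : Finset V := Finset.univ.filter fun v => TrivTo G (4 * l + 5) A v with hX
  have hXm : ∀ v, v ∈ X ↔ TrivTo G (4 * l + 5) A v := by simp [hX]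
  refine isGenSplit_or_degen (A := A) (B := B) (m := 2 * t + 3) (X := X) ?_ ?_ ?_ ?_ hAB.rest ?_
  · intro v hv
    rw [hXm]
    exact (trivTo_of_clean hAB.cleanA hv).mono (by omega)
  · intro v hv
    rw [Finset.mem_compl, hXm]
    intro h
    exact hnb A B hAB v ⟨h.mono (by omega), (trivTo_of_clean hAB.cleanB hv).mono (by omega)⟩
  · exact side A B hAB _ fun v hv => (hXm v).1 (by exact_mod_cast hv)
  · refine side B A hAB.symm _ fun v hv => ?_
    have hv' : v ∉ X := by simpa using hv
    exact (tor v).resolve_left fun h => hv' ((hXm v).2 h)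
  · push_cast
    linarith

section degen
variable {V : Type} [Fintype V]

/-- Codes that are constant, or the identity, off a small set. -/
def TameCode (R : Finset V) (q : (V → V) × Bool) : Prop :=
  ∃ o : Option V, ∀ v, v ∉ R → q.1 v = o.getD v

theorem cnt_tameCode (R : Finset V) : cnt (TameCode R) ≤
    (Fintype.card V + 1 : ℝ) * (2 * (Fintype.card V : ℝ) ^ R.card) := by
  have h1 : ∀ o : Option V, True → cnt (fun q : (V → V) × Bool => ∀ v, v ∉ R → q.1 v = o.getD v) ≤
      2 * (Fintype.card V : ℝ) ^ R.card := by
    intro o _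
    have h2 : cnt (fun f : V → V => ∀ v, v ∉ R → f v = o.getD v) ≤ (Fintype.card V : ℝ) ^ R.card := by
      rw [cnt_pi (fun v y => v ∉ R → y = o.getD v)]
      calc _ ≤ ∏ v : V, if v ∈ R then (Fintype.card V : ℝ) else 1 := by
            refine Finset.prod_le_prod (fun _ _ => cnt_nonneg _) fun v _ => ?_
            split_ifs with h
            · exact cnt_le_card _
            · simp only [h, not_false_eq_true, true_imp_iff]
              rw [cnt_eq_card_filter]
              have : (Finset.univ.filter fun y : V => y = o.getD v).card ≤ 1 :=
                Finset.card_le_one.2 fun a ha b hb => by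
                  rw [Finset.mem_filter] at ha hb
                  rw [ha.2, hb.2]
              exact_mod_cast this
        _ = _ := by
            rw [Finset.prod_ite, Finset.prod_const, Finset.prod_const_one, mul_one]
            congr 2
            ext; simp
    have h3 := cnt_prod (fun f : V → V => ∀ v, v ∉ R → f v = o.getD v) (fun _ : Bool => True)
    rw [cnt_true, Fintype.card_bool] at h3
    refine (cnt_mono (Q := fun q : (V → V) × Bool => (∀ v, v ∉ R → q.1 v = o.getD v) ∧ True)
      fun q h => ⟨h, trivial⟩).trans (h3.le.trans ?_)
    push_cast
    linarith
  have := cnt_exists (R := fun _ : Option V => True) h1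
  rw [cnt_true, Fintype.card_option] at this
  push_cast at this
  refine (cnt_mono fun q h => ?_).trans this
  obtain ⟨o, ho⟩ := h
  exact ⟨o, trivial, ho⟩

theorem PFree.exists_tame {G : SimpleGraph V} {X R : Finset V} (h : PFree G ↑X) (hR : Hom G (X \ R)) :
    ∃ f, TameCode R (f, true) ∧ Coded G X (f, true) := by
  set f : V → V := fun v => @Classical.epsilon V ⟨v⟩
    (fun x => x ∈ blk G ↑X v ∧ (x ∈ R → blk G ↑X v ⊆ R)) with hf
  have hmem : ∀ v ∈ X, f v ∈ blk G ↑X v ∧ (f v ∈ R → blk G ↑X v ⊆ R) := by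
    intro v hv
    have hvb : v ∈ blk G ↑X v := by simp [blk, hv]
    refine @Classical.epsilon_spec V (fun x => x ∈ blk G ↑X v ∧ (x ∈ R → blk G ↑X v ⊆ R)) ?_
    by_cases hb : blk G ↑X v ⊆ R
    · exact ⟨v, hvb, fun _ => hb⟩
    · obtain ⟨x, hx, hxR⟩ := Finset.not_subset.1 hb
      exact ⟨x, hx, fun h => absurd h hxR⟩
  have hcoded : Coded G X (f, true) := by
    intro u hu v hv huv
    simp only [iff_true]
    constructor
    · intro hadj
      have : blk G (↑X) u = blk G (↑X) v := blk_eq h hu hv hadj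
      simp only [hf]
      congr 1
      rw [this]
    · intro heq
      have h1 := (hmem u hu).1
      have h2 := (hmem v hv).1
      rw [← heq] at h2
      simp only [blk, Finset.mem_filter, Finset.mem_univ, true_and] at h1 h2
      rcases h1.2 with h3 | h3
      · rcases h2.2 with h4 | h4
        · exact absurd (h3.symm.trans h4) huv
        · rw [h3] at h4; exact h4.symm
      · rcases h2.2 with h4 | h4
        · rw [h4] at h3; exact h3
        · exact h hu h1.1 hv h3 h4.symm huv
  obtain ⟨o, ho⟩ : ∃ o : Option V, ∀ v ∈ X, v ∉ R → f v = o.getD v := by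
    rcases hR with hR | hR
    · by_cases hne : (X \ R).Nonempty
      · obtain ⟨w, hw⟩ := hne
        refine ⟨some (f w), fun v hv hvR => ?_⟩
        rw [Option.getD_some]
        rcases eq_or_ne v w with rfl | hvw
        · rfl
        have hw' := Finset.mem_sdiff.1 hw
        have := (hcoded v hv w hw'.1 hvw).1 (hR (by simp [hv, hvR]) (by simpa using hw') hvw)
        simpa using this
      · exact ⟨none, fun v hv hvR => absurd ⟨v, Finset.mem_sdiff.2 ⟨hv, hvR⟩⟩ hne⟩
    · refine ⟨none, fun v hv hvR => ?_⟩
      rw [Option.getD_none]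
      obtain ⟨h1, h2⟩ := hmem v hv
      have hfR : f v ∉ R := fun h => hvR (h2 h (by simp [blk, hv]))
      simp only [blk, Finset.mem_filter, Finset.mem_univ, true_and] at h1
      rcases h1.2 with h3 | h3
      · exact h3
      · exact absurd h3 (hR (x := v) (y := f v) (by simp [hv, hvR])
          (by simpa using ⟨by simpa using h1.1, hfR⟩) h3.ne).2
  refine ⟨fun v => if v ∈ X then f v else o.getD v, ⟨o, fun v hv => ?_⟩, fun u hu v hv huv => ?_⟩
  · simp only
    split_ifs with hX
    · exact ho v hX hv
    · rfl
  · simpa [hu, hv] using hcoded u hu v hv huv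

theorem Clean.exists_tame {G : SimpleGraph V} {X R : Finset V} (h : Clean G ↑X) (hR : Hom G (X \ R)) :
    ∃ q, TameCode R q ∧ Coded G X q := by
  rcases h with h | h
  · obtain ⟨f, hf⟩ := h.exists_tame hR
    exact ⟨_, hf⟩
  · obtain ⟨f, ⟨o, ho⟩, hf⟩ := h.exists_tame hR.compl
    refine ⟨(f, false), ⟨o, ho⟩, fun u hu v hv huv => ?_⟩
    have := hf u hu v hv huv
    simp only [SimpleGraph.compl_adj, ne_eq, huv, not_false_eq_true, true_and, iff_true] at this
    simp only [Bool.false_eq_true, iff_false]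
    rw [← this, not_not]

theorem cnt_degen_le {γ : ℝ} (hn : 1 ≤ Fintype.card V) : cnt (fun G : SimpleGraph V => Degen G γ) ≤
    (2:ℝ) ^ (3 * (Fintype.card V : ℝ)) * (((2:ℝ) ^ (2 + Real.logb 2 (Fintype.card V) +
      γ * Fintype.card V * Real.logb 2 (Fintype.card V))) ^ 2 * 2 ^ ((Fintype.card V : ℝ) ^ 2 / 4)) := by
  set n := Fintype.card V with hn0
  have hn1 : (1:ℝ) ≤ n := by exact_mod_cast hn
  have hlg : 0 ≤ Real.logb 2 n := Real.logb_nonneg (by norm_num) hn1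
  have htame : ∀ R : Finset V, (R.card : ℝ) ≤ γ * n →
      cnt (TameCode R) ≤ (2:ℝ) ^ (2 + Real.logb 2 n + γ * n * Real.logb 2 n) := by
    intro R hR
    refine (cnt_tameCode R).trans ?_
    rw [← hn0]
    calc ((n:ℝ) + 1) * (2 * (n:ℝ) ^ R.card) ≤ (2 * n) * (2 * (n:ℝ) ^ (γ * n)) := by
          gcongr
          · linarith
          · rw [← Real.rpow_natCast]
            exact Real.rpow_le_rpow_of_exponent_le hn1 hR
      _ = (2:ℝ) ^ (2:ℝ) * n * (n:ℝ) ^ (γ * n) := by norm_num; ring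
      _ = _ := by
          rw [Real.rpow_add (by norm_num), Real.rpow_add (by norm_num), rpow_lg (by omega),
            mul_comm (γ * n), Real.rpow_mul (x := 2) (by norm_num) (Real.logb 2 n) (γ * n),
            rpow_lg (by omega)]
  have hM : ∀ p : (Finset V × Finset V) × Finset V,
      ((p.1.2.card : ℝ) ≤ γ * n ∧ (p.2.card : ℝ) ≤ γ * n) →
      cnt (fun G : SimpleGraph V => (∃ q, TameCode p.1.2 q ∧ Coded G p.1.1 q) ∧
        (∃ q, TameCode p.2 q ∧ Coded G p.1.1ᶜ q) ∧ True) ≤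
      ((2:ℝ) ^ (2 + Real.logb 2 n + γ * n * Real.logb 2 n)) ^ 2 * 2 ^ ((n : ℝ) ^ 2 / 4) := by
    rintro ⟨⟨X, R⟩, S⟩ ⟨hR, hS⟩
    have h1 := cnt_split (V := V) X Xᶜ ∅ (fun v _ => by simpa using em (v ∈ X)) (TameCode R) (TameCode S)
      (fun _ => True)
    refine h1.trans ?_
    simp only [Finset.card_empty, zero_mul, pow_zero, one_mul, and_true]
    have h2 := cnt_bip X Xᶜ
    have h3 : (2:ℝ) ^ (X.card * Xᶜ.card) ≤ 2 ^ ((n : ℝ) ^ 2 / 4) := by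
      rw [← Real.rpow_natCast]
      apply Real.rpow_le_rpow_of_exponent_le (by norm_num)
      exact card_mul_card_le disjoint_compl_right
    have h4 := htame R hR
    have h5 := htame S hS
    rw [pow_two]
    refine mul_le_mul (mul_le_mul h4 h5 (cnt_nonneg _) (by positivity)) (h2.trans h3) (cnt_nonneg _)
      (by positivity)
  refine (cnt_mono ?_).trans ((cnt_exists hM).trans ?_)
  · rintro G ⟨X, R, S, h1, h2, h3, h4, h5, h6⟩
    exact ⟨((X, R), S), ⟨h3, h4⟩, h1.exists_tame h5,
      Clean.exists_tame (by simpa using h2) h6, trivial⟩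
  · gcongr
    refine (cnt_le_card _).trans (le_of_eq ?_)
    rw [Fintype.card_prod, Fintype.card_prod, Fintype.card_finset, ← hn0,
      show 3 * (n:ℝ) = ((3 * n : ℕ) : ℝ) by push_cast; ring, Real.rpow_natCast, pow_mul]
    push_cast
    rw [← mul_pow, ← mul_pow]
    norm_num
end degen

theorem aa_not_degen : AA (fun V _ G => ¬ Degen G (1/20)) := by
  obtain ⟨n₀, hn₀⟩ := ((nU_ge_eventually.and (poly_le_exp 2 0 (c := 1) (by norm_num))).and
    ((eventually_ge_real 10).and (lg_tendsto.eventually_ge_atTop 60))).exists_forall_of_atTop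
  refine AA.of_total (c := 1) (by norm_num) n₀ fun V _ hn => ?_
  obtain ⟨⟨h1, h2⟩, h3, h4⟩ := hn₀ _ hn
  refine (cnt_mono (Q := fun G => Degen G (1/20)) fun G h => not_not.1 h.2).trans ?_
  have hn1 : 1 ≤ Fintype.card V := by
    have : (1:ℝ) ≤ Fintype.card V := by linarith
    exact_mod_cast this
  refine (cnt_degen_le hn1).trans ?_
  set n := Fintype.card V
  refine le_trans ?_ (mul_le_mul_of_nonneg_left h1 (by positivity))
  rw [← Real.rpow_natCast, ← Real.rpow_mul (by norm_num), ← Real.rpow_add (by norm_num),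
    ← Real.rpow_add (by norm_num), ← Real.rpow_add (by norm_num)]
  apply Real.rpow_le_rpow_of_exponent_le (by norm_num)
  push_cast at h2 ⊢
  have h5 : (n:ℝ) * 60 ≤ n * Real.logb 2 n := by gcongr
  nlinarith

theorem aa_isGenSplit : AA (fun V _ G => IsGenSplit G) := by
  refine (aa_isGenSplit_or_degen.and aa_not_degen).mono 0 ?_
  rintro V _ _ G _ ⟨h1, h2⟩
  exact h1.resolve_right h2

theorem cnt_isCoUnipolar {V : Type} [Fintype V] :
    cnt (fun G : SimpleGraph V => IsCoUnipolar G) = nU (Fintype.card V) := by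
  rw [← cnt_isUnipolar]
  exact cnt_equiv (Equiv.ofBijective (fun G : SimpleGraph V => Gᶜ) compl_bijective) fun G => Iff.rfl

theorem exists_nF_le : ∃ Γ : ℝ, 1 ≤ Γ ∧ ∀ n, nF n ≤ Γ * nU n := by
  obtain ⟨c, hc, n₀, h⟩ := aa_isGenSplit
  obtain ⟨n₁, hn₁⟩ := (eventually_ge_real (1/c)).exists_forall_of_atTop
  set N := max n₀ n₁
  set Γ := 4 + ∑ m ∈ Finset.range N, nF m with hΓ
  have hnn : ∀ m, 0 ≤ nF m := fun m => cnt_nonneg _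
  have hΓ4 : 4 ≤ Γ := by
    have := Finset.sum_nonneg fun m (_ : m ∈ Finset.range N) => hnn m
    linarith
  refine ⟨Γ, by linarith, fun n => ?_⟩
  induction n using Nat.strong_induction_on with
  | _ n ih =>
    have hU := nU_pos n
    by_cases hn : n < N
    · have h1 : nF n ≤ ∑ m ∈ Finset.range N, nF m :=
        Finset.single_le_sum (fun m _ => hnn m) (Finset.mem_range.2 hn)
      nlinarith
    · push Not at hn
      have h1 := h (Fin n) (by simpa using (le_max_left _ _).trans hn) Γ (by linarith)
        (by simpa using ih)
      rw [Fintype.card_fin] at h1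
      have h2 := hn₁ n ((le_max_right _ _).trans hn)
      rw [div_le_iff₀ hc] at h2
      have h3 : (2:ℝ) ^ (-(c * n)) ≤ 1/2 := by
        calc (2:ℝ) ^ (-(c * n)) ≤ 2 ^ (-(1:ℝ)) :=
              Real.rpow_le_rpow_of_exponent_le (by norm_num) (by linarith)
          _ = _ := by rw [Real.rpow_neg_one]; norm_num
      have h4 : nF n ≤ (nU n + nU n) + (2:ℝ) ^ (-(c * n)) * (Γ * nU n) := by
        refine (cnt_mono (Q := fun G : SimpleGraph (Fin n) => (IsUnipolar G ∨ IsCoUnipolar G) ∨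
          (InF G ∧ ¬ IsGenSplit G)) fun G hG => ?_).trans ?_
        · by_cases hs : IsGenSplit G
          · exact Or.inl hs
          · exact Or.inr ⟨hG, hs⟩
        · refine (cnt_or _ _).trans (add_le_add ((cnt_or _ _).trans (add_le_add ?_ ?_)) h1)
          · rw [cnt_isUnipolar, Fintype.card_fin]
          · rw [cnt_isCoUnipolar, Fintype.card_fin]
      have h5 : (2:ℝ) ^ (-(c * n)) * (Γ * nU n) ≤ 1/2 * (Γ * nU n) := by gcongr
      nlinarith

/-- Almost all members of the class are generalized split graphs. -/
theorem exists_cnt_not_isGenSplit_le : ∃ c : ℝ, 0 < c ∧ ∃ Γ : ℝ, 1 ≤ Γ ∧ ∃ n₀ : ℕ, ∀ n, n₀ ≤ n →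
    cnt (fun G : SimpleGraph (Fin n) => InF G ∧ ¬ IsGenSplit G) ≤ (2:ℝ) ^ (-(c * n)) * (Γ * nU n) := by
  obtain ⟨c, hc, n₀, h⟩ := aa_isGenSplit
  obtain ⟨Γ, hΓ, hF⟩ := exists_nF_le
  refine ⟨c, hc, Γ, hΓ, n₀, fun n hn => ?_⟩
  have := h (Fin n) (by simpa using hn) Γ hΓ fun m _ => hF m
  rwa [Fintype.card_fin] at this

theorem nU_le_perfectCount (n : ℕ) : nU n ≤ perfectCount n := by
  have h : (perfectCount n : ℝ) = cnt (fun G : SimpleGraph (Fin n) => IsPerfect G) := rfl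
  rw [h]
  exact cnt_mono fun G hG => hG.isPerfect

theorem cnt_exists_sum {α ι : Type*} [Finite α] [Fintype ι] (P : ι → α → Prop) :
    cnt (fun x => ∃ i, P i x) ≤ ∑ i, cnt (P i) := by
  suffices h : ∀ s : Finset ι, cnt (fun x => ∃ i ∈ s, P i x) ≤ ∑ i ∈ s, cnt (P i) by
    simpa using h Finset.univ
  intro s
  induction s using Finset.induction_on with
  | empty =>
    simp only [Finset.notMem_empty, false_and, exists_false, Finset.sum_empty]
    simp [cnt]
  | insert a s ha ih =>
    rw [Finset.sum_insert ha]
    refine (cnt_mono (Q := fun x => P a x ∨ ∃ i ∈ s, P i x) ?_).trans ((cnt_or _ _).trans (by gcongr))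
    rintro x ⟨i, hi, h⟩
    rcases Finset.mem_insert.1 hi with rfl | hi
    · exact Or.inl h
    · exact Or.inr ⟨i, hi, h⟩

section bell
variable {V : Type}

/-- Disjoint unions of cliques, all vertices outside `D` being isolated. -/
structure OnP (D : Finset V) (H : SimpleGraph V) : Prop where
  mem : ∀ ⦃a b⦄, H.Adj a b → a ∈ D
  pFree : PFree H Set.univ

/-- The graph whose cliques are the fibres of `f`. -/
def kerG {D : Finset V} {ι : Type} (f : {x // x ∈ D} → ι) : SimpleGraph V where
  Adj a b := a ≠ b ∧ ∃ ha hb, f ⟨a, ha⟩ = f ⟨b, hb⟩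
  symm := ⟨fun _ _ ⟨h, ha, hb, e⟩ => ⟨h.symm, hb, ha, e.symm⟩⟩
  loopless := ⟨fun _ h => h.1 rfl⟩

theorem kerG_onP {D : Finset V} {ι : Type} (f : {x // x ∈ D} → ι) : OnP D (kerG f) := by
  refine ⟨fun a b h => h.2.1, ?_⟩
  rintro u v w _ _ _ ⟨_, hu, hv, e⟩ ⟨_, hv', hw, e'⟩ huw
  exact ⟨huw, hu, hw, e.trans e'⟩

theorem kerG_adj_iff {D : Finset V} {ι : Type} (f : {x // x ∈ D} → ι) (a b : {x // x ∈ D}) :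
    ((kerG f).Adj a b ∨ a = b) ↔ f a = f b := by
  constructor
  · rintro (⟨_, _, _, h⟩ | rfl)
    · exact h
    · rfl
  · intro h
    by_cases hab : a = b
    · exact Or.inr hab
    · exact Or.inl ⟨fun e => hab (Subtype.ext e), a.2, b.2, h⟩

theorem OnP.exists_kerG {D : Finset V} {H : SimpleGraph V} (h : OnP D H) :
    ∃ j ≤ D.card, ∃ f : {x // x ∈ D} → Fin j, Function.Surjective f ∧ kerG f = H := by
  let r : Setoid {x // x ∈ D} := ⟨fun a b => a = b ∨ H.Adj a b, by
    refine ⟨fun a => Or.inl rfl, fun h => h.imp Eq.symm fun h => h.symm, ?_⟩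
    rintro a b c (rfl | h1) h2
    · exact h2
    rcases h2 with rfl | h2
    · exact Or.inr h1
    by_cases hac : a = c
    · exact Or.inl hac
    · exact Or.inr (h.pFree trivial trivial trivial h1 h2 fun e => hac (Subtype.ext e))⟩
  have : Fintype (Quotient r) := Fintype.ofFinite _
  refine ⟨Fintype.card (Quotient r), ?_, fun a => Fintype.equivFin _ (Quotient.mk r a), ?_, ?_⟩
  · have := Fintype.card_le_of_surjective (Quotient.mk r) Quotient.mk_surjective
    rwa [Fintype.card_coe] at this
  · exact (Fintype.equivFin _).surjective.comp Quotient.mk_surjective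
  · ext a b
    constructor
    · rintro ⟨hab, ha, hb, e⟩
      have e' := Quotient.exact ((Fintype.equivFin _).injective e)
      rcases e' with e' | e'
      · exact absurd (congrArg Subtype.val e') hab
      · exact e'
    · intro hab
      refine ⟨hab.ne, h.mem hab, h.mem hab.symm, ?_⟩
      exact congrArg (Fintype.equivFin (Quotient r))
        (Quotient.sound (s := r) (a := ⟨a, h.mem hab⟩) (b := ⟨b, h.mem hab.symm⟩) (Or.inr hab))

variable [Fintype V]

theorem cnt_kerG_surjective (D : Finset V) (j : ℕ) :
    cnt (fun H : SimpleGraph V => ∃ f : {x // x ∈ D} → Fin j, Function.Surjective f ∧ kerG f = H) *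
      (Nat.factorial j : ℝ) ≤ (j:ℝ) ^ D.card := by
  have h := cnt_fiber_ge (P := fun _ : {x // x ∈ D} → Fin j => True)
    (Q := fun H : SimpleGraph V => ∃ f : {x // x ∈ D} → Fin j, Function.Surjective f ∧ kerG f = H)
    (fun f => kerG f) (M := (Nat.factorial j : ℝ)) (by
      rintro H ⟨f, hf, rfl⟩
      have h1 : (Nat.factorial j : ℝ) = cnt (fun _ : Equiv.Perm (Fin j) => True) := by
        rw [cnt_true, Fintype.card_perm, Fintype.card_fin]
      rw [h1]
      refine cnt_inj (fun σ => σ ∘ f) (fun σ _ => ⟨trivial, ?_⟩) fun σ τ _ _ e => ?_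
      · ext a b
        simp [kerG]
      · ext i
        obtain ⟨a, rfl⟩ := hf i
        exact congrArg Fin.val (congrFun e a))
  rw [cnt_true, Fintype.card_fun, Fintype.card_fin, Fintype.card_coe] at h
  exact_mod_cast h

theorem cnt_onP_le (D : Finset V) {x : ℝ} (hx : 0 < x) :
    cnt (OnP D) ≤ (Nat.factorial D.card : ℝ) / x ^ D.card * Real.exp (Real.exp x) := by
  set m := D.card
  have h1 : cnt (OnP D) ≤ ∑ j : Fin (m + 1), cnt (fun H : SimpleGraph V =>
      ∃ f : {x // x ∈ D} → Fin j, Function.Surjective f ∧ kerG f = H) := by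
    refine (cnt_mono fun H hH => ?_).trans (cnt_exists_sum _)
    obtain ⟨j, hj, hf⟩ := hH.exists_kerG
    exact ⟨⟨j, by omega⟩, hf⟩
  have h2 : ∀ j : ℕ, cnt (fun H : SimpleGraph V =>
      ∃ f : {x // x ∈ D} → Fin j, Function.Surjective f ∧ kerG f = H) ≤
      (Nat.factorial m : ℝ) / x ^ m * (Real.exp x ^ j / Nat.factorial j) := by
    intro j
    have hj : (0:ℝ) < Nat.factorial j := by exact_mod_cast Nat.factorial_pos j
    have hm : (0:ℝ) < Nat.factorial m := by exact_mod_cast Nat.factorial_pos m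
    have h3 := cnt_kerG_surjective D j
    have h4 : (j * x) ^ m / Nat.factorial m ≤ Real.exp (j * x) :=
      Real.pow_div_factorial_le_exp _ (by positivity) _
    rw [div_le_iff₀ hm, mul_pow, Real.exp_nat_mul] at h4
    rw [← le_div_iff₀ hj] at h3
    refine h3.trans ?_
    rw [← mul_div_assoc]
    gcongr
    rw [div_mul_eq_mul_div, le_div_iff₀ (by positivity), mul_comm (Nat.factorial m : ℝ)]
    exact h4
  refine h1.trans ((Finset.sum_le_sum fun (j : Fin (m + 1)) _ => h2 (j : ℕ)).trans ?_)
  rw [← Finset.mul_sum, Fin.sum_univ_eq_sum_range (fun j => Real.exp x ^ j / (Nat.factorial j : ℝ))]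
  gcongr
  exact Real.sum_le_exp_of_nonneg (by positivity) _

theorem pow_le_cnt_onP (D : Finset V) (j : ℕ) : (j:ℝ) ^ D.card ≤ cnt (OnP D) * Nat.factorial j := by
  have h := cnt_fiber (P := fun _ : {x // x ∈ D} → Fin j => True) (Q := OnP D) (fun f => kerG f)
    (M := (Nat.factorial j : ℝ)) (fun f _ => kerG_onP f) (by
      intro H _
      by_cases hf : ∃ f : {x // x ∈ D} → Fin j, kerG f = H
      · obtain ⟨f, rfl⟩ := hf
        have h1 : (Nat.factorial j : ℝ) = cnt (fun _ : Equiv.Perm (Fin j) => True) := by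
          rw [cnt_true, Fintype.card_perm, Fintype.card_fin]
        rw [h1]
        have hσ : ∀ g : {x // x ∈ D} → Fin j, kerG g = kerG f → ∃ σ : Equiv.Perm (Fin j), g = σ ∘ f := by
          intro g hg
          have hfg : ∀ a b, f a = f b ↔ g a = g b := by
            intro a b
            rw [← kerG_adj_iff f, ← kerG_adj_iff g, hg]
          let φ : {i // i ∈ Set.range f} → {i // i ∈ Set.range g} :=
            fun i => ⟨g i.2.choose, ⟨_, rfl⟩⟩
          have hφ : ∀ a, φ ⟨f a, ⟨a, rfl⟩⟩ = ⟨g a, ⟨a, rfl⟩⟩ := by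
            intro a
            apply Subtype.ext
            exact (hfg _ _).1 (Set.mem_range_self (f := f) a).choose_spec
          have hbij : Function.Bijective φ := by
            constructor
            · rintro ⟨_, a, rfl⟩ ⟨_, b, rfl⟩ e
              rw [hφ, hφ] at e
              exact Subtype.ext ((hfg a b).2 (congrArg Subtype.val e))
            · rintro ⟨_, a, rfl⟩
              exact ⟨_, hφ a⟩
          refine ⟨(Equiv.ofBijective φ hbij).extendSubtype, funext fun a => ?_⟩
          have := Equiv.extendSubtype_apply_of_mem (Equiv.ofBijective φ hbij) (f a) ⟨a, rfl⟩
          rw [Function.comp_apply, this, Equiv.ofBijective_apply, hφ]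
        refine cnt_inj (fun g => if hg : kerG g = kerG f then (hσ g hg).choose else 1)
          (fun _ _ => trivial) ?_
        rintro g g' ⟨_, hg⟩ ⟨_, hg'⟩ e
        simp only [hg, hg', dif_pos] at e
        rw [(hσ g hg).choose_spec, (hσ g' hg').choose_spec, e]
      · rw [show (fun f : {x // x ∈ D} → Fin j => True ∧ kerG f = H) = fun _ => False from by
          funext f; simp only [true_and, eq_iff_iff, iff_false]; exact fun h => hf ⟨f, h⟩]
        simp [cnt])
  rw [cnt_true, Fintype.card_fun, Fintype.card_fin, Fintype.card_coe] at h
  exact_mod_cast h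
end bell

theorem factorial_le_exp (m : ℕ) (hm : 1 ≤ m) :
    (Nat.factorial m : ℝ) ≤ Real.exp 1 * m * (m:ℝ) ^ m / Real.exp m := by
  rw [le_div_iff₀ (Real.exp_pos _)]
  induction m, hm using Nat.le_induction with
  | base => simp
  | succ m hm ih =>
    have hm0 : (0:ℝ) < m := by exact_mod_cast hm
    have h1 : Real.exp 1 * (m:ℝ) ^ (m + 1) ≤ ((m:ℝ) + 1) ^ (m + 1) := by
      have h2 : (m:ℝ) / (m + 1) ≤ Real.exp (-(1 / (m + 1))) := by
        have := Real.add_one_le_exp (-(1 / ((m:ℝ) + 1)))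
        refine le_trans (le_of_eq ?_) this
        field_simp
        ring
      have h3 := pow_le_pow_left₀ (by positivity) h2 (m + 1)
      rw [← Real.exp_nat_mul, div_pow, div_le_iff₀ (by positivity)] at h3
      have h4 : ((m + 1 : ℕ) : ℝ) * -(1 / (m + 1)) = -1 := by
        push_cast; field_simp
      rw [h4] at h3
      calc Real.exp 1 * (m:ℝ) ^ (m + 1) ≤ Real.exp 1 * (Real.exp (-1) * ((m:ℝ) + 1) ^ (m + 1)) := by
            gcongr
        _ = _ := by rw [← mul_assoc, ← Real.exp_add]; simp
    rw [Nat.factorial_succ]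
    push_cast
    rw [Real.exp_add]
    calc ((m:ℝ) + 1) * Nat.factorial m * (Real.exp m * Real.exp 1)
        = (m + 1) * Real.exp 1 * (Nat.factorial m * Real.exp m) := by ring
      _ ≤ (m + 1) * Real.exp 1 * (Real.exp 1 * m * (m:ℝ) ^ m) := by gcongr
      _ = Real.exp 1 * (m + 1) * (Real.exp 1 * (m:ℝ) ^ (m + 1)) := by ring
      _ ≤ Real.exp 1 * (m + 1) * ((m:ℝ) + 1) ^ (m + 1) := by gcongr

theorem exists_saddle {m : ℕ} (hm : 20 ≤ m) : ∃ x : ℝ, 2 ≤ x ∧ x * Real.exp x = m ∧ x ≤ Real.log m := by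
  have hm' : (20:ℝ) ≤ m := by exact_mod_cast hm
  have h1 : (2:ℝ) * Real.exp 2 ≤ m := by
    have : Real.exp 2 = Real.exp 1 ^ 2 := by rw [← Real.exp_nat_mul]; norm_num
    rw [this]
    nlinarith [Real.exp_one_lt_d9, Real.exp_pos 1]
  have h2 : (m:ℝ) ≤ m * Real.exp m := by
    have := Real.add_one_le_exp (m:ℝ)
    nlinarith
  obtain ⟨x, hx, hxe⟩ := intermediate_value_Icc (show (2:ℝ) ≤ m by linarith)
    (f := fun x => x * Real.exp x) (by fun_prop) ⟨h1, h2⟩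
  refine ⟨x, hx.1, hxe, ?_⟩
  rw [Real.le_log_iff_exp_le (by linarith), ← hxe]
  have := Real.exp_pos x
  simp only
  nlinarith [hx.1]

theorem bell_ratio {V : Type} [Fintype V] {D : Finset V} (hm : 20 ≤ D.card) {x : ℝ} (hx : 2 ≤ x)
    (hxe : x * Real.exp x = D.card) :
    (Nat.factorial D.card : ℝ) / x ^ D.card * Real.exp (Real.exp x) ≤
      Real.exp 2 * (D.card : ℝ) ^ 3 * cnt (OnP D) := by
  set m := D.card
  set y := Real.exp x with hy
  have hm' : (20:ℝ) ≤ m := by exact_mod_cast hm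
  have hy0 : 0 < y := Real.exp_pos _
  set j := ⌈y⌉₊ with hj
  have hyj : y ≤ j := Nat.le_ceil _
  have hjy : (j:ℝ) ≤ y + 1 := (Nat.ceil_lt_add_one hy0.le).le
  have hj1 : 1 ≤ j := Nat.one_le_iff_ne_zero.2 (by rw [hj]; exact (Nat.ceil_pos.2 hy0).ne')
  have hj0 : (0:ℝ) < j := by exact_mod_cast hj1
  have hym : y ≤ m / 2 := by nlinarith
  have hjm' : (j:ℝ) ≤ m := by linarith
  have hjm : j ≤ m := by exact_mod_cast hjm'
  have hmy : (m:ℝ) / x = y := by rw [← hxe]; field_simp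
  have hfj : (0:ℝ) < Nat.factorial j := by exact_mod_cast Nat.factorial_pos j
  have key : (Nat.factorial m : ℝ) / x ^ m * Real.exp y * Nat.factorial j ≤
      Real.exp 2 * (m : ℝ) ^ 3 * (j:ℝ) ^ m := by
    have e1 : y ^ j ≤ Real.exp m * y := by
      rw [hy, ← Real.exp_nat_mul, ← Real.exp_add]
      apply Real.exp_le_exp.2
      rw [← hxe]
      nlinarith
    calc (Nat.factorial m : ℝ) / x ^ m * Real.exp y * Nat.factorial j
        ≤ (Real.exp 1 * m * (m:ℝ) ^ m / Real.exp m) / x ^ m * Real.exp y *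
          (Real.exp 1 * j * (j:ℝ) ^ j / Real.exp j) := by
          gcongr
          · exact factorial_le_exp m (by omega)
          · exact factorial_le_exp j hj1
      _ ≤ (Real.exp 1 * m * (m:ℝ) ^ m / Real.exp m) / x ^ m * Real.exp j *
          (Real.exp 1 * j * (j:ℝ) ^ j / Real.exp j) := by
          gcongr
      _ = Real.exp 1 * Real.exp 1 * m * j * ((m:ℝ) / x) ^ m * (j:ℝ) ^ j / Real.exp m := by
          rw [div_pow]
          have := Real.exp_pos j
          field_simp
      _ = Real.exp 2 * m * j * (y ^ (m - j) * y ^ j) * (j:ℝ) ^ j / Real.exp m := by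
          rw [← Real.exp_add, hmy, ← pow_add, Nat.sub_add_cancel hjm]; norm_num
      _ ≤ Real.exp 2 * m * m * ((j:ℝ) ^ (m - j) * (Real.exp m * m)) * (j:ℝ) ^ j / Real.exp m := by
          gcongr
          exact e1.trans (by gcongr; linarith)
      _ = Real.exp 2 * (m : ℝ) ^ 3 * ((j:ℝ) ^ (m - j) * (j:ℝ) ^ j) := by
          have := Real.exp_pos m
          field_simp
      _ = _ := by rw [← pow_add, Nat.sub_add_cancel hjm]
  have h2 := pow_le_cnt_onP D j
  refine le_of_mul_le_mul_right (key.trans ?_) hfj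
  rw [mul_assoc (Real.exp 2 * (m:ℝ) ^ 3)]
  gcongr

/-- There are `T` different blocks of size at least `s`. -/
def Big {V : Type} [Fintype V] (s T : ℕ) (H : SimpleGraph V) : Prop :=
  ∃ X : Finset V, X.card = T ∧ (∀ x ∈ X, ∀ y ∈ X, ¬ H.Adj x y) ∧
    ∀ x ∈ X, s ≤ (blk H Set.univ x).card

section big
variable {V : Type} [Fintype V]

theorem mem_blk_univ {H : SimpleGraph V} {v w : V} :
    w ∈ blk H Set.univ v ↔ w = v ∨ H.Adj v w := by
  simp [blk]

/-- `H` with the vertices of `S` isolated. -/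
def isolate (H : SimpleGraph V) (S : Finset V) : SimpleGraph V where
  Adj a b := H.Adj a b ∧ a ∉ S ∧ b ∉ S
  symm := ⟨fun _ _ ⟨h, ha, hb⟩ => ⟨h.symm, hb, ha⟩⟩
  loopless := ⟨fun _ h => h.1.ne rfl⟩

theorem onP_big_reduce {s T : ℕ} (hs : 2 ≤ s) {D : Finset V} {H : SimpleGraph V} (h : OnP D H)
    (hB : Big s (T + 1) H) : ∃ S : Finset V, (S ⊆ D ∧ s ≤ S.card ∧ ∃ v, S = blk H Set.univ v) ∧
      OnP (D \ S) (isolate H S) ∧ Big s T (isolate H S) := by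
  obtain ⟨X, hX, hi, hb⟩ := hB
  obtain ⟨x, hx⟩ : X.Nonempty := Finset.card_pos.1 (by omega)
  refine ⟨blk H Set.univ x, ⟨?_, hb x hx, x, rfl⟩, ⟨?_, ?_⟩, X.erase x, ?_, ?_, ?_⟩
  · have hxD : x ∈ D := by
      obtain ⟨w, hw, hwx⟩ := Finset.exists_mem_ne (show 1 < (blk H Set.univ x).card from by
        have := hb x hx; omega) x
      rcases mem_blk_univ.1 hw with rfl | hw
      · exact absurd rfl hwx
      · exact h.mem hw
    intro w hw
    rcases mem_blk_univ.1 hw with rfl | hw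
    · exact hxD
    · exact h.mem hw.symm
  · rintro a b ⟨h1, h2, _⟩
    exact Finset.mem_sdiff.2 ⟨h.mem h1, h2⟩
  · rintro a b c _ _ _ ⟨h1, h2, _⟩ ⟨h3, _, h4⟩ hac
    exact ⟨h.pFree trivial trivial trivial h1 h3 hac, h2, h4⟩
  · rw [Finset.card_erase_of_mem hx, hX]; rfl
  · intro a ha b hb' hab
    exact hi a (Finset.mem_of_mem_erase ha) b (Finset.mem_of_mem_erase hb') hab.1
  · intro a ha
    have haX := Finset.mem_of_mem_erase ha
    refine (hb a haX).trans (Finset.card_le_card fun w hw => ?_)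
    have hax : a ∉ blk H Set.univ x := by
      rw [mem_blk_univ]
      rintro (e | e)
      · exact Finset.ne_of_mem_erase ha e
      · exact hi x hx a haX e
    rw [mem_blk_univ] at hw ⊢
    refine hw.imp id fun hw => ⟨hw, hax, fun hwx => hax ?_⟩
    rw [mem_blk_univ] at hwx ⊢
    by_cases hxa : a = x
    · exact Or.inl hxa
    · rcases hwx with rfl | hwx
      · exact Or.inr hw.symm
      · exact Or.inr (h.pFree trivial trivial trivial hwx hw.symm (Ne.symm hxa))

theorem cnt_big_step {s T : ℕ} {D : Finset V} (S : Finset V) :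
    cnt (fun H : SimpleGraph V => OnP D H ∧ (∃ v, S = blk H Set.univ v) ∧
      OnP (D \ S) (isolate H S) ∧ Big s T (isolate H S)) ≤
    cnt (fun H : SimpleGraph V => OnP (D \ S) H ∧ Big s T H) := by
  refine cnt_inj (fun H => isolate H S) (fun H h => h.2.2) ?_
  have aux : ∀ H H' : SimpleGraph V, OnP D H → OnP D H' → (∃ v, S = blk H Set.univ v) →
      (∃ v, S = blk H' Set.univ v) → isolate H S = isolate H' S → ∀ a b, H.Adj a b → H'.Adj a b := by
    rintro H H' hH hH' ⟨v, hv⟩ ⟨v', hv'⟩ e a b hab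
    have hcl : ∀ a b, H.Adj a b → a ∈ S → b ∈ S := by
      intro a b hab ha
      rw [hv, mem_blk_univ] at ha ⊢
      by_cases hbv : b = v
      · exact Or.inl hbv
      · rcases ha with rfl | ha
        · exact Or.inr hab
        · exact Or.inr (hH.pFree trivial trivial trivial ha hab (Ne.symm hbv))
    by_cases ha : a ∈ S
    · have hb := hcl a b hab ha
      exact blk_isClique hH'.pFree trivial (by rw [← hv']; exact_mod_cast ha)
        (by rw [← hv']; exact_mod_cast hb) hab.ne
    · have hb : b ∉ S := fun hb => ha (hcl b a hab.symm hb)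
      have : (isolate H S).Adj a b := ⟨hab, ha, hb⟩
      rw [e] at this
      exact this.1
  rintro H H' ⟨hH, hv, _⟩ ⟨hH', hv', _⟩ e
  ext a b
  exact ⟨aux H H' hH hH' hv hv' e a b, aux H' H hH' hH hv' hv e.symm a b⟩

theorem cnt_onP_big_le {s : ℕ} (hs : 2 ≤ s) {x : ℝ} (hx : 0 < x) (T : ℕ) : ∀ D : Finset V,
    cnt (fun H : SimpleGraph V => OnP D H ∧ Big s T H) ≤
      (Nat.factorial D.card : ℝ) / x ^ D.card * Real.exp (Real.exp x) *
        Real.exp (Real.exp 1 * x - s) ^ T := by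
  induction T with
  | zero =>
    intro D
    rw [pow_zero, mul_one]
    exact (cnt_mono fun H h => h.1).trans (cnt_onP_le D hx)
  | succ T ih =>
    intro D
    set E := Real.exp (Real.exp x)
    set τ := Real.exp (Real.exp 1 * x - s) with hτ
    have hE : 0 < E := Real.exp_pos _
    have hτ0 : 0 < τ := Real.exp_pos _
    set m := D.card with hm
    set F : ℕ → ℝ := fun i => if s ≤ i then
      (Nat.factorial (m - i) : ℝ) / x ^ (m - i) * E * τ ^ T else 0 with hF
    have h1 : cnt (fun H : SimpleGraph V => OnP D H ∧ Big s (T + 1) H) ≤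
        ∑ S ∈ D.powerset, F S.card := by
      refine (cnt_mono (Q := fun H : SimpleGraph V => ∃ S : {S // S ∈ D.powerset},
        s ≤ S.1.card ∧ (OnP D H ∧ (∃ v, S.1 = blk H Set.univ v) ∧
        OnP (D \ S.1) (isolate H S.1) ∧ Big s T (isolate H S.1))) ?_).trans ?_
      · rintro H ⟨hH, hB⟩
        obtain ⟨S, ⟨h1, h2, h3⟩, h4, h5⟩ := onP_big_reduce hs hH hB
        exact ⟨⟨S, Finset.mem_powerset.2 h1⟩, h2, hH, h3, h4, h5⟩
      · refine (cnt_exists_sum _).trans ?_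
        rw [← Finset.sum_coe_sort D.powerset (fun S => F S.card)]
        refine Finset.sum_le_sum fun S _ => ?_
        simp only [hF]
        split_ifs with hS
        · refine (cnt_mono fun H h => h.2).trans ((cnt_big_step S.1).trans ((ih _).trans ?_))
          rw [Finset.card_sdiff_of_subset (Finset.mem_powerset.1 S.2)]
        · refine (cnt_mono (Q := fun _ => False) fun H h => hS h.1).trans ?_
          simp [cnt]
    refine h1.trans ?_
    rw [Finset.sum_powerset_apply_card F]
    have h2 : ∀ i ∈ Finset.range (m + 1), m.choose i • F i ≤
        (Nat.factorial m : ℝ) / x ^ m * E * τ ^ T * Real.exp (-s) *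
          ((Real.exp 1 * x) ^ i / Nat.factorial i) := by
      intro i hi
      have him : i ≤ m := by simpa [Nat.lt_succ_iff] using hi
      simp only [hF]
      split_ifs with hsi
      · have hc : (m.choose i : ℝ) * Nat.factorial i * Nat.factorial (m - i) = Nat.factorial m := by
          exact_mod_cast Nat.choose_mul_factorial_mul_factorial him
        have hxm : x ^ m = x ^ (m - i) * x ^ i := by rw [← pow_add, Nat.sub_add_cancel him]
        have hfi : (0:ℝ) < Nat.factorial i := by exact_mod_cast Nat.factorial_pos i
        have hexp : 1 ≤ Real.exp (-s) * Real.exp 1 ^ i := by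
          rw [← Real.exp_nat_mul, ← Real.exp_add]
          apply Real.one_le_exp
          have : (s:ℝ) ≤ i := by exact_mod_cast hsi
          linarith
        rw [nsmul_eq_mul]
        calc (m.choose i : ℝ) * ((Nat.factorial (m - i) : ℝ) / x ^ (m - i) * E * τ ^ T)
            = (Nat.factorial m : ℝ) / x ^ m * E * τ ^ T * (x ^ i / Nat.factorial i) * 1 := by
              rw [← hc, hxm]; field_simp
          _ ≤ (Nat.factorial m : ℝ) / x ^ m * E * τ ^ T * (x ^ i / Nat.factorial i) *
              (Real.exp (-s) * Real.exp 1 ^ i) := by gcongr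
          _ = _ := by rw [mul_pow]; ring
      · rw [smul_zero]; positivity
    refine (Finset.sum_le_sum h2).trans ?_
    rw [← Finset.mul_sum]
    have h3 := Real.sum_le_exp_of_nonneg (x := Real.exp 1 * x) (by positivity) (m + 1)
    calc (Nat.factorial m : ℝ) / x ^ m * E * τ ^ T * Real.exp (-s) *
          ∑ i ∈ Finset.range (m + 1), (Real.exp 1 * x) ^ i / Nat.factorial i
        ≤ (Nat.factorial m : ℝ) / x ^ m * E * τ ^ T * Real.exp (-s) * Real.exp (Real.exp 1 * x) := by
          gcongr
      _ = (Nat.factorial m : ℝ) / x ^ m * E * τ ^ T * (Real.exp (-s) * Real.exp (Real.exp 1 * x)) := by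
          ring
      _ = _ := by rw [← Real.exp_add, pow_succ, hτ]; ring_nf

theorem cnt_big_frac {s T : ℕ} (hs : 2 ≤ s) {D : Finset V} (hm : 20 ≤ D.card) :
    cnt (fun H : SimpleGraph V => OnP D H ∧ Big s T H) ≤
      Real.exp 2 * (D.card : ℝ) ^ 3 * Real.exp (Real.exp 1 * Real.log D.card - s) ^ T *
        cnt (OnP D) := by
  obtain ⟨x, hx2, hxe, hxl⟩ := exists_saddle hm
  refine (cnt_onP_big_le hs (x := x) (by linarith) T D).trans ?_
  have h := mul_le_mul (bell_ratio hm hx2 hxe) (pow_le_pow_left₀ (Real.exp_pos _).le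
    (Real.exp_le_exp.2 (sub_le_sub_right (mul_le_mul_of_nonneg_left hxl (Real.exp_pos 1).le) (s:ℝ))) T)
    (by positivity) (by have := cnt_nonneg (OnP D); positivity)
  refine h.trans (le_of_eq ?_)
  ring
end big

theorem sum_cnt_le {α ι : Type*} [Finite α] (s : Finset ι) {P : ι → α → Prop} {Q : α → Prop}
    (h : ∀ i ∈ s, ∀ x, P i x → Q x) (hd : ∀ i ∈ s, ∀ j ∈ s, ∀ x, P i x → P j x → i = j) :
    ∑ i ∈ s, cnt (P i) ≤ cnt Q := by
  have := Fintype.ofFinite α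
  simp only [cnt_eq_card_filter]
  rw [← Nat.cast_sum, ← Finset.card_biUnion]
  · norm_cast
    refine Finset.card_le_card fun x hx => ?_
    simp only [Finset.mem_biUnion, Finset.mem_filter, Finset.mem_univ, true_and] at hx ⊢
    obtain ⟨i, hi, hx⟩ := hx
    exact h i hi x hx
  · intro i hi j hj hij
    refine Finset.disjoint_left.2 fun x hx hx' => ?_
    simp only [Finset.mem_filter, Finset.mem_univ, true_and] at hx hx'
    exact hij (hd i hi j hj x hx hx')

section glue
variable {V : Type} [Fintype V]

/-- The arrangement predicate with the central clique given as a finset. -/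
def Arr (C : Finset V) (G : SimpleGraph V) : Prop := G.IsClique ↑C ∧ PFree G (↑C)ᶜ

theorem IsUnipolar.exists_arr {G : SimpleGraph V} (h : IsUnipolar G) : ∃ C : Finset V, Arr C G := by
  obtain ⟨C, hC⟩ := h
  rw [isUnipolarArrangement_iff] at hC
  refine ⟨C.toFinset, ?_⟩
  unfold Arr
  rwa [Set.coe_toFinset]

theorem Arr.isUnipolar {G : SimpleGraph V} {C : Finset V} (h : Arr C G) : IsUnipolar G :=
  ⟨↑C, isUnipolarArrangement_iff.2 h⟩

/-- The subgraph of `G` spanned by the complement of `C`. -/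
def sideG (C : Finset V) (G : SimpleGraph V) : SimpleGraph V where
  Adj a b := G.Adj a b ∧ a ∈ Cᶜ ∧ b ∈ Cᶜ
  symm := ⟨fun _ _ ⟨h, ha, hb⟩ => ⟨h.symm, hb, ha⟩⟩
  loopless := ⟨fun _ h => h.1.ne rfl⟩

/-- The neighbourhoods outside `C` of the vertices of `C`. -/
def sideRow (C : Finset V) (G : SimpleGraph V) (v : V) : Finset V :=
  Finset.univ.filter fun w => v ∈ C ∧ w ∉ C ∧ G.Adj v w

def Supp (C : Finset V) (T : V → Finset V) : Prop := ∀ v, T v ⊆ if v ∈ C then Cᶜ else ∅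

theorem cnt_supp (C : Finset V) : cnt (Supp C) = 2 ^ (C.card * Cᶜ.card) := by
  unfold Supp
  rw [cnt_pi (fun v X => X ⊆ if v ∈ C then Cᶜ else ∅)]
  simp_rw [cnt_finset_subset]
  rw [Finset.prod_pow_eq_pow_sum]
  congr 1
  simp only [apply_ite Finset.card, Finset.card_empty]
  rw [← Finset.sum_filter]
  simp

theorem sideRow_supp (C : Finset V) (G : SimpleGraph V) : Supp C (sideRow C G) := by
  intro v w hw
  simp only [sideRow, Finset.mem_filter, Finset.mem_univ, true_and] at hw
  rw [if_pos hw.1, Finset.mem_compl]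
  exact hw.2.1

theorem Arr.onP {C : Finset V} {G : SimpleGraph V} (h : Arr C G) : OnP Cᶜ (sideG C G) := by
  refine ⟨fun a b h => h.2.1, ?_⟩
  rintro a b c _ _ _ ⟨h1, ha, hb⟩ ⟨h2, _, hc⟩ hac
  exact ⟨h.2 (Finset.mem_compl.1 ha) (Finset.mem_compl.1 hb) (Finset.mem_compl.1 hc) h1 h2 hac, ha, hc⟩

theorem Arr.ext {C : Finset V} {G G' : SimpleGraph V} (h : Arr C G) (h' : Arr C G')
    (h1 : sideG C G = sideG C G') (h2 : sideRow C G = sideRow C G') : G = G' := by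
  have hr : ∀ v ∈ C, ∀ w ∉ C, (G.Adj v w ↔ G'.Adj v w) := by
    intro v hv w hw
    have := Finset.ext_iff.1 (congrFun h2 v) w
    simpa [sideRow, hv, hw] using this
  ext a b
  by_cases ha : a ∈ C <;> by_cases hb : b ∈ C
  · by_cases hab : a = b
    · subst hab; simp
    · exact iff_of_true (h.1 ha hb hab) (h'.1 ha hb hab)
  · exact hr a ha b hb
  · rw [G.adj_comm, G'.adj_comm]
    exact hr b hb a ha
  · have : (sideG C G).Adj a b ↔ (sideG C G').Adj a b := by rw [h1]
    simpa [sideG, ha, hb] using this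

/-- The graph with prescribed central clique, side graph and rows. -/
def glue (C : Finset V) (H : SimpleGraph V) (T : V → Finset V) : SimpleGraph V where
  Adj a b := a ≠ b ∧ ((a ∈ C ∧ b ∈ C) ∨ H.Adj a b ∨ (b ∈ T a) ∨ (a ∈ T b))
  symm := ⟨fun a b ⟨h, h'⟩ => ⟨h.symm, by
    rcases h' with h' | h' | h' | h'
    · exact Or.inl h'.symm
    · exact Or.inr (Or.inl h'.symm)
    · exact Or.inr (Or.inr (Or.inr h'))
    · exact Or.inr (Or.inr (Or.inl h'))⟩⟩
  loopless := ⟨fun _ h => h.1 rfl⟩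

theorem Supp.mem {C : Finset V} {T : V → Finset V} (h : Supp C T) {v w : V} (hw : w ∈ T v) :
    v ∈ C ∧ w ∉ C := by
  have := h v hw
  split_ifs at this with hv
  · exact ⟨hv, Finset.mem_compl.1 this⟩
  · simp at this

theorem glue_side_adj {C : Finset V} {H : SimpleGraph V} {T : V → Finset V} (hT : Supp C T)
    {a b : V} (ha : a ∉ C) (hb : b ∉ C) : (glue C H T).Adj a b ↔ H.Adj a b := by
  constructor
  · rintro ⟨_, h | h | h | h⟩
    · exact absurd h.1 ha
    · exact h
    · exact absurd (hT.mem h).1 ha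
    · exact absurd (hT.mem h).1 hb
  · exact fun h => ⟨h.ne, Or.inr (Or.inl h)⟩

theorem glue_arr {C : Finset V} {H : SimpleGraph V} {T : V → Finset V} (hH : OnP Cᶜ H)
    (hT : Supp C T) : Arr C (glue C H T) := by
  constructor
  · intro a ha b hb hab
    exact ⟨hab, Or.inl ⟨ha, hb⟩⟩
  · intro a b c ha hb hc h1 h2 hac
    rw [glue_side_adj hT ha hb] at h1
    rw [glue_side_adj hT hb hc] at h2
    rw [glue_side_adj hT ha hc]
    exact hH.pFree trivial trivial trivial h1 h2 hac

theorem sideG_glue {C : Finset V} {H : SimpleGraph V} {T : V → Finset V} (hH : OnP Cᶜ H)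
    (hT : Supp C T) : sideG C (glue C H T) = H := by
  ext a b
  constructor
  · rintro ⟨h, ha, hb⟩
    exact (glue_side_adj hT (Finset.mem_compl.1 ha) (Finset.mem_compl.1 hb)).1 h
  · intro h
    have ha := hH.mem h
    have hb := hH.mem h.symm
    exact ⟨(glue_side_adj hT (Finset.mem_compl.1 ha) (Finset.mem_compl.1 hb)).2 h, ha, hb⟩

theorem sideRow_glue {C : Finset V} {H : SimpleGraph V} {T : V → Finset V} (hH : OnP Cᶜ H)
    (hT : Supp C T) : sideRow C (glue C H T) = T := by
  ext v w
  simp only [sideRow, Finset.mem_filter, Finset.mem_univ, true_and]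
  constructor
  · rintro ⟨hv, hw, _, h | h | h | h⟩
    · exact absurd h.2 hw
    · exact absurd hv (Finset.mem_compl.1 (hH.mem h))
    · exact h
    · exact absurd hv (hT.mem h).2
  · intro h
    have := hT.mem h
    exact ⟨this.1, this.2, fun e => this.2 (e ▸ this.1), Or.inr (Or.inr (Or.inl h))⟩

/-- The number of graphs with central clique `C`. -/
def arrCount (C : Finset V) : ℝ := cnt (OnP Cᶜ) * cnt (Supp C)

theorem arrCount_nonneg (C : Finset V) : 0 ≤ arrCount C := mul_nonneg (cnt_nonneg _) (cnt_nonneg _)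

theorem arrCount_le_cnt (C : Finset V) : arrCount C ≤ cnt (Arr C) := by
  unfold arrCount
  rw [← cnt_prod]
  refine cnt_inj (fun q => glue C q.1 q.2) (fun q hq => glue_arr hq.1 hq.2) ?_
  rintro ⟨H, T⟩ ⟨H', T'⟩ ⟨h1, h2⟩ ⟨h3, h4⟩ e
  have e1 := congrArg (sideG C) e
  have e2 := congrArg (sideRow C) e
  simp only at h1 h2 h3 h4 e1 e2
  rw [sideG_glue h1 h2, sideG_glue h3 h4] at e1
  rw [sideRow_glue h1 h2, sideRow_glue h3 h4] at e2
  rw [e1, e2]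

theorem cnt_arr_le {C : Finset V} {Hb : SimpleGraph V → Prop}
    {B : SimpleGraph V → (V → Finset V) → Prop} {δ ε : ℝ} (hε : 0 ≤ ε)
    (h1 : cnt (fun H => OnP Cᶜ H ∧ Hb H) ≤ δ * cnt (OnP Cᶜ))
    (h2 : ∀ H, OnP Cᶜ H → ¬ Hb H → cnt (fun T => Supp C T ∧ B H T) ≤ ε * cnt (Supp C)) :
    cnt (fun G => Arr C G ∧ B (sideG C G) (sideRow C G)) ≤ (δ + ε) * arrCount C := by
  have hS := cnt_nonneg (Supp C)
  have h3 : cnt (fun G => Arr C G ∧ B (sideG C G) (sideRow C G)) ≤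
      cnt (fun q : SimpleGraph V × (V → Finset V) =>
        ((OnP Cᶜ q.1 ∧ Hb q.1) ∧ Supp C q.2) ∨ (OnP Cᶜ q.1 ∧ ¬ Hb q.1 ∧ Supp C q.2 ∧ B q.1 q.2)) := by
    refine cnt_inj (fun G => (sideG C G, sideRow C G)) ?_ ?_
    · rintro G ⟨hG, hB⟩
      by_cases hb : Hb (sideG C G)
      · exact Or.inl ⟨⟨hG.onP, hb⟩, sideRow_supp C G⟩
      · exact Or.inr ⟨hG.onP, hb, sideRow_supp C G, hB⟩
    · rintro G G' ⟨hG, _⟩ ⟨hG', _⟩ e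
      exact hG.ext hG' (congrArg Prod.fst e) (congrArg Prod.snd e)
  have h4 : cnt (fun q : SimpleGraph V × (V → Finset V) =>
      OnP Cᶜ q.1 ∧ ¬ Hb q.1 ∧ Supp C q.2 ∧ B q.1 q.2) ≤ cnt (OnP Cᶜ) * (ε * cnt (Supp C)) := by
    refine cnt_fiber Prod.fst (fun q h => h.1) fun H hH => ?_
    by_cases hb : Hb H
    · refine (cnt_mono (Q := fun _ => False) ?_).trans ?_
      · rintro ⟨H', T⟩ ⟨⟨_, h, _⟩, rfl⟩
        exact h hb
      · simp only [cnt, Set.ofPred_false, Set.ncard_empty, Nat.cast_zero]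
        exact mul_nonneg hε hS
    · refine le_trans (cnt_inj (fun q => q.2) ?_ ?_) (h2 H hH hb)
      · rintro ⟨H', T⟩ ⟨⟨_, _, h⟩, rfl⟩
        exact h
      · rintro ⟨H', T⟩ ⟨H'', T'⟩ ⟨_, rfl⟩ ⟨_, h⟩ e
        exact Prod.ext h.symm e
  refine h3.trans ((cnt_or _ _).trans ?_)
  rw [cnt_prod (fun H => OnP Cᶜ H ∧ Hb H) (Supp C)]
  calc _ ≤ δ * cnt (OnP Cᶜ) * cnt (Supp C) + cnt (OnP Cᶜ) * (ε * cnt (Supp C)) := by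
        refine add_le_add (mul_le_mul_of_nonneg_right h1 hS) h4
    _ = _ := by unfold arrCount; ring

theorem cnt_rows_le {C A : Finset V} (hA : A ⊆ C) (q : V → Finset V → Prop) {ρ : ℝ}
    (h : ∀ c ∈ A, cnt (fun X : Finset V => X ⊆ Cᶜ ∧ q c X) ≤ ρ * 2 ^ Cᶜ.card) :
    cnt (fun T => Supp C T ∧ ∀ c ∈ A, q c (T c)) ≤ ρ ^ A.card * cnt (Supp C) := by
  have h1 : cnt (fun T => Supp C T ∧ ∀ c ∈ A, q c (T c)) =
      ∏ v, cnt (fun X : Finset V => X ⊆ (if v ∈ C then Cᶜ else ∅) ∧ (v ∈ A → q v X)) := by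
    rw [← cnt_pi]
    refine cnt_congr fun T => ⟨fun h v => ⟨h.1 v, fun hv => h.2 v hv⟩,
      fun h => ⟨fun v => (h v).1, fun v hv => (h v).2 hv⟩⟩
  have h2 : cnt (Supp C) = ∏ v, cnt (fun X : Finset V => X ⊆ (if v ∈ C then Cᶜ else ∅)) := by
    rw [← cnt_pi]; rfl
  have h3 : ρ ^ A.card = ∏ v : V, if v ∈ A then ρ else 1 := by
    rw [Finset.prod_ite]; simp
  rw [h1, h2, h3, ← Finset.prod_mul_distrib]
  refine Finset.prod_le_prod (fun v _ => cnt_nonneg _) fun v _ => ?_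
  by_cases hv : v ∈ A
  · rw [if_pos hv, if_pos (hA hv), cnt_finset_subset]
    refine le_trans (cnt_mono ?_) (h v hv)
    exact fun X hX => ⟨hX.1, hX.2 hv⟩
  · rw [if_neg hv, one_mul]
    exact cnt_mono fun X hX => hX.1

theorem cnt_between {D S S' : Finset V} (hS : S ⊆ D) (hS' : S' ⊆ D) (hd : Disjoint S S') :
    cnt (fun X : Finset V => X ⊆ D ∧ S ⊆ X ∧ Disjoint X S') * 2 ^ (S.card + S'.card) =
      2 ^ D.card := by
  have h1 : cnt (fun X : Finset V => X ⊆ D ∧ S ⊆ X ∧ Disjoint X S') =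
      cnt (fun X : Finset V => X ⊆ D \ (S ∪ S')) := by
    apply le_antisymm
    · refine cnt_inj (fun X => X \ S) ?_ ?_
      · rintro X ⟨h1, h2, h3⟩ x hx
        rw [Finset.disjoint_left] at h3
        simp only [Finset.mem_sdiff, Finset.mem_union] at hx ⊢
        exact ⟨h1 hx.1, fun h => h.elim hx.2 (h3 hx.1)⟩
      · rintro X Y ⟨_, h2, _⟩ ⟨_, h2', _⟩ e
        rw [← Finset.sdiff_union_of_subset h2, ← Finset.sdiff_union_of_subset h2']
        rw [show X \ S = Y \ S from e]
    · refine cnt_inj (fun X => X ∪ S) ?_ ?_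
      · intro X hX
        refine ⟨Finset.union_subset (hX.trans Finset.sdiff_subset) hS, Finset.subset_union_right, ?_⟩
        rw [Finset.disjoint_union_left]
        refine ⟨?_, hd⟩
        rw [Finset.disjoint_left]
        intro x hx hx'
        exact (Finset.mem_sdiff.1 (hX hx)).2 (Finset.mem_union_right _ hx')
      · intro X Y hX hY e
        have aux : ∀ Z, Z ⊆ D \ (S ∪ S') → (Z ∪ S) \ S = Z := by
          intro Z hZ
          rw [Finset.union_sdiff_right]
          refine Finset.sdiff_eq_self_of_disjoint ?_
          rw [Finset.disjoint_left]
          intro x hx hx'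
          exact (Finset.mem_sdiff.1 (hZ hx)).2 (Finset.mem_union_left _ hx')
        rw [← aux X hX, ← aux Y hY]
        rw [show X ∪ S = Y ∪ S from e]
  rw [h1, cnt_finset_subset, ← pow_add]
  congr 1
  rw [Finset.card_sdiff_of_subset (Finset.union_subset hS hS'), Finset.card_union_of_disjoint hd]
  have := Finset.card_le_card (Finset.union_subset hS hS')
  rw [Finset.card_union_of_disjoint hd] at this
  omega
end glue

theorem exp_le_two_rpow {y : ℝ} (hy : y ≤ 0) : Real.exp y ≤ (2:ℝ) ^ y := by
  rw [Real.rpow_def_of_pos (by norm_num)]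
  apply Real.exp_le_exp.2
  have : Real.log 2 ≤ 1 := Real.log_two_lt_d9.le.trans (by norm_num)
  nlinarith

theorem exp_two_le : Real.exp 2 ≤ 2 ^ 3 := by
  rw [show (2:ℝ) = 1 + 1 by norm_num, Real.exp_add]
  nlinarith [Real.exp_one_lt_d9, Real.exp_pos 1]

theorem natPow_eq_rpow_lg {n : ℕ} (hn : 0 < n) (k : ℕ) : (n:ℝ) ^ k = 2 ^ (k * Real.logb 2 n) := by
  rw [mul_comm, Real.rpow_mul (by norm_num), rpow_lg hn, Real.rpow_natCast]

theorem two_rpow_add_le {a b : ℝ} (h : a ≤ b - 1) : (2:ℝ) ^ a ≤ 2 ^ b / 2 := by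
  rw [show (2:ℝ) ^ b / 2 = 2 ^ (b - 1) by rw [Real.rpow_sub_one (by norm_num)]]
  exact Real.rpow_le_rpow_of_exponent_le (by norm_num) h

/-- Blocks are small in almost all disjoint unions of cliques. -/
theorem cnt_quarter_block : ∃ n₀ : ℕ, ∀ n, n₀ ≤ n → ∀ (V : Type) [Fintype V],
    Fintype.card V = n → ∀ D : Finset V, n ≤ 8 * D.card →
    cnt (fun H : SimpleGraph V => OnP D H ∧ Big (D.card / 4) 1 H) ≤
      2 ^ (-((n:ℝ) / 50)) / 2 * cnt (OnP D) := by
  have h := (poly_le_exp 6 5 (show (0:ℝ) < 1 / 100 by norm_num)).and (eventually_ge_atTop 200)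
  obtain ⟨n₀, hn₀⟩ := eventually_atTop.1 h
  refine ⟨n₀, fun n hn V _ hV D hD => ?_⟩
  obtain ⟨h1, h2⟩ := hn₀ n hn
  set m := D.card with hm
  have hmn : m ≤ n := by rw [← hV]; exact Finset.card_le_univ D
  have hn0 : (0:ℝ) < n := by exact_mod_cast (by omega : 0 < n)
  have hm0 : (0:ℝ) < m := by exact_mod_cast (by omega : 0 < m)
  refine (cnt_big_frac (by omega) (by omega)).trans ?_
  rw [pow_one]
  refine mul_le_mul_of_nonneg_right ?_ (cnt_nonneg _)
  have hmn' : (m:ℝ) ≤ n := by exact_mod_cast hmn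
  have hq : (n:ℝ) / 32 - 1 ≤ ((m / 4 : ℕ) : ℝ) := by
    have : n ≤ 32 * (m / 4 + 1) := by omega
    have : (n:ℝ) ≤ 32 * ((m / 4 : ℕ) + 1) := by exact_mod_cast this
    linarith
  have e1 : Real.exp (Real.exp 1 * Real.log m - (m / 4 : ℕ)) ≤ (n:ℝ) ^ 3 * 2 ^ (1 - (n:ℝ) / 32) := by
    have e2 : Real.exp 1 * Real.log m ≤ 3 * Real.log n := by
      have := Real.exp_one_lt_d9
      have l1 : Real.log m ≤ Real.log n := Real.log_le_log hm0 hmn'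
      have l2 : 0 ≤ Real.log m := Real.log_nonneg (by exact_mod_cast (by omega : 1 ≤ m))
      nlinarith [Real.exp_pos 1]
    calc Real.exp (Real.exp 1 * Real.log m - (m / 4 : ℕ)) ≤ Real.exp (3 * Real.log n + (1 - (n:ℝ) / 32)) := by
          apply Real.exp_le_exp.2; linarith
      _ = (n:ℝ) ^ 3 * Real.exp (1 - (n:ℝ) / 32) := by
          rw [Real.exp_add]
          congr 1
          rw [show (3:ℝ) = (3:ℕ) by norm_num, Real.exp_nat_mul, Real.exp_log hn0]
      _ ≤ _ := by
          gcongr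
          apply exp_le_two_rpow
          have : (200:ℝ) ≤ n := by exact_mod_cast h2
          linarith
  calc Real.exp 2 * (m:ℝ) ^ 3 * Real.exp (Real.exp 1 * Real.log m - (m / 4 : ℕ))
      ≤ 2 ^ 3 * (n:ℝ) ^ 3 * ((n:ℝ) ^ 3 * 2 ^ (1 - (n:ℝ) / 32)) := by
        gcongr
        exact exp_two_le
    _ = 2 ^ (3 + 6 * Real.logb 2 n + (1 - (n:ℝ) / 32)) := by
        rw [natPow_eq_rpow_lg (by omega), ← Real.rpow_natCast 2 3, ← Real.rpow_add (by norm_num),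
          ← Real.rpow_add (by norm_num), ← Real.rpow_add (by norm_num)]
        congr 1
        push_cast
        ring
    _ ≤ _ := by
        apply two_rpow_add_le
        have : (200:ℝ) ≤ n := by exact_mod_cast h2
        linarith

section uniq
variable {V : Type} [Fintype V]

theorem blk_card_le {H : SimpleGraph V} {s : ℕ} (h : ¬ Big s 1 H) (v : V) :
    (blk H Set.univ v).card ≤ s := by
  by_contra hc
  refine h ⟨{v}, by simp, ?_, ?_⟩
  · intro x hx y hy
    rw [Finset.mem_singleton] at hx hy
    subst hx; subst hy
    simp
  · intro x hx
    rw [Finset.mem_singleton] at hx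
    subst hx
    omega

/-- Some row is covered by two blocks. -/
def Covered (C : Finset V) (H : SimpleGraph V) (T : V → Finset V) : Prop :=
  ∃ p : V × (V × V), p.1 ∈ C ∧ ∀ c ∈ ({p.1} : Finset V),
    T c ⊆ blk H Set.univ p.2.1 ∪ blk H Set.univ p.2.2

theorem Arr.clique_subset_blk {C : Finset V} {G : SimpleGraph V} {K : Set V} {d : V}
    (hd : d ∈ K) (hK : G.IsClique K) (hKC : ∀ x ∈ K, x ∉ C) :
    ∀ x ∈ K, x ∈ blk (sideG C G) Set.univ d := by
  intro x hx
  rw [mem_blk_univ]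
  by_cases hxd : x = d
  · exact Or.inl hxd
  · exact Or.inr ⟨hK hd hx (Ne.symm hxd), Finset.mem_compl.2 (hKC d hd), Finset.mem_compl.2 (hKC x hx)⟩

theorem Arr.subset_of_not_covered {C C' : Finset V} {G : SimpleGraph V} (hC' : Arr C' G)
    (h : ¬ Covered C (sideG C G) (sideRow C G)) : C ⊆ C' := by
  intro x hx
  by_contra hx'
  apply h
  have aux : ∀ K : Set V, G.IsClique K → (∀ x ∈ K, x ∉ C) →
      ∃ d, ∀ x ∈ K, x ∈ blk (sideG C G) Set.univ d := by
    intro K hK hKC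
    rcases K.eq_empty_or_nonempty with rfl | ⟨d, hd⟩
    · exact ⟨x, by simp⟩
    · exact ⟨d, Arr.clique_subset_blk hd hK hKC⟩
  obtain ⟨d₀, h0⟩ := aux {w | w ∈ C' ∧ w ∉ C} (fun a ha b hb hab => hC'.1 ha.1 hb.1 hab)
    (fun a ha => ha.2)
  obtain ⟨d₁, h1⟩ := aux {w | G.Adj x w ∧ w ∉ C' ∧ w ∉ C}
    (fun a ha b hb hab => hC'.2 ha.2.1 hx' hb.2.1 ha.1.symm hb.1 hab) (fun a ha => ha.2.2)
  refine ⟨(x, d₀, d₁), hx, fun c hc w hw => ?_⟩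
  rw [Finset.mem_singleton] at hc
  subst hc
  simp only [sideRow, Finset.mem_filter, Finset.mem_univ, true_and] at hw
  rw [Finset.mem_union]
  by_cases hwC' : w ∈ C'
  · exact Or.inl (h0 w ⟨hwC', hw.2.1⟩)
  · exact Or.inr (h1 w ⟨hw.2.2, hwC', hw.2.1⟩)

theorem cnt_covered_le {C : Finset V} {H : SimpleGraph V} (h : ¬ Big (Cᶜ.card / 4) 1 H) :
    cnt (fun T => Supp C T ∧ Covered C H T) ≤
      (Fintype.card V : ℝ) ^ 3 * 2 ^ (-((Cᶜ.card:ℝ) / 2)) * cnt (Supp C) := by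
  have h1 : cnt (fun T => Supp C T ∧ Covered C H T) ≤
      cnt (fun p : V × (V × V) => p.1 ∈ C) * (2 ^ (-((Cᶜ.card:ℝ) / 2)) * cnt (Supp C)) := by
    refine (cnt_mono (Q := fun T => ∃ p : V × (V × V), p.1 ∈ C ∧ (Supp C T ∧ ∀ c ∈ ({p.1} : Finset V),
      T c ⊆ blk H Set.univ p.2.1 ∪ blk H Set.univ p.2.2)) ?_).trans (cnt_exists ?_)
    · rintro T ⟨hT, p, hp, hc⟩
      exact ⟨p, hp, hT, hc⟩
    · intro p hp
      refine (cnt_rows_le (A := {p.1}) (by simpa using hp)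
        (fun _ X => X ⊆ blk H Set.univ p.2.1 ∪ blk H Set.univ p.2.2)
        (ρ := 2 ^ (-((Cᶜ.card:ℝ) / 2))) ?_).trans (by simp)
      intro c _
      refine (cnt_mono (Q := fun X => X ⊆ blk H Set.univ p.2.1 ∪ blk H Set.univ p.2.2)
        fun X hX => hX.2).trans ?_
      rw [cnt_finset_subset, ← Real.rpow_natCast, ← Real.rpow_natCast, ← Real.rpow_add (by norm_num)]
      apply Real.rpow_le_rpow_of_exponent_le (by norm_num)
      have h2 := Finset.card_union_le (blk H Set.univ p.2.1) (blk H Set.univ p.2.2)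
      have h3 := blk_card_le h p.2.1
      have h4 := blk_card_le h p.2.2
      have h5 : 2 * (blk H Set.univ p.2.1 ∪ blk H Set.univ p.2.2).card ≤ Cᶜ.card := by omega
      have h6 : (2:ℝ) * (blk H Set.univ p.2.1 ∪ blk H Set.univ p.2.2).card ≤ Cᶜ.card := by
        exact_mod_cast h5
      linarith
  refine h1.trans ?_
  have h2 := cnt_le_card (fun p : V × (V × V) => p.1 ∈ C)
  rw [Fintype.card_prod, Fintype.card_prod] at h2
  push_cast at h2
  rw [mul_assoc]
  have := cnt_nonneg (Supp C)
  gcongr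
  exact h2.trans (le_of_eq (by ring))
end uniq

theorem cnt_arr_covered : ∃ n₀ : ℕ, ∀ n, n₀ ≤ n → ∀ (V : Type) [Fintype V],
    Fintype.card V = n → ∀ C : Finset V, n ≤ 8 * Cᶜ.card →
    cnt (fun G => Arr C G ∧ Covered C (sideG C G) (sideRow C G)) ≤ 1 / 2 * arrCount C := by
  obtain ⟨n₁, hn₁⟩ := cnt_quarter_block
  have h := (poly_le_exp 3 2 (show (0:ℝ) < 1 / 16 by norm_num)).and (eventually_ge_atTop (n₁ + 50))
  obtain ⟨n₀, hn₀⟩ := eventually_atTop.1 h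
  refine ⟨n₀, fun n hn V _ hV C hC => ?_⟩
  obtain ⟨h1, h2⟩ := hn₀ n hn
  have hn50 : (50:ℝ) ≤ n := by exact_mod_cast (by omega : 50 ≤ n)
  have hC' : (n:ℝ) ≤ 8 * Cᶜ.card := by exact_mod_cast hC
  refine (cnt_arr_le (Hb := Big (Cᶜ.card / 4) 1) (B := Covered C) (by positivity)
    (hn₁ n (by omega) V hV Cᶜ hC) fun H _ hb => cnt_covered_le hb).trans ?_
  refine mul_le_mul_of_nonneg_right ?_ (arrCount_nonneg C)
  have e1 : (2:ℝ) ^ (-((n:ℝ) / 50)) ≤ 2 ^ (-1:ℝ) :=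
    Real.rpow_le_rpow_of_exponent_le (by norm_num) (by linarith)
  have e2 : (Fintype.card V : ℝ) ^ 3 * 2 ^ (-((Cᶜ.card:ℝ) / 2)) ≤ 2 ^ (-2:ℝ) := by
    rw [hV, natPow_eq_rpow_lg (by omega), ← Real.rpow_add (by norm_num)]
    apply Real.rpow_le_rpow_of_exponent_le (by norm_num)
    push_cast
    linarith
  norm_num [Real.rpow_neg] at e1 e2 ⊢
  linarith

/-- Most arrangements with central clique `C` are the only arrangement of their graph. -/
theorem sum_arrCount_le : ∃ n₀ : ℕ, ∀ n, n₀ ≤ n → ∀ (V : Type) [Fintype V],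
    Fintype.card V = n → ∀ S : Finset (Finset V),
    (∀ C ∈ S, n ≤ 8 * Cᶜ.card) → ∑ C ∈ S, arrCount C ≤ 2 * nU n := by
  obtain ⟨n₀, hn₀⟩ := cnt_arr_covered
  refine ⟨n₀, fun n hn V _ hV S hS => ?_⟩
  have h1 : ∀ C ∈ S, arrCount C ≤
      2 * cnt (fun G : SimpleGraph V => Arr C G ∧ ¬ Covered C (sideG C G) (sideRow C G)) := by
    intro C hC
    have h2 := hn₀ n hn V hV C (hS C hC)
    have h3 := arrCount_le_cnt C
    have h4 : cnt (Arr C) ≤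
        cnt (fun G : SimpleGraph V => Arr C G ∧ Covered C (sideG C G) (sideRow C G)) +
        cnt (fun G : SimpleGraph V => Arr C G ∧ ¬ Covered C (sideG C G) (sideRow C G)) := by
      refine (cnt_mono fun G hG => ?_).trans (cnt_or _ _)
      by_cases hc : Covered C (sideG C G) (sideRow C G)
      · exact Or.inl ⟨hG, hc⟩
      · exact Or.inr ⟨hG, hc⟩
    linarith
  refine (Finset.sum_le_sum h1).trans ?_
  rw [← Finset.mul_sum]
  rw [← hV, ← cnt_isUnipolar]
  gcongr
  refine sum_cnt_le S (fun C _ G hG => hG.1.isUnipolar) ?_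
  intro C _ C' _ G hG hG'
  exact (Arr.subset_of_not_covered hG'.1 hG.2).antisymm (Arr.subset_of_not_covered hG.1 hG'.2)

theorem exp_exp_one_le : Real.exp (Real.exp 1) ≤ 2 ^ 5 := by
  have h : Real.exp 1 ≤ 3 := (Real.exp_one_lt_d9.trans (by norm_num)).le
  calc Real.exp (Real.exp 1) ≤ Real.exp 3 := Real.exp_le_exp.2 h
    _ = Real.exp 1 ^ 3 := by rw [← Real.exp_nat_mul]; norm_num
    _ ≤ 3 ^ 3 := by gcongr
    _ ≤ 2 ^ 5 := by norm_num

theorem sum_arrCount_extreme_le : ∃ n₀ : ℕ, ∀ n, n₀ ≤ n → ∀ (V : Type) [Fintype V],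
    Fintype.card V = n → ∀ S : Finset (Finset V),
    (∀ C ∈ S, 8 * C.card < n ∨ 8 * Cᶜ.card < n) →
    ∑ C ∈ S, arrCount C ≤ 2 ^ (-(n:ℝ)) * nU n := by
  have h := nU_ge_eventually.and ((lg_le_mul (show (0:ℝ) < 1 / 16 by norm_num)).and
    ((eventually_ge_atTop 1000).and (lg_tendsto.eventually_ge_atTop 0)))
  obtain ⟨n₀, hn₀⟩ := eventually_atTop.1 h
  refine ⟨n₀, fun n hn V _ hV S hS => ?_⟩
  obtain ⟨h1, h2, h3, h4⟩ := hn₀ n hn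
  have hn1000 : (1000:ℝ) ≤ n := by exact_mod_cast h3
  have hC : ∀ C ∈ S, arrCount C ≤ 2 ^ (n * Real.logb 2 n + 5 + 7 * (n:ℝ) ^ 2 / 64) := by
    intro C hC
    have hcard : C.card + Cᶜ.card = n := by rw [Finset.card_add_card_compl, hV]
    have hcard' : (C.card : ℝ) + Cᶜ.card = n := by exact_mod_cast hcard
    have e1 : cnt (OnP Cᶜ) ≤ 2 ^ (n * Real.logb 2 n) * 2 ^ (5:ℝ) := by
      refine (cnt_onP_le Cᶜ one_pos).trans ?_
      rw [one_pow, div_one]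
      have e2 : (Nat.factorial Cᶜ.card : ℝ) ≤ 2 ^ (n * Real.logb 2 n) := by
        rw [← natPow_eq_rpow_lg (by omega)]
        have : Nat.factorial Cᶜ.card ≤ n ^ n :=
          (Nat.factorial_le (by omega)).trans (Nat.factorial_le_pow n)
        exact_mod_cast this
      have e3 := exp_exp_one_le
      rw [show (2:ℝ) ^ (5:ℝ) = 2 ^ 5 by norm_num]
      gcongr
    have e2 : cnt (Supp C) ≤ 2 ^ (7 * (n:ℝ) ^ 2 / 64) := by
      rw [cnt_supp, ← Real.rpow_natCast]
      apply Real.rpow_le_rpow_of_exponent_le (by norm_num)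
      push_cast
      rcases hS C hC with h | h
      · have h' : 8 * (C.card:ℝ) ≤ n := by exact_mod_cast h.le
        nlinarith [mul_nonneg (show (0:ℝ) ≤ n / 8 - C.card by linarith)
          (show (0:ℝ) ≤ 7 * n / 8 - C.card by linarith)]
      · have h' : 8 * (Cᶜ.card:ℝ) ≤ n := by exact_mod_cast h.le
        nlinarith [mul_nonneg (show (0:ℝ) ≤ n / 8 - Cᶜ.card by linarith)
          (show (0:ℝ) ≤ 7 * n / 8 - Cᶜ.card by linarith)]
    unfold arrCount
    rw [Real.rpow_add (by norm_num), Real.rpow_add (by norm_num)]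
    gcongr
    exact cnt_nonneg _
  have hcS : (S.card : ℝ) ≤ 2 ^ (n:ℝ) := by
    have := Finset.card_le_univ S
    rw [Fintype.card_finset, hV] at this
    rw [Real.rpow_natCast]
    exact_mod_cast this
  calc ∑ C ∈ S, arrCount C ≤ ∑ C ∈ S, (2:ℝ) ^ (n * Real.logb 2 n + 5 + 7 * (n:ℝ) ^ 2 / 64) :=
        Finset.sum_le_sum hC
    _ = S.card * (2:ℝ) ^ (n * Real.logb 2 n + 5 + 7 * (n:ℝ) ^ 2 / 64) := by simp
    _ ≤ 2 ^ (n:ℝ) * (2:ℝ) ^ (n * Real.logb 2 n + 5 + 7 * (n:ℝ) ^ 2 / 64) := by gcongr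
    _ = 2 ^ (n + (n * Real.logb 2 n + 5 + 7 * (n:ℝ) ^ 2 / 64)) := by
        rw [Real.rpow_add (by norm_num) (n:ℝ)]
    _ ≤ 2 ^ (-(n:ℝ) + ((n:ℝ)^2 / 4 + n * Real.logb 2 n / 5)) := by
        apply Real.rpow_le_rpow_of_exponent_le (by norm_num)
        have h5 : n * Real.logb 2 n ≤ n * (1 / 16 * n) := by gcongr
        have h6 : 0 ≤ n * Real.logb 2 n := by positivity
        nlinarith
    _ ≤ _ := by
        rw [Real.rpow_add (by norm_num)]
        gcongr

theorem cnt_unipolar_and_le : ∃ n₀ : ℕ, ∀ n, n₀ ≤ n → ∀ (V : Type) [Fintype V],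
    Fintype.card V = n → ∀ P : SimpleGraph V → Prop, ∀ ε : ℝ, 0 ≤ ε → (∀ C : Finset V, n ≤ 8 * C.card → n ≤ 8 * Cᶜ.card →
      cnt (fun G => Arr C G ∧ P G) ≤ ε * arrCount C) →
    cnt (fun G => IsUnipolar G ∧ P G) ≤ (2 * ε + 2 ^ (-(n:ℝ))) * nU n := by
  obtain ⟨n₁, h1⟩ := sum_arrCount_le
  obtain ⟨n₂, h2⟩ := sum_arrCount_extreme_le
  refine ⟨max n₁ n₂, fun n hn V _ hV P ε hε hP => ?_⟩
  set S : Finset (Finset V) := Finset.univ.filter fun C => n ≤ 8 * C.card ∧ n ≤ 8 * Cᶜ.card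
  have e1 := h1 n (le_trans (le_max_left _ _) hn) V hV S (fun C hC => (Finset.mem_filter.1 hC).2.2)
  have e2 := h2 n (le_trans (le_max_right _ _) hn) V hV Sᶜ (fun C hC => by
    simp only [S, Finset.mem_compl, Finset.mem_filter, Finset.mem_univ, true_and] at hC
    omega)
  have e3 : cnt (fun G => IsUnipolar G ∧ P G) ≤
      ∑ C : Finset V, cnt (fun G => Arr C G ∧ P G) := by
    refine (cnt_mono fun G hG => ?_).trans (cnt_exists_sum _)
    obtain ⟨C, hC⟩ := hG.1.exists_arr
    exact ⟨C, hC, hG.2⟩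
  rw [← Finset.sum_add_sum_compl S] at e3
  have e4 : ∑ C ∈ S, cnt (fun G => Arr C G ∧ P G) ≤ ε * ∑ C ∈ S, arrCount C := by
    rw [Finset.mul_sum]
    refine Finset.sum_le_sum fun C hC => ?_
    exact hP C (Finset.mem_filter.1 hC).2.1 (Finset.mem_filter.1 hC).2.2
  have e5 : ∑ C ∈ Sᶜ, cnt (fun G => Arr C G ∧ P G) ≤ ∑ C ∈ Sᶜ, arrCount C := by
    refine Finset.sum_le_sum fun C hC => ?_
    have := cnt_arr_le (C := C) (Hb := fun _ => False) (B := fun _ _ => True) (δ := 0) (ε := 1)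
      (by norm_num) (by simp [cnt]) (by simp)
    rw [zero_add, one_mul] at this
    exact (cnt_mono fun G hG => ⟨hG.1, trivial⟩).trans this
  have e6 : ε * ∑ C ∈ S, arrCount C ≤ ε * (2 * nU n) := by gcongr
  linarith

/-- To be clique-colourable it suffices that monochromatic cliques extend. -/
theorem twoCliqueColourable_of_extend {V : Type} {G : SimpleGraph V} (f : V → Fin 2)
    (h : ∀ s : Set V, G.IsClique s → s.Nontrivial → ∀ i, (∀ v ∈ s, f v = i) →
      ∃ w, w ∉ s ∧ ∀ v ∈ s, G.Adj w v) : TwoCliqueColourable G := by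
  refine ⟨f, fun s hs hmax hnt => ?_⟩
  by_contra hc
  push Not at hc
  obtain ⟨v₀, hv₀⟩ := hnt.nonempty
  obtain ⟨w, hw, hws⟩ := h s hs hnt (f v₀) fun v hv => hc v hv v₀ hv₀
  refine hw ?_
  have hcl : G.IsClique (insert w s) := hs.insert fun v hv _ => hws v hv
  rw [← hmax _ hcl (Set.subset_insert _ _)]
  exact Set.mem_insert _ _

section co
variable {V : Type} [Fintype V]

theorem cnt_superset_le {D S : Finset V} {j : ℝ} (hS : S ⊆ D) (h : j ≤ S.card) :
    cnt (fun X : Finset V => X ⊆ D ∧ S ⊆ X) ≤ 2 ^ (-j) * 2 ^ D.card := by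
  have h1 := cnt_between hS (Finset.empty_subset D) (Finset.disjoint_empty_right S)
  simp only [Finset.disjoint_empty_right, and_true, Finset.card_empty, add_zero] at h1
  rw [← h1, mul_left_comm]
  refine le_mul_of_one_le_right (cnt_nonneg _) ?_
  rw [← Real.rpow_natCast, ← Real.rpow_add (by norm_num)]
  exact Real.one_le_rpow (by norm_num) (by linarith)

/-- Some row contains all but one block. -/
def CoCovered (C : Finset V) (H : SimpleGraph V) (T : V → Finset V) : Prop :=
  ∃ p : V × V, p.1 ∈ C ∧ ∀ c ∈ ({p.1} : Finset V), Cᶜ \ blk H Set.univ p.2 ⊆ T c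

theorem Arr.compl_twoCliqueColourable {C : Finset V} {G : SimpleGraph V} (h : Arr C G)
    (hC : Cᶜ.Nonempty) (hc : ¬ CoCovered C (sideG C G) (sideRow C G)) :
    TwoCliqueColourable Gᶜ := by
  obtain ⟨d, hd⟩ := hC
  have hdC := Finset.mem_compl.1 hd
  set K := blk (sideG C G) Set.univ d with hK
  have hKC : ∀ v ∈ K, v ∉ C := by
    intro v hv
    rcases mem_blk_univ.1 hv with rfl | hv
    · exact hdC
    · exact Finset.mem_compl.1 hv.2.2
  have hKadj : ∀ v ∈ K, ∀ w ∉ C, w ∉ K → Gᶜ.Adj v w := by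
    intro v hv w hw hwK
    rw [SimpleGraph.compl_adj]
    refine ⟨fun e => hwK (e ▸ hv), fun hvw => hwK ?_⟩
    rw [hK, mem_blk_univ] at hv ⊢
    by_cases hwd : w = d
    · exact Or.inl hwd
    · refine Or.inr ⟨?_, hd, Finset.mem_compl.2 hw⟩
      rcases hv with rfl | hv
      · exact hvw
      · exact h.2 hdC (Finset.mem_compl.1 hv.2.2) hw hv.1 hvw (Ne.symm hwd)
  refine twoCliqueColourable_of_extend (fun v => if v ∈ C ∨ v ∈ K then 0 else 1) ?_
  intro s hs hnt i hi
  obtain rfl | rfl : i = 0 ∨ i = 1 := by omega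
  · have hred : ∀ v ∈ s, v ∈ C ∨ v ∈ K := by
      intro v hv
      by_contra hv'
      have := hi v hv
      simp [hv'] at this
    obtain ⟨u, hu, v, hv, huv⟩ := hnt
    have hex : ∃ c ∈ s, c ∈ C := by
      by_contra hno
      push Not at hno
      have hu' := (hred u hu).resolve_left (hno u hu)
      have hv' := (hred v hv).resolve_left (hno v hv)
      have := hs hu hv huv
      rw [SimpleGraph.compl_adj] at this
      refine this.2 ?_
      have := blk_isClique h.onP.pFree (v := d) trivial (by exact_mod_cast hu') (by exact_mod_cast hv') huv
      exact this.1
    obtain ⟨c, hcs, hcC⟩ := hex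
    have huniq : ∀ v ∈ s, v ∈ C → v = c := by
      intro v hv hvC
      by_contra hvc
      have := hs hv hcs hvc
      rw [SimpleGraph.compl_adj] at this
      exact this.2 (h.1 hvC hcC hvc)
    have hw : ∃ w, w ∈ Cᶜ \ K ∧ w ∉ sideRow C G c := by
      by_contra hno
      push Not at hno
      exact hc ⟨(c, d), hcC, fun c' hc' w hw => by
        rw [Finset.mem_singleton] at hc'
        subst hc'
        exact hno w hw⟩
    obtain ⟨w, hw, hwc⟩ := hw
    rw [Finset.mem_sdiff, Finset.mem_compl] at hw
    refine ⟨w, fun hws => (hred w hws).elim hw.1 hw.2, fun v hv => ?_⟩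
    rcases hred v hv with hvC | hvK
    · obtain rfl := huniq v hv hvC
      rw [SimpleGraph.compl_adj]
      refine ⟨fun e => hw.1 (e ▸ hvC), fun hadj => hwc ?_⟩
      simp [sideRow, hvC, hw.1, hadj.symm]
    · exact (hKadj v hvK w hw.1 hw.2).symm
  · have hblue : ∀ v ∈ s, v ∉ C ∧ v ∉ K := by
      intro v hv
      have := hi v hv
      simp only [ite_eq_right_iff, zero_ne_one, imp_false, not_or] at this
      exact this
    have hdK : d ∈ K := mem_blk_univ.2 (Or.inl rfl)
    exact ⟨d, fun hds => (hblue d hds).2 hdK, fun v hv => hKadj d hdK v (hblue v hv).1 (hblue v hv).2⟩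

theorem cnt_coCovered_le {C : Finset V} {H : SimpleGraph V} (h : ¬ Big (Cᶜ.card / 4) 1 H) :
    cnt (fun T => Supp C T ∧ CoCovered C H T) ≤
      (Fintype.card V : ℝ) ^ 2 * 2 ^ (-((Cᶜ.card:ℝ) / 2)) * cnt (Supp C) := by
  have h1 : cnt (fun T => Supp C T ∧ CoCovered C H T) ≤
      cnt (fun p : V × V => p.1 ∈ C) * (2 ^ (-((Cᶜ.card:ℝ) / 2)) * cnt (Supp C)) := by
    refine (cnt_mono (Q := fun T => ∃ p : V × V, p.1 ∈ C ∧ (Supp C T ∧ ∀ c ∈ ({p.1} : Finset V),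
      Cᶜ \ blk H Set.univ p.2 ⊆ T c)) ?_).trans (cnt_exists ?_)
    · rintro T ⟨hT, p, hp, hc⟩
      exact ⟨p, hp, hT, hc⟩
    · intro p hp
      refine (cnt_rows_le (A := {p.1}) (by simpa using hp)
        (fun _ X => Cᶜ \ blk H Set.univ p.2 ⊆ X)
        (ρ := 2 ^ (-((Cᶜ.card:ℝ) / 2))) ?_).trans (by simp)
      intro c _
      refine cnt_superset_le Finset.sdiff_subset ?_
      have h2 := Finset.le_card_sdiff (blk H Set.univ p.2) Cᶜ
      have h3 := blk_card_le h p.2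
      have h5 : Cᶜ.card ≤ 2 * (Cᶜ \ blk H Set.univ p.2).card := by omega
      have h6 : (Cᶜ.card:ℝ) ≤ 2 * (Cᶜ \ blk H Set.univ p.2).card := by exact_mod_cast h5
      linarith
  refine h1.trans ?_
  have h2 := cnt_le_card (fun p : V × V => p.1 ∈ C)
  rw [Fintype.card_prod] at h2
  push_cast at h2
  rw [mul_assoc]
  have := cnt_nonneg (Supp C)
  gcongr
  exact h2.trans (le_of_eq (by ring))
end co

theorem cnt_arr_compl_not_colourable : ∃ n₀ : ℕ, ∀ n, n₀ ≤ n → ∀ (V : Type) [Fintype V],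
    Fintype.card V = n → ∀ C : Finset V, n ≤ 8 * Cᶜ.card →
    cnt (fun G => Arr C G ∧ ¬ TwoCliqueColourable Gᶜ) ≤ 2 ^ (-((n:ℝ) / 50)) * arrCount C := by
  obtain ⟨n₁, hn₁⟩ := cnt_quarter_block
  have h := (poly_le_exp 2 1 (show (0:ℝ) < 1 / 50 by norm_num)).and (eventually_ge_atTop (n₁ + 50))
  obtain ⟨n₀, hn₀⟩ := eventually_atTop.1 h
  refine ⟨n₀, fun n hn V _ hV C hC => ?_⟩
  obtain ⟨h1, h2⟩ := hn₀ n hn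
  have hC' : (n:ℝ) ≤ 8 * Cᶜ.card := by exact_mod_cast hC
  have hne : Cᶜ.Nonempty := Finset.card_pos.1 (by omega)
  refine (cnt_mono (Q := fun G => Arr C G ∧ CoCovered C (sideG C G) (sideRow C G)) ?_).trans ?_
  · rintro G ⟨hG, hn⟩
    exact ⟨hG, by_contra fun hc => hn (hG.compl_twoCliqueColourable hne hc)⟩
  refine (cnt_arr_le (Hb := Big (Cᶜ.card / 4) 1) (B := CoCovered C) (by positivity)
    (hn₁ n (by omega) V hV Cᶜ hC) fun H _ hb => cnt_coCovered_le hb).trans ?_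
  refine mul_le_mul_of_nonneg_right ?_ (arrCount_nonneg C)
  have e2 : (Fintype.card V : ℝ) ^ 2 * 2 ^ (-((Cᶜ.card:ℝ) / 2)) ≤ 2 ^ (-((n:ℝ) / 50)) / 2 := by
    rw [hV, natPow_eq_rpow_lg (by omega), ← Real.rpow_add (by norm_num)]
    apply two_rpow_add_le
    push_cast
    linarith
  linarith

section uni
variable {V : Type} [Fintype V]

/-- `X` meets every block with more than `s` vertices. -/
structure Hits (D : Finset V) (H : SimpleGraph V) (s T : ℕ) (X : Finset V) : Prop where
  sub : X ⊆ D
  nonempty : X.Nonempty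
  card_le : X.card ≤ T
  small : ∀ y ∈ D, (∀ x ∈ X, y ∉ blk H Set.univ x) → (blk H Set.univ y).card ≤ s

theorem exists_hits {D : Finset V} (hD : D.Nonempty) {H : SimpleGraph V} (hH : OnP D H) {s T : ℕ}
    (hs : 2 ≤ s) (hT : 1 ≤ T) (h : ¬ Big s T H) : ∃ X, Hits D H s T X := by
  obtain ⟨Y, hY, hmax⟩ := Finset.exists_max_image
    (Finset.univ.filter fun Y : Finset V => (∀ x ∈ Y, ∀ y ∈ Y, ¬ H.Adj x y) ∧
      ∀ x ∈ Y, s ≤ (blk H Set.univ x).card) Finset.card ⟨∅, by simp⟩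
  simp only [Finset.mem_filter, Finset.mem_univ, true_and] at hY hmax
  obtain ⟨hYi, hYb⟩ := hY
  have hYT : Y.card < T := by
    by_contra hc
    obtain ⟨X, hX, hXc⟩ := Finset.exists_subset_card_eq (not_lt.1 hc)
    exact h ⟨X, hXc, fun x hx y hy => hYi x (hX hx) y (hX hy), fun x hx => hYb x (hX hx)⟩
  have hYD : Y ⊆ D := by
    intro x hx
    obtain ⟨w, hw, hwx⟩ := Finset.exists_mem_ne (show 1 < (blk H Set.univ x).card from by
        have := hYb x hx; omega) x
    rcases mem_blk_univ.1 hw with rfl | hw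
    · exact absurd rfl hwx
    · exact hH.mem hw
  have hsm : ∀ y, (∀ x ∈ Y, y ∉ blk H Set.univ x) → (blk H Set.univ y).card ≤ s := by
    intro y hy
    by_contra hc
    have hyY : y ∉ Y := fun hyY => hy y hyY (mem_blk_univ.2 (Or.inl rfl))
    have hyn : ∀ x ∈ Y, ¬ H.Adj x y := fun x hx hxy => hy x hx (mem_blk_univ.2 (Or.inr hxy))
    have := hmax (insert y Y) ⟨?_, ?_⟩
    · rw [Finset.card_insert_of_notMem hyY] at this
      omega
    · intro a ha b hb
      rcases Finset.mem_insert.1 ha with ha' | ha' <;> rcases Finset.mem_insert.1 hb with hb' | hb'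
      · rw [ha', hb']
        exact H.loopless.irrefl y
      · rw [ha']
        exact fun e => hyn b hb' e.symm
      · rw [hb']
        exact hyn a ha'
      · exact hYi a ha' b hb'
    · intro a ha
      rcases Finset.mem_insert.1 ha with rfl | ha
      · omega
      · exact hYb a ha
  rcases Y.eq_empty_or_nonempty with rfl | hne
  · obtain ⟨d, hd⟩ := hD
    refine ⟨{d}, by simpa using hd, by simp, by simpa using hT, fun y _ _ => hsm y (by simp)⟩
  · exact ⟨Y, hYD, hne, hYT.le, fun y _ hy => hsm y hy⟩

/-- A set with half the elements of `K`. -/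
def half (K : Finset V) : Finset V :=
  (Finset.exists_subset_card_eq (Nat.div_le_self K.card 2)).choose

theorem half_subset (K : Finset V) : half K ⊆ K :=
  (Finset.exists_subset_card_eq (Nat.div_le_self K.card 2)).choose_spec.1

theorem half_card (K : Finset V) : (half K).card = K.card / 2 :=
  (Finset.exists_subset_card_eq (Nat.div_le_self K.card 2)).choose_spec.2

/-- The halves of the blocks not met by `X`, together with the empty set. -/
def piece (D : Finset V) (H : SimpleGraph V) (X : Finset V) : Option (V × Bool) → Finset V
  | none => ∅
  | some (y, b) => if y ∈ D ∧ ∀ x ∈ X, y ∉ blk H Set.univ x then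
      (if b then half (blk H Set.univ y) else blk H Set.univ y \ half (blk H Set.univ y)) else ∅

theorem piece_subset_blk {D : Finset V} {H : SimpleGraph V} {X : Finset V} {p : Option (V × Bool)}
    {w : V} (hw : w ∈ piece D H X p) :
    ∃ y ∈ D, (∀ x ∈ X, y ∉ blk H Set.univ x) ∧ w ∈ blk H Set.univ y := by
  rcases p with _ | ⟨y, b⟩
  · simp [piece] at hw
  · simp only [piece] at hw
    split_ifs at hw with h1 h2
    · exact ⟨y, h1.1, h1.2, half_subset _ hw⟩
    · exact ⟨y, h1.1, h1.2, (Finset.mem_sdiff.1 hw).1⟩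
    · simp at hw

theorem piece_subset {D : Finset V} {H : SimpleGraph V} (hH : OnP D H) {X : Finset V}
    (p : Option (V × Bool)) : piece D H X p ⊆ D := by
  intro w hw
  obtain ⟨y, hy, _, hwy⟩ := piece_subset_blk hw
  rcases mem_blk_univ.1 hwy with rfl | h
  · exact hy
  · exact hH.mem h.symm

theorem piece_disjoint {D : Finset V} {H : SimpleGraph V} {X : Finset V}
    (p : Option (V × Bool)) {x : V} (hx : x ∈ X) : x ∉ piece D H X p := by
  intro hw
  obtain ⟨y, hy, hyX, hwy⟩ := piece_subset_blk hw
  apply hyX x hx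
  rw [mem_blk_univ] at hwy ⊢
  exact hwy.imp Eq.symm fun h => h.symm

theorem piece_card_le {D : Finset V} {H : SimpleGraph V} {s T : ℕ} {X : Finset V}
    (hX : Hits D H s T X) (p : Option (V × Bool)) : (piece D H X p).card ≤ (s + 1) / 2 := by
  rcases p with _ | ⟨y, b⟩
  · simp [piece]
  · simp only [piece]
    split_ifs with h1 h2
    · have := hX.small y h1.1 h1.2
      rw [half_card]
      omega
    · have := hX.small y h1.1 h1.2
      rw [Finset.card_sdiff_of_subset (half_subset _), half_card]
      omega
    · simp

theorem Arr.twoCliqueColourable {C : Finset V} {G : SimpleGraph V} (h : Arr C G) {s T : ℕ}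
    {X : Finset V} (hX : Hits Cᶜ (sideG C G) s T X) {x₁ : V} (hx₁ : x₁ ∈ X)
    (hP : ∀ p, ∃ c ∈ C, X ∪ piece Cᶜ (sideG C G) X p ⊆ sideRow C G c)
    (hQ : ∀ p, ∃ c ∈ C, piece Cᶜ (sideG C G) X p ⊆ sideRow C G c ∧ x₁ ∉ sideRow C G c) :
    TwoCliqueColourable G := by
  set H := sideG C G with hH
  have hmet : ∀ v, v ∉ C → (∃ x ∈ X, v ∈ blk H Set.univ x) ∨
      (v ∈ Cᶜ ∧ ∀ x ∈ X, v ∉ blk H Set.univ x) := by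
    intro v hv
    by_cases hm : ∃ x ∈ X, v ∈ blk H Set.univ x
    · exact Or.inl hm
    · push Not at hm
      exact Or.inr ⟨Finset.mem_compl.2 hv, hm⟩
  have hadjrow : ∀ c ∈ C, ∀ w ∈ sideRow C G c, G.Adj c w := by
    intro c _ w hw
    simp only [sideRow, Finset.mem_filter, Finset.mem_univ, true_and] at hw
    exact hw.2.2
  have hcliq : ∀ K : Set V, G.IsClique K → ∀ y ∈ K, y ∉ C → ∀ w ∈ K, w ∉ C →
      w ∈ blk H Set.univ y := by
    intro K hK y hy hyC w hw hwC
    rw [mem_blk_univ]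
    by_cases hwy : w = y
    · exact Or.inl hwy
    · exact Or.inr ⟨hK hy hw (Ne.symm hwy), Finset.mem_compl.2 hyC, Finset.mem_compl.2 hwC⟩
  have hblkeq : ∀ y w, w ∈ blk H Set.univ y → blk H Set.univ w = blk H Set.univ y := by
    intro y w hw
    rcases mem_blk_univ.1 hw with rfl | hw
    · rfl
    · exact blk_eq h.onP.pFree trivial trivial hw.symm
  have hXC : ∀ x ∈ X, x ∉ C := fun x hx => Finset.mem_compl.1 (hX.sub hx)
  set f : V → Fin 2 := fun v =>
    if v ∈ C then (if X ⊆ sideRow C G v then 1 else 0)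
    else if v ∈ X then 0
    else if ∃ x ∈ X, v ∈ blk H Set.univ x then 1
    else if v ∈ half (blk H Set.univ v) then 0 else 1 with hf
  have f_row : ∀ c ∈ C, X ⊆ sideRow C G c → f c = 1 := by
    intro c hc hcX; simp [hf, hc, hcX]
  have f_row' : ∀ c ∈ C, ¬ X ⊆ sideRow C G c → f c = 0 := by
    intro c hc hcX; simp [hf, hc, hcX]
  have f_X : ∀ x ∈ X, f x = 0 := by
    intro x hx; simp [hf, hXC x hx, hx]
  have f_met : ∀ v ∉ C, v ∉ X → (∃ x ∈ X, v ∈ blk H Set.univ x) → f v = 1 := by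
    intro v hv hvX hm
    simp only [hf, if_neg hv, if_neg hvX, if_pos hm]
  have f_half : ∀ v ∉ C, (∀ x ∈ X, v ∉ blk H Set.univ x) →
      (f v = if v ∈ half (blk H Set.univ v) then 0 else 1) := by
    intro v hv hm
    have hvX : v ∉ X := fun hvX => hm v hvX (mem_blk_univ.2 (Or.inl rfl))
    have hm' : ¬ ∃ x ∈ X, v ∈ blk H Set.univ x := by push Not; exact hm
    simp only [hf, if_neg hv, if_neg hvX, if_neg hm']
  have extend : ∀ (K : Set V), G.IsClique K → ∀ c ∈ C, c ∉ K →
      (∀ w ∈ K, w ∉ C → w ∈ sideRow C G c) → ∃ w, w ∉ K ∧ ∀ v ∈ K, G.Adj w v := by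
    intro K hK c hc hcK hrow
    refine ⟨c, hcK, fun v hv => ?_⟩
    by_cases hvC : v ∈ C
    · exact h.1 hc hvC fun e => hcK (e ▸ hv)
    · exact hadjrow c hc v (hrow v hv hvC)
  refine twoCliqueColourable_of_extend f ?_
  intro K hK _ i hi
  obtain rfl | rfl : i = 0 ∨ i = 1 := by omega
  · have hex : ∃ p, ∀ w ∈ K, w ∉ C → w ∈ X ∪ piece Cᶜ H X p := by
      by_cases hno : ∃ y ∈ K, y ∉ C
      · obtain ⟨y, hy, hyC⟩ := hno
        rcases hmet y hyC with hm | ⟨_, hm⟩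
        · refine ⟨none, fun w hw hwC => Finset.mem_union_left _ ?_⟩
          by_contra hwX
          obtain ⟨x, hx, hyx⟩ := hm
          have hwx : w ∈ blk H Set.univ x := by
            rw [← hblkeq x y hyx]; exact hcliq K hK y hy hyC w hw hwC
          have := (hi w hw).symm.trans (f_met w hwC hwX ⟨x, hx, hwx⟩)
          simp at this
        · refine ⟨some (y, true), fun w hw hwC => Finset.mem_union_right _ ?_⟩
          have hwy := hcliq K hK y hy hyC w hw hwC
          have hwm : ∀ x ∈ X, w ∉ blk H Set.univ x := by
            intro x hx hwx
            refine hm x hx ?_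
            rw [← hblkeq x w hwx, hblkeq y w hwy]
            exact mem_blk_univ.2 (Or.inl rfl)
          have h1 := (hi w hw).symm.trans (f_half w hwC hwm)
          rw [hblkeq y w hwy] at h1
          simp only [piece]
          rw [if_pos ⟨Finset.mem_compl.2 hyC, hm⟩, if_true]
          by_contra hc
          rw [if_neg hc] at h1
          simp at h1
      · push Not at hno
        exact ⟨none, fun w hw hwC => absurd (hno w hw) hwC⟩
    obtain ⟨p, hp⟩ := hex
    obtain ⟨c, hc, hcp⟩ := hP p
    refine extend K hK c hc (fun hcK => ?_) fun w hw hwC => hcp (hp w hw hwC)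
    have := (hi c hcK).symm.trans (f_row c hc (Finset.union_subset_left hcp))
    simp at this
  · by_cases hmetK : ∃ y ∈ K, y ∉ C ∧ ∃ x ∈ X, y ∈ blk H Set.univ x
    · obtain ⟨y, hy, hyC, x, hx, hyx⟩ := hmetK
      have hxK : x ∉ K := by
        intro hxK
        have := (hi x hxK).symm.trans (f_X x hx)
        simp at this
      refine ⟨x, hxK, fun v hv => ?_⟩
      by_cases hvC : v ∈ C
      · refine (hadjrow v hvC x ?_).symm
        by_contra hc
        have := (hi v hv).symm.trans (f_row' v hvC fun hX => hc (hX hx))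
        simp at this
      · have hvx : v ∈ blk H Set.univ x := by
          rw [← hblkeq x y hyx]; exact hcliq K hK y hy hyC v hv hvC
        rcases mem_blk_univ.1 hvx with rfl | hvx
        · exact absurd hv hxK
        · exact hvx.1
    · push Not at hmetK
      have hex : ∃ p, ∀ w ∈ K, w ∉ C → w ∈ piece Cᶜ H X p := by
        by_cases hno : ∃ y ∈ K, y ∉ C
        · obtain ⟨y, hy, hyC⟩ := hno
          refine ⟨some (y, false), fun w hw hwC => ?_⟩
          have hwy := hcliq K hK y hy hyC w hw hwC
          have h1 := (hi w hw).symm.trans (f_half w hwC (hmetK w hw hwC))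
          rw [hblkeq y w hwy] at h1
          simp only [piece]
          rw [if_pos ⟨Finset.mem_compl.2 hyC, hmetK y hy hyC⟩, if_neg (by simp), Finset.mem_sdiff]
          refine ⟨hwy, fun hc => ?_⟩
          rw [if_pos hc] at h1
          simp at h1
        · push Not at hno
          exact ⟨none, fun w hw hwC => absurd (hno w hw) hwC⟩
      obtain ⟨p, hp⟩ := hex
      obtain ⟨c, hc, hcp, hcx⟩ := hQ p
      refine extend K hK c hc (fun hcK => ?_) fun w hw hwC => hcp (hp w hw hwC)
      have := (hi c hcK).symm.trans (f_row' c hc fun hX => hcx (hX hx₁))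
      simp at this
end uni

theorem cnt_and_add_cnt_not {α : Type*} [Finite α] (P Q : α → Prop) :
    cnt (fun x => P x ∧ Q x) + cnt (fun x => P x ∧ ¬ Q x) = cnt P := by
  have := Fintype.ofFinite α
  rw [cnt_eq_card_filter, cnt_eq_card_filter, cnt_eq_card_filter, ← Finset.filter_filter,
    ← Finset.filter_filter]
  exact_mod_cast Finset.card_filter_add_card_filter_not (s := Finset.univ.filter P) Q

section uni
variable {V : Type} [Fintype V]

theorem cnt_not_between_le {D S S' : Finset V} (hS : S ⊆ D) (hS' : S' ⊆ D) (hd : Disjoint S S')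
    {J : ℕ} (hJ : S.card + S'.card ≤ J) :
    cnt (fun X : Finset V => X ⊆ D ∧ ¬ (S ⊆ X ∧ Disjoint X S')) ≤
      (1 - (1 / 2) ^ J) * 2 ^ D.card := by
  have h1 := cnt_between hS hS' hd
  have h2 := cnt_and_add_cnt_not (fun X : Finset V => X ⊆ D) fun X => S ⊆ X ∧ Disjoint X S'
  rw [cnt_finset_subset] at h2
  have h3 : (1 / 2 : ℝ) ^ J * 2 ^ D.card ≤
      cnt (fun X : Finset V => X ⊆ D ∧ S ⊆ X ∧ Disjoint X S') := by
    rw [← h1, mul_left_comm]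
    refine mul_le_of_le_one_right (cnt_nonneg _) ?_
    calc (1 / 2 : ℝ) ^ J * 2 ^ (S.card + S'.card)
        ≤ (1 / 2 : ℝ) ^ J * 2 ^ J := by
          gcongr
          norm_num
      _ = 1 := by rw [← mul_pow]; norm_num
  linarith

theorem cnt_rows_fail_le {C S S' : Finset V} (hS : S ⊆ Cᶜ) (hS' : S' ⊆ Cᶜ) (hd : Disjoint S S')
    {J : ℕ} (hJ : S.card + S'.card ≤ J) :
    cnt (fun T => Supp C T ∧ ∀ c ∈ C, ¬ (S ⊆ T c ∧ Disjoint (T c) S')) ≤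
      (1 - (1 / 2) ^ J) ^ C.card * cnt (Supp C) :=
  cnt_rows_le (Finset.Subset.refl C) (fun _ X => ¬ (S ⊆ X ∧ Disjoint X S'))
    fun _ _ => cnt_not_between_le hS hS' hd hJ

/-- For a typical side graph, random rows give a clique-colourable graph. -/
theorem cnt_glue_not_colourable {C : Finset V} (hC : Cᶜ.Nonempty) {H : SimpleGraph V}
    (hH : OnP Cᶜ H) {s T : ℕ} (hs : 2 ≤ s) (hT : 1 ≤ T) (h : ¬ Big s T H) :
    cnt (fun R => Supp C R ∧ ¬ TwoCliqueColourable (glue C H R)) ≤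
      (4 * Fintype.card V + 2) * (1 - (1 / 2) ^ (T + (s + 1) / 2 + 1)) ^ C.card * cnt (Supp C) := by
  obtain ⟨X, hX⟩ := exists_hits hC hH hs hT h
  obtain ⟨x₁, hx₁⟩ := hX.nonempty
  set M := (1 - (1 / 2 : ℝ) ^ (T + (s + 1) / 2 + 1)) ^ C.card * cnt (Supp C) with hM
  have hA : ∀ p, cnt (fun R => Supp C R ∧ ∀ c ∈ C,
      ¬ (X ∪ piece Cᶜ H X p ⊆ R c ∧ Disjoint (R c) ∅)) ≤ M := by
    intro p
    refine cnt_rows_fail_le (Finset.union_subset hX.sub (piece_subset hH p))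
      (Finset.empty_subset _) (Finset.disjoint_empty_right _) ?_
    have := Finset.card_union_le X (piece Cᶜ H X p)
    have := hX.card_le
    have := piece_card_le hX p
    simp only [Finset.card_empty]
    omega
  have hB : ∀ p, cnt (fun R => Supp C R ∧ ∀ c ∈ C,
      ¬ (piece Cᶜ H X p ⊆ R c ∧ Disjoint (R c) {x₁})) ≤ M := by
    intro p
    refine cnt_rows_fail_le (piece_subset hH p) (by simpa using hX.sub hx₁)
      (Finset.disjoint_singleton_right.2 (piece_disjoint p hx₁)) ?_
    have := piece_card_le hX p
    simp only [Finset.card_singleton]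
    omega
  have hsum : ∀ p : Option (V × Bool), cnt (fun R => (Supp C R ∧ ∀ c ∈ C,
      ¬ (X ∪ piece Cᶜ H X p ⊆ R c ∧ Disjoint (R c) ∅)) ∨ (Supp C R ∧ ∀ c ∈ C,
      ¬ (piece Cᶜ H X p ⊆ R c ∧ Disjoint (R c) {x₁}))) ≤ 2 * M := by
    intro p
    have := cnt_or (fun R => Supp C R ∧ ∀ c ∈ C,
      ¬ (X ∪ piece Cᶜ H X p ⊆ R c ∧ Disjoint (R c) ∅)) (fun R => Supp C R ∧ ∀ c ∈ C,
      ¬ (piece Cᶜ H X p ⊆ R c ∧ Disjoint (R c) {x₁}))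
    linarith [hA p, hB p]
  refine (cnt_mono (Q := fun R => ∃ p : Option (V × Bool), (Supp C R ∧ ∀ c ∈ C,
      ¬ (X ∪ piece Cᶜ H X p ⊆ R c ∧ Disjoint (R c) ∅)) ∨ (Supp C R ∧ ∀ c ∈ C,
      ¬ (piece Cᶜ H X p ⊆ R c ∧ Disjoint (R c) {x₁}))) ?_).trans ?_
  · rintro R ⟨hR, hn⟩
    by_contra hno
    push Not at hno
    apply hn
    have hG := glue_arr hH hR
    have e1 := sideG_glue hH hR
    have e2 := sideRow_glue hH hR
    refine Arr.twoCliqueColourable hG (s := s) (T := T) (X := X) (by rw [e1]; exact hX) hx₁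
      (fun p => ?_) fun p => ?_
    · obtain ⟨c, hc, h1, _⟩ := (hno p).1 hR
      exact ⟨c, hc, by rw [e1, e2]; exact h1⟩
    · obtain ⟨c, hc, h1, h2⟩ := (hno p).2 hR
      exact ⟨c, hc, by rw [e1, e2]; exact ⟨h1, Finset.disjoint_singleton_right.1 h2⟩⟩
  · refine (cnt_exists_sum _).trans ((Finset.sum_le_sum fun p _ => hsum p).trans (le_of_eq ?_))
    rw [Finset.sum_const, Finset.card_univ, Fintype.card_option, Fintype.card_prod,
      Fintype.card_bool, nsmul_eq_mul]
    push_cast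
    ring

theorem cnt_arr_not_colourable_le {C : Finset V} (hC : 20 ≤ Cᶜ.card) {s T : ℕ} (hs : 2 ≤ s)
    (hT : 1 ≤ T) :
    cnt (fun G => Arr C G ∧ ¬ TwoCliqueColourable G) ≤
      (Real.exp 2 * (Cᶜ.card : ℝ) ^ 3 * Real.exp (Real.exp 1 * Real.log Cᶜ.card - s) ^ T +
        (4 * Fintype.card V + 2) * (1 - (1 / 2) ^ (T + (s + 1) / 2 + 1)) ^ C.card) *
      arrCount C := by
  have h0 : (0:ℝ) ≤ 1 - (1 / 2) ^ (T + (s + 1) / 2 + 1) := by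
    rw [sub_nonneg]
    exact pow_le_one₀ (by norm_num) (by norm_num)
  refine le_trans (cnt_mono ?_) (cnt_arr_le (Hb := Big s T)
    (B := fun H R => ¬ TwoCliqueColourable (glue C H R)) (by positivity) (cnt_big_frac hs hC)
    fun H hH hb => cnt_glue_not_colourable (Finset.card_pos.1 (by omega)) hH hs hT hb)
  rintro G ⟨hG, hn⟩
  refine ⟨hG, ?_⟩
  have hS := sideRow_supp C G
  rwa [← Arr.ext hG (glue_arr hG.onP hS) (sideG_glue hG.onP hS).symm (sideRow_glue hG.onP hS).symm]
end uni

theorem big_fraction_le {n m s T : ℕ} (hm : 0 < m) (hmn : m ≤ n)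
    (hL : (10:ℝ) ^ 6 ≤ Real.logb 2 n) (hs : 1.95 * Real.logb 2 n ≤ s)
    (hT : 0.005 * Real.logb 2 n ≤ T) :
    Real.exp 2 * (m : ℝ) ^ 3 * Real.exp (Real.exp 1 * Real.log m - s) ^ T ≤
      2 ^ (-(Real.logb 2 n ^ 2 / 4000)) / 2 := by
  set L := Real.logb 2 n with hLdef
  have hn : 0 < n := hm.trans_le hmn
  have hlog : Real.log m ≤ L * Real.log 2 := by
    rw [hLdef, Real.logb, div_mul_cancel₀ _ (Real.log_pos (by norm_num)).ne']
    exact Real.log_le_log (by exact_mod_cast hm) (by exact_mod_cast hmn)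
  have he : Real.exp 1 * Real.log 2 ≤ 1.885 := by
    have h1 := Real.exp_one_lt_d9
    have h2 := Real.log_two_lt_d9
    have h3 := Real.log_pos (show (1:ℝ) < 2 by norm_num)
    nlinarith
  have hexp : Real.exp 1 * Real.log m - s ≤ -(0.065 * L) := by
    have h1 := mul_le_mul_of_nonneg_left hlog (Real.exp_pos 1).le
    have h2 := mul_le_mul_of_nonneg_left he (show 0 ≤ L by linarith)
    nlinarith
  have h1 : Real.exp (Real.exp 1 * Real.log m - s) ^ T ≤ 2 ^ (-(0.000325 * L ^ 2)) := by
    rw [← Real.exp_nat_mul]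
    refine le_trans (Real.exp_le_exp.2 ?_) (exp_le_two_rpow (by nlinarith))
    have h2 := mul_le_mul_of_nonneg_left hexp (Nat.cast_nonneg (α := ℝ) T)
    have h3 := mul_le_mul_of_nonneg_right hT (show 0 ≤ 0.065 * L by linarith)
    nlinarith
  have h2 : (m:ℝ) ^ 3 ≤ 2 ^ ((3:ℕ) * L) := by
    rw [hLdef, ← natPow_eq_rpow_lg hn]
    gcongr
  have h3 : Real.exp 2 ≤ (2:ℝ) ^ (3:ℝ) := by exact_mod_cast exp_two_le
  calc Real.exp 2 * (m : ℝ) ^ 3 * Real.exp (Real.exp 1 * Real.log m - s) ^ T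
      ≤ (2:ℝ) ^ (3:ℝ) * 2 ^ ((3:ℕ) * L) * 2 ^ (-(0.000325 * L ^ 2)) := by gcongr
    _ = 2 ^ ((3:ℝ) + (3:ℕ) * L + -(0.000325 * L ^ 2)) := by
        rw [Real.rpow_add (by norm_num), Real.rpow_add (by norm_num)]
    _ ≤ _ := by
        apply two_rpow_add_le
        push_cast
        nlinarith

theorem rows_fraction_le {n k J : ℕ} (hL : (10:ℝ) ^ 6 ≤ Real.logb 2 n) (hn : 0 < n)
    (hk : n ≤ 8 * k) (hJ : (J:ℝ) ≤ 0.98 * Real.logb 2 n + 3) :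
    (4 * (n:ℝ) + 2) * (1 - (1 / 2) ^ J) ^ k ≤ 2 ^ (-(Real.logb 2 n ^ 2 / 4000)) / 2 := by
  set L := Real.logb 2 n with hLdef
  have hnL : (n:ℝ) = 2 ^ L := by
    have := natPow_eq_rpow_lg hn 1
    simpa using this
  have h0 : (1 / 2 : ℝ) ^ J = 2 ^ (-(J:ℝ)) := by
    rw [Real.rpow_neg (by norm_num), Real.rpow_natCast, one_div, inv_pow]
  have h01 : (1 / 2 : ℝ) ^ J ≤ 1 := pow_le_one₀ (by norm_num) (by norm_num)
  have hgrow : (2:ℝ) ^ (0.02 * L - 6) ≤ (1 / 2 : ℝ) ^ J * k := by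
    have hk' : (n:ℝ) / 8 ≤ k := by
      have : (n:ℝ) ≤ 8 * k := by exact_mod_cast hk
      linarith
    calc (2:ℝ) ^ (0.02 * L - 6) = 2 ^ (-(0.98 * L + 3)) * 2 ^ (L - 3) := by
          rw [← Real.rpow_add (by norm_num)]
          congr 1
          ring
      _ = 2 ^ (-(0.98 * L + 3)) * ((n:ℝ) / 8) := by
          rw [Real.rpow_sub (by norm_num), ← hnL]
          norm_num
      _ ≤ _ := by
          rw [h0]
          refine mul_le_mul (Real.rpow_le_rpow_of_exponent_le (by norm_num) (by linarith)) hk'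
            (by positivity) (by positivity)
  have hpoly : L ^ 2 / 4000 + L + 4 ≤ (2:ℝ) ^ (0.02 * L - 6) := by
    have h1 : (0.01 * L) ^ 3 / (Nat.factorial 3) ≤ Real.exp (0.01 * L) :=
      Real.pow_div_factorial_le_exp _ (by linarith) 3
    have h2 : Real.exp (0.01 * L) ≤ 2 ^ (0.02 * L) := by
      rw [Real.rpow_def_of_pos (by norm_num)]
      apply Real.exp_le_exp.2
      have := Real.log_two_gt_d9
      nlinarith
    have h3 : (2:ℝ) ^ (0.02 * L - 6) = 2 ^ (0.02 * L) / 64 := by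
      rw [Real.rpow_sub (by norm_num)]
      norm_num
    rw [h3]
    have h4 : (Nat.factorial 3 : ℝ) = 6 := by norm_num [Nat.factorial]
    rw [h4] at h1
    have h5 : (10:ℝ) ^ 6 * L ^ 2 ≤ L ^ 3 := by
      have := mul_le_mul_of_nonneg_right hL (sq_nonneg L)
      nlinarith
    nlinarith
  have hmain : (1 - (1 / 2 : ℝ) ^ J) ^ k ≤ 2 ^ (-(L ^ 2 / 4000 + L + 4)) := by
    calc (1 - (1 / 2 : ℝ) ^ J) ^ k ≤ Real.exp (-(1 / 2 : ℝ) ^ J) ^ k := by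
          refine pow_le_pow_left₀ (by linarith) ?_ k
          have := Real.add_one_le_exp (-(1 / 2 : ℝ) ^ J)
          linarith
      _ = Real.exp (-((1 / 2 : ℝ) ^ J * k)) := by
          rw [← Real.exp_nat_mul]
          congr 1
          ring
      _ ≤ 2 ^ (-((1 / 2 : ℝ) ^ J * k)) := exp_le_two_rpow (by
          have : 0 ≤ (1 / 2 : ℝ) ^ J * k := by positivity
          linarith)
      _ ≤ _ := Real.rpow_le_rpow_of_exponent_le (by norm_num) (by linarith)
  have hn1 : (1:ℝ) ≤ n := by exact_mod_cast hn
  calc (4 * (n:ℝ) + 2) * (1 - (1 / 2) ^ J) ^ k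
      ≤ (2 ^ (3:ℝ) * 2 ^ L) * 2 ^ (-(L ^ 2 / 4000 + L + 4)) := by
        refine mul_le_mul ?_ hmain (pow_nonneg (by linarith) _) (by positivity)
        rw [← hnL]
        norm_num
        linarith
    _ = 2 ^ ((3:ℝ) + L + -(L ^ 2 / 4000 + L + 4)) := by
        rw [Real.rpow_add (by norm_num), Real.rpow_add (by norm_num)]
    _ ≤ _ := two_rpow_add_le (by linarith)

/-- Almost all unipolar graphs with a given arrangement are clique-colourable. -/
theorem cnt_arr_not_colourable : ∃ n₀ : ℕ, ∀ n, n₀ ≤ n → ∀ (V : Type) [Fintype V],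
    Fintype.card V = n → ∀ C : Finset V, n ≤ 8 * C.card → n ≤ 8 * Cᶜ.card →
    cnt (fun G => Arr C G ∧ ¬ TwoCliqueColourable G) ≤
      2 ^ (-(Real.logb 2 n ^ 2 / 4000)) * arrCount C := by
  obtain ⟨n₀, h₀⟩ := eventually_atTop.1
    ((lg_tendsto.eventually_ge_atTop ((10:ℝ) ^ 6)).and (eventually_ge_atTop 160))
  refine ⟨n₀, fun n hn V _ hV C hC hC' => ?_⟩
  obtain ⟨hL, hn⟩ := h₀ n hn
  set L := Real.logb 2 n with hLdef
  have hs1 := Nat.le_ceil (1.95 * L)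
  have hs2 := Nat.ceil_lt_add_one (show 0 ≤ 1.95 * L by linarith)
  have hT1 := Nat.le_ceil (0.005 * L)
  have hT2 := Nat.ceil_lt_add_one (show 0 ≤ 0.005 * L by linarith)
  set s := ⌈1.95 * L⌉₊
  set T := ⌈0.005 * L⌉₊
  have hs : 2 ≤ s := by
    have : (2:ℝ) ≤ s := by linarith
    exact_mod_cast this
  have hT : 1 ≤ T := by
    have : (1:ℝ) ≤ T := by linarith
    exact_mod_cast this
  refine (cnt_arr_not_colourable_le (s := s) (T := T) (C := C) (by omega) hs hT).trans
    (mul_le_mul_of_nonneg_right ?_ (arrCount_nonneg C))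
  have hJ : ((T + (s + 1) / 2 + 1 : ℕ) : ℝ) ≤ 0.98 * L + 3 := by
    have h1 : (((s + 1) / 2 : ℕ) : ℝ) ≤ (s + 1 : ℕ) / (2:ℕ) := Nat.cast_div_le
    push_cast at h1 ⊢
    linarith
  have h1 := big_fraction_le (m := Cᶜ.card) (by omega) (hV ▸ Finset.card_le_univ _) hL hs1 hT1
  have h2 := rows_fraction_le hL (by omega) hC hJ
  rw [hV]
  linarith

theorem lg_sq_le_mul {c : ℝ} (hc : 0 < c) : ∀ᶠ n : ℕ in atTop, Real.logb 2 n ^ 2 ≤ c * n := by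
  have hl := Real.log_pos one_lt_two
  have h := (Real.isLittleO_pow_log_id_atTop (n := 2)).comp_tendsto tendsto_natCast_atTop_atTop
  filter_upwards [h.def (c := c * Real.log 2 ^ 2) (by positivity)] with n hn
  simp only [Function.comp, id, Real.norm_eq_abs, Nat.abs_cast] at hn
  rw [Real.logb, div_pow, div_le_iff₀ (by positivity)]
  have := (le_abs_self _).trans hn
  linarith

/-- Few perfect graphs are not clique-colourable. -/
theorem cnt_perfect_not_colourable : ∃ n₀ : ℕ, ∀ n, n₀ ≤ n →
    cnt (fun G : SimpleGraph (Fin n) => IsPerfect G ∧ ¬ TwoCliqueColourable G) ≤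
      2 ^ (-(1 / 5000 * Real.logb 2 n ^ 2)) * nU n := by
  obtain ⟨c, hc, Γ, hΓ, n₁, h₁⟩ := exists_cnt_not_isGenSplit_le
  obtain ⟨n₂, h₂⟩ := cnt_unipolar_and_le
  obtain ⟨n₃, h₃⟩ := cnt_arr_not_colourable
  obtain ⟨n₄, h₄⟩ := cnt_arr_compl_not_colourable
  obtain ⟨n₀, h₀⟩ := eventually_atTop.1
    ((lg_sq_le_mul hc).and ((lg_sq_le_mul one_pos).and
      ((lg_tendsto.eventually_ge_atTop ((10:ℝ) ^ 6)).and
      ((tendsto_natCast_atTop_atTop.eventually_ge_atTop (2 * (Real.logb 2 Γ + 3) / c)).and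
      ((tendsto_natCast_atTop_atTop.eventually_ge_atTop (1000:ℝ)).and
      ((eventually_ge_atTop n₁).and ((eventually_ge_atTop n₂).and
      ((eventually_ge_atTop n₃).and (eventually_ge_atTop n₄)))))))))
  refine ⟨n₀, fun n hn => ?_⟩
  obtain ⟨e1, e2, e3, e4, e5, hn₁, hn₂, hn₃, hn₄⟩ := h₀ n hn
  have b1 := h₁ n hn₁
  have b2 := h₂ n hn₂ (Fin n) (by simp) (fun G => ¬ TwoCliqueColourable G) _ (by positivity)
    fun C hC hC' => h₃ n hn₃ (Fin n) (by simp) C hC hC'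
  have b3 := h₂ n hn₂ (Fin n) (by simp) (fun G => ¬ TwoCliqueColourable Gᶜ) _ (by positivity)
    fun C _ hC' => h₄ n hn₄ (Fin n) (by simp) C hC'
  have b4 : cnt (fun G : SimpleGraph (Fin n) => IsCoUnipolar G ∧ ¬ TwoCliqueColourable G) =
      cnt (fun G : SimpleGraph (Fin n) => IsUnipolar G ∧ ¬ TwoCliqueColourable Gᶜ) :=
    cnt_equiv (Equiv.ofBijective (fun G : SimpleGraph (Fin n) => Gᶜ) compl_bijective) fun G => by
      simp only [Equiv.ofBijective_apply, compl_compl]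
      exact Iff.rfl
  have b5 : cnt (fun G : SimpleGraph (Fin n) => IsPerfect G ∧ ¬ TwoCliqueColourable G) ≤
      cnt (fun G : SimpleGraph (Fin n) => InF G ∧ ¬ IsGenSplit G) +
      (cnt (fun G : SimpleGraph (Fin n) => IsUnipolar G ∧ ¬ TwoCliqueColourable G) +
      cnt (fun G : SimpleGraph (Fin n) => IsCoUnipolar G ∧ ¬ TwoCliqueColourable G)) := by
    refine (cnt_mono ?_).trans ((cnt_or _ _).trans (add_le_add_right (cnt_or _ _) _))
    rintro G ⟨hG, hn⟩
    by_cases hs : IsGenSplit G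
    · exact Or.inr (hs.imp (fun h => ⟨h, hn⟩) fun h => ⟨h, hn⟩)
    · exact Or.inl ⟨hG.inF, hs⟩
  rw [b4] at b5
  set L := Real.logb 2 n
  set t : ℝ := 2 ^ (-(1 / 5000 * L ^ 2)) with ht
  have hL2 : (10:ℝ) ^ 12 ≤ L ^ 2 := by nlinarith
  have hsmall : ∀ x : ℝ, x ≤ -(1 / 5000 * L ^ 2) - 3 → (2:ℝ) ^ x ≤ t / 8 := by
    intro x hx
    refine (Real.rpow_le_rpow_of_exponent_le (by norm_num) hx).trans (le_of_eq ?_)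
    rw [Real.rpow_sub (by norm_num), ht]
    norm_num
  have s1 : (2:ℝ) ^ (-(c * n)) * Γ ≤ t / 8 := by
    have hΓ' : Γ = (2:ℝ) ^ Real.logb 2 Γ :=
      (Real.rpow_logb (by norm_num) (by norm_num) (by linarith)).symm
    have e4' : 2 * (Real.logb 2 Γ + 3) ≤ n * c := (div_le_iff₀ hc).1 e4
    calc (2:ℝ) ^ (-(c * n)) * Γ = (2:ℝ) ^ (-(c * n) + Real.logb 2 Γ) := by
          rw [Real.rpow_add (by norm_num), ← hΓ']
      _ ≤ _ := hsmall _ (by linarith)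
  have s2 : (2:ℝ) ^ (-(L ^ 2 / 4000)) ≤ t / 8 := hsmall _ (by linarith)
  have s3 : (2:ℝ) ^ (-(n:ℝ)) ≤ t / 8 := hsmall _ (by linarith)
  have s4 : (2:ℝ) ^ (-((n:ℝ) / 50)) ≤ t / 8 := hsmall _ (by linarith)
  have hU := nU_pos n
  have ht0 : 0 ≤ t := by positivity
  calc _ ≤ _ := b5
    _ ≤ ((2:ℝ) ^ (-(c * n)) * Γ + ((2 * 2 ^ (-(L ^ 2 / 4000)) + 2 ^ (-(n:ℝ))) +
        (2 * 2 ^ (-((n:ℝ) / 50)) + 2 ^ (-(n:ℝ))))) * nU n := by linarith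
    _ ≤ t * nU n := mul_le_mul_of_nonneg_right (by linarith) (by linarith)

/-- Almost all perfect graphs are 2-clique-colourable, with failure probability at most
`2^{−c log₂² n}`. -/
theorem almost_all_perfect_two_clique_colourable :
    ∃ c : ℝ, 0 < c ∧ ∃ n₀ : ℕ, ∀ n : ℕ, n₀ ≤ n →
      1 - (2 : ℝ) ^ (-(c * (Real.logb 2 n) ^ 2)) ≤
        (Nat.card {G : SimpleGraph (Fin n) // IsPerfect G ∧ TwoCliqueColourable G} : ℝ) /
          (perfectCount n : ℝ) := by
  obtain ⟨n₀, h₀⟩ := cnt_perfect_not_colourable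
  refine ⟨1 / 5000, by norm_num, n₀, fun n hn => ?_⟩
  have hb := h₀ n hn
  have hU := nU_pos n
  have hP := nU_le_perfectCount n
  have hsplit := cnt_and_add_cnt_not (fun G : SimpleGraph (Fin n) => IsPerfect G)
    TwoCliqueColourable
  have e1 : cnt (fun G : SimpleGraph (Fin n) => IsPerfect G) = perfectCount n := rfl
  have e2 : cnt (fun G : SimpleGraph (Fin n) => IsPerfect G ∧ TwoCliqueColourable G) =
      Nat.card {G : SimpleGraph (Fin n) // IsPerfect G ∧ TwoCliqueColourable G} := rfl
  rw [e1, e2] at hsplit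
  rw [le_div_iff₀ (by linarith)]
  have ht : (0:ℝ) ≤ 2 ^ (-(1 / 5000 * Real.logb 2 n ^ 2)) := by positivity
  have := mul_le_mul_of_nonneg_left hP ht
  linarith
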